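/- Let (X_i)_{i≥0} be a stationary Markov chain with invariant measure μ and transition kernel K, and let P_n(f) denote the law of n^{−1/2} Σ_{i=1}^n (f(X_i) − μ(f)). Assume f ∈ C(M,p,μ) for some M > 0 and p ∈ (3,∞], and that α_2(k) = O(k^{−(1+δ)p/(p−3)}) for some δ ∈ (0,1). Then for every concave c : [0,∞) → [0,∞) with c(0) = 0, d_c(P_n(f), G_{σ^2(f)}) = O(c(n^{−δ/2})), where G_{σ^2(f)} is the centered Gaussian law with variance σ^2(μ,K,f). -/

import Mathlib

open MeasureTheory ProbabilityTheory Filter Set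
open scoped ENNReal NNReal Topology

noncomputable section

/-- The intermittent (Liverani–Saussol–Vaienti) map `T_γ` on `[0,1]`. -/
def Tmap (γ : ℝ) (x : ℝ) : ℝ :=
  if x < 1/2 then x * (1 + 2 ^ γ * x ^ γ) else 2 * x - 1

/-- `K` is the Perron–Frobenius operator of `T_γ` with respect to `ν`:
`ν(f · g∘T_γ) = ν(K f · g)` for all bounded measurable `f, g`. -/
def IsPFOp (γ : ℝ) (ν : Measure ℝ) (K : (ℝ → ℝ) → ℝ → ℝ) : Prop :=
  ∀ f g : ℝ → ℝ, Measurable f → Measurable g → (∃ C, ∀ x, |f x| ≤ C) →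
    (∃ C, ∀ x, |g x| ≤ C) →
    ∫ x, f x * g (Tmap γ x) ∂ν = ∫ x, (K f) x * g x ∂ν

/-- Birkhoff sums `S_n(f) = ∑_{i=1}^n f ∘ T_γ^i`. -/
def Sn (γ : ℝ) (f : ℝ → ℝ) (n : ℕ) (x : ℝ) : ℝ :=
  ∑ i ∈ Finset.range n, f ((Tmap γ)^[i + 1] x)

/-- The class `H_{α,1}` of `α`-Hölder functions (with constant 1) on `[0,1]`. -/
def Hclass (α : ℝ) : Set (ℝ → ℝ) :=
  {f | ∀ x ∈ Set.Icc (0:ℝ) 1, ∀ y ∈ Set.Icc (0:ℝ) 1, |f x - f y| ≤ |x - y| ^ α}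

/-- `f_t = 1_{(-∞, t]}`. -/
def indic (t : ℝ) : ℝ → ℝ := Set.indicator (Set.Iic t) (fun _ => 1)

/-- Nested operator `K^{(n_1,…,n_k)}(f_1,…,f_k)
= K^{n_1}(f_1 · K^{n_2}(f_2 ⋯ K^{n_k}(f_k)⋯))`, encoded by a list of pairs. -/
def nestedK (K : (ℝ → ℝ) → ℝ → ℝ) : List (ℕ × (ℝ → ℝ)) → ℝ → ℝ
  | [] => fun _ => 1
  | (n, f) :: r => K^[n] (fun x => f x * nestedK K r x)

/-- The list `[(n, f_{t_1}), (n_2, f_{t_2}), …, (n_l, f_{t_l})]`. -/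
def tList (n : ℕ) {l : ℕ} (ns : Fin l → ℕ) (ts : Fin (l + 1) → ℝ) :
    List (ℕ × (ℝ → ℝ)) :=
  (n, indic (ts 0)) :: List.ofFn (fun i : Fin l => (ns i, indic (ts i.succ)))

/-- The coefficient `α_1(n)` for an operator `K` with invariant measure `ν`. -/
def alpha1 (K : (ℝ → ℝ) → ℝ → ℝ) (ν : Measure ℝ) (n : ℕ) : ℝ :=
  ⨆ t : ℝ, ∫ x, |K^[n] (indic t) x - ∫ y, indic t y ∂ν| ∂ν

/-- The dependence coefficient `α_k(n)`. -/
def alphaCoef (K : (ℝ → ℝ) → ℝ → ℝ) (ν : Measure ℝ) (k n : ℕ) : ℝ :=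
  max (alpha1 K ν n)
    (⨆ j : Fin (k - 1), ⨆ ns : {m : Fin (j.1 + 1) → ℕ // ∀ i, 1 ≤ m i},
      ⨆ ts : Fin (j.1 + 2) → ℝ,
        ∫ x, |nestedK K (tList n ns.1 ts) x - ∫ y, nestedK K (tList n ns.1 ts) y ∂ν| ∂ν)

/-- The dependence coefficient `β_1(n)`. -/
def beta1 (K : (ℝ → ℝ) → ℝ → ℝ) (ν : Measure ℝ) (n : ℕ) : ℝ :=
  ∫ x, (⨆ t : ℝ, |K^[n] (indic t) x - ∫ y, indic t y ∂ν|) ∂ν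

/-- The dependence coefficient `β_k(n)`. -/
def betaCoef (K : (ℝ → ℝ) → ℝ → ℝ) (ν : Measure ℝ) (k n : ℕ) : ℝ :=
  max (beta1 K ν n)
    (⨆ j : Fin (k - 1), ⨆ ns : {m : Fin (j.1 + 1) → ℕ // ∀ i, 1 ≤ m i},
      ∫ x, (⨆ ts : Fin (j.1 + 2) → ℝ,
        |nestedK K (tList n ns.1 ts) x - ∫ y, nestedK K (tList n ns.1 ts) y ∂ν|) ∂ν)

/-- The operator associated with a Markov transition kernel: `(Kg)(x) = ∫ g(y) K(x,dy)`. -/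
def Kop (K : Kernel ℝ ℝ) (g : ℝ → ℝ) : ℝ → ℝ := fun x => ∫ y, g y ∂(K x)

/-- The class `Mon(M,p,μ)` of monotonic functions on an open interval, vanishing
elsewhere, with tail condition `μ(|g|>t) ≤ M^p t^{-p}` (for `p < ∞`),
resp. `μ(|g|>M) = 0` (for `p = ∞`). -/
def Mon (M : ℝ) (p : ℝ≥0∞) (μ : Measure ℝ) (g : ℝ → ℝ) : Prop :=
  (∃ I : Set ℝ, IsOpen I ∧ I.OrdConnected ∧ (MonotoneOn g I ∨ AntitoneOn g I) ∧
      ∀ x ∉ I, g x = 0) ∧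
  (if p = ∞ then μ {x | M < |g x|} = 0
   else ∀ t : ℝ, 0 < t →
      μ {x | t < |g x|} ≤ ENNReal.ofReal (M ^ p.toReal * t ^ (-p.toReal)))

/-- The class `C(M,p,μ)`: the closure in `L¹(μ)` of convex-type combinations
`∑ a_i g_i`, `∑ |a_i| ≤ 1`, `g_i ∈ Mon(M,p,μ)`. -/
def ClassC (M : ℝ) (p : ℝ≥0∞) (μ : Measure ℝ) (f : ℝ → ℝ) : Prop :=
  Integrable f μ ∧ ∀ ε : ℝ, 0 < ε → ∃ (n : ℕ) (a : Fin n → ℝ) (g : Fin n → ℝ → ℝ),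
    (∑ i, |a i|) ≤ 1 ∧ (∀ i, Mon M p μ (g i)) ∧
    ∫ x, |f x - ∑ i, a i * g i x| ∂μ < ε

/-- The class `Lip_c` of functions `g` with `|g(x) − g(y)| ≤ c(|x−y|)`. -/
def LipC (c : ℝ → ℝ) : Set (ℝ → ℝ) := {g | ∀ x y : ℝ, |g x - g y| ≤ c |x - y|}

/-- The distance `d_c(P,Q) = sup_{g ∈ Lip_c} |P(g) − Q(g)|`. -/
def dC (c : ℝ → ℝ) (P Q : Measure ℝ) : ℝ :=
  ⨆ g : LipC c, |(∫ x, (g : ℝ → ℝ) x ∂P) - ∫ x, (g : ℝ → ℝ) x ∂Q|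


lemma rpow_neg_le_rpow_sub_rpow {s : ℝ} (hs : s ∈ Ioo (0:ℝ) 1) {x : ℝ} (hx : 1 ≤ x) :
    (1 - s) * x ^ (-s) ≤ x ^ (1 - s) - (x - 1) ^ (1 - s) := by
  have hx0 : 0 < x := by linarith
  have hxi : x⁻¹ ≤ 1 := inv_le_one_of_one_le₀ hx
  have h1 : (1 + (-x⁻¹)) ^ (1 - s) ≤ 1 + (1 - s) * (-x⁻¹) :=
    rpow_one_add_le_one_add_mul_self (by linarith) (by linarith [hs.2]) (by linarith [hs.1])
  have h2 : (x - 1) ^ (1 - s) = x ^ (1 - s) * (1 + (-x⁻¹)) ^ (1 - s) := by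
    rw [← Real.mul_rpow hx0.le (by linarith)]
    congr 1
    field_simp
    ring
  have h3 : x ^ (-s) = x ^ (1 - s) * x⁻¹ := by
    rw [← Real.rpow_neg_one x, ← Real.rpow_add hx0]
    congr 1
    ring
  rw [h2, h3]
  have := mul_le_mul_of_nonneg_left h1 (Real.rpow_nonneg hx0.le (1 - s))
  linarith

lemma sum_range_rpow_neg_le {s : ℝ} (hs : s ∈ Ioo (0:ℝ) 1) (n : ℕ) :
    ∑ k ∈ Finset.range n, ((k:ℝ) + 1) ^ (-s) ≤ (1 - s)⁻¹ * (n:ℝ) ^ (1 - s) := by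
  have h1s : 0 < 1 - s := by linarith [hs.2]
  induction n with
  | zero => simp [Real.zero_rpow h1s.ne']
  | succ n ih =>
    rw [Finset.sum_range_succ]
    have h := rpow_neg_le_rpow_sub_rpow hs (x := (n:ℝ) + 1) (by simp)
    rw [add_sub_cancel_right] at h
    have h' : ((n:ℝ) + 1) ^ (-s) ≤ (1 - s)⁻¹ * (((n:ℝ) + 1) ^ (1 - s) - (n:ℝ) ^ (1 - s)) := by
      rw [inv_mul_eq_div, le_div_iff₀ h1s]
      linarith
    push_cast
    linarith

lemma rpow_neg_one_add_le {δ : ℝ} (hδ : δ ∈ Ioo (0:ℝ) 1) {x : ℝ} (hx : 1 ≤ x) :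
    x ^ (-(1 + δ)) ≤ 4 / δ * (x ^ (-δ) - (x + 1) ^ (-δ)) := by
  have hx0 : 0 < x := by linarith
  have hy0 : 0 < x + 1 := by linarith
  have hyi : (x + 1)⁻¹ ≤ 1 := inv_le_one_of_one_le₀ (by linarith)
  have hyi0 : 0 < (x + 1)⁻¹ := by positivity
  have hyi' : (x + 1)⁻¹ < 1 := inv_lt_one_of_one_lt₀ (by linarith)
  have hδ0 := hδ.1
  have h1 : (1 + (-(x + 1)⁻¹)) ^ δ ≤ 1 + δ * (-(x + 1)⁻¹) :=
    rpow_one_add_le_one_add_mul_self (by linarith) hδ.1.le hδ.2.le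
  have hb : 0 < 1 + (-(x + 1)⁻¹) := by linarith
  have h2 : x ^ (-δ) = (x + 1) ^ (-δ) * ((1 + (-(x + 1)⁻¹)) ^ δ)⁻¹ := by
    rw [← Real.rpow_neg hb.le, ← Real.mul_rpow hy0.le hb.le]
    congr 1
    field_simp
    ring
  have h3 : 1 + δ * (x + 1)⁻¹ ≤ ((1 + (-(x + 1)⁻¹)) ^ δ)⁻¹ := by
    have hpos : 0 < (1 + (-(x + 1)⁻¹)) ^ δ := Real.rpow_pos_of_pos hb _
    rw [le_inv_comm₀ (by positivity) hpos]
    refine h1.trans ?_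
    have hpos' : 0 < 1 + δ * (x + 1)⁻¹ := by positivity
    rw [inv_eq_one_div (1 + δ * (x + 1)⁻¹), le_div_iff₀ hpos']
    nlinarith [sq_nonneg (δ * (x + 1)⁻¹)]
  have h4 : δ * (x + 1) ^ (-(1 + δ)) ≤ x ^ (-δ) - (x + 1) ^ (-δ) := by
    have : (x + 1) ^ (-(1 + δ)) = (x + 1) ^ (-δ) * (x + 1)⁻¹ := by
      rw [← Real.rpow_neg_one (x + 1), ← Real.rpow_add hy0]
      congr 1
      ring
    rw [h2, this]
    have := mul_le_mul_of_nonneg_left h3 (Real.rpow_nonneg hy0.le (-δ))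
    linarith
  have h5 : x ^ (-(1 + δ)) ≤ 4 * (x + 1) ^ (-(1 + δ)) := by
    have h6 : (2 * x) ^ (-(1 + δ)) ≤ (x + 1) ^ (-(1 + δ)) :=
      Real.rpow_le_rpow_of_nonpos hy0 (by linarith) (by linarith)
    rw [Real.mul_rpow (by norm_num) hx0.le] at h6
    have h7 : (2:ℝ) ^ (-(2:ℝ)) ≤ 2 ^ (-(1 + δ)) :=
      Real.rpow_le_rpow_of_exponent_le (by norm_num) (by linarith [hδ.2])
    have h8 : (2:ℝ) ^ (-(2:ℝ)) = 1 / 4 := by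
      rw [Real.rpow_neg (by norm_num)]
      norm_num
    rw [h8] at h7
    have h9 := mul_le_mul_of_nonneg_right h7 (Real.rpow_nonneg hx0.le (-(1 + δ)))
    linarith
  rw [div_mul_eq_mul_div, le_div_iff₀ hδ0]
  nlinarith

lemma sum_range_rpow_neg_one_add_le {δ : ℝ} (hδ : δ ∈ Ioo (0:ℝ) 1) (N n : ℕ) :
    ∑ i ∈ Finset.range n, ((i + N : ℕ) + 1 : ℝ) ^ (-(1 + δ)) ≤
      4 / δ * (((N:ℝ) + 1) ^ (-δ) - ((n + N : ℕ) + 1 : ℝ) ^ (-δ)) := by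
  induction n with
  | zero => simp
  | succ n ih =>
    rw [Finset.sum_range_succ]
    have h := rpow_neg_one_add_le hδ (x := ((n + N : ℕ) : ℝ) + 1)
      (le_add_of_nonneg_left (Nat.cast_nonneg _))
    have h' : ((n + N : ℕ) : ℝ) + 1 + 1 = ((n + 1 + N : ℕ) : ℝ) + 1 := by push_cast; ring
    rw [h'] at h
    linarith

lemma summable_rpow_neg_one_add {δ : ℝ} (hδ : δ ∈ Ioo (0:ℝ) 1) :
    Summable fun i : ℕ => ((i:ℝ) + 1) ^ (-(1 + δ)) := by
  refine summable_of_sum_range_le (c := 4 / δ) (fun i => by positivity) fun n => ?_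
  have h := sum_range_rpow_neg_one_add_le hδ 0 n
  have hpos : 0 ≤ 4 / δ * ((n + 0 : ℕ) + 1 : ℝ) ^ (-δ) := by
    have := hδ.1
    positivity
  simp only [add_zero, Nat.cast_zero, zero_add, Real.one_rpow] at h hpos
  linarith

lemma tsum_rpow_neg_one_add_le {δ : ℝ} (hδ : δ ∈ Ioo (0:ℝ) 1) (N : ℕ) :
    ∑' i : ℕ, ((i + N : ℕ) + 1 : ℝ) ^ (-(1 + δ)) ≤ 4 / δ * ((N:ℝ) + 1) ^ (-δ) := by
  refine ((summable_nat_add_iff N).2 (summable_rpow_neg_one_add hδ)).tsum_le_of_sum_range_le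
    fun n => ?_
  have h := sum_range_rpow_neg_one_add_le hδ N n
  have hpos : 0 ≤ 4 / δ * ((n + N : ℕ) + 1 : ℝ) ^ (-δ) := by
    have := hδ.1
    positivity
  linarith

/-- The convolution of `h` with the centred Gaussian law of variance `v`. -/
def gaussSmooth (v : ℝ≥0) (h : ℝ → ℝ) (x : ℝ) : ℝ := ∫ y, h (x + y) ∂gaussianReal 0 v

lemma LipschitzWith.integrable_of_integrable_id {K : ℝ≥0} {h : ℝ → ℝ} (hh : LipschitzWith K h)
    {ν : Measure ℝ} [IsFiniteMeasure ν] (hν : Integrable (fun x => x) ν) : Integrable h ν := by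
  refine Integrable.mono' ((integrable_const |h 0|).add (hν.abs.const_mul (K:ℝ)))
    hh.continuous.aestronglyMeasurable (ae_of_all _ fun x => ?_)
  have h1 := hh.dist_le_mul x 0
  rw [Real.dist_eq, Real.dist_eq, sub_zero] at h1
  have h2 := abs_sub_abs_le_abs_sub (h x) (h 0)
  simp only [Pi.add_apply, Real.norm_eq_abs]
  linarith

lemma integrable_id_gaussianReal (m : ℝ) (v : ℝ≥0) : Integrable (fun x => x) (gaussianReal m v) :=
  (memLp_id_gaussianReal (μ := m) (v := v) 1).integrable le_rfl

lemma integrable_pow_gaussianReal (m : ℝ) (v : ℝ≥0) (n : ℕ) :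
    Integrable (fun x => |x| ^ n) (gaussianReal m v) :=
  (memLp_id_gaussianReal (μ := m) (v := v) n).integrable_norm_pow'

lemma integral_sq_gaussianReal (v : ℝ≥0) : ∫ y, y ^ 2 ∂gaussianReal 0 v = v := by
  have h := variance_fun_id_gaussianReal (μ := 0) (v := v)
  rw [variance_eq_integral (by fun_prop)] at h
  simpa [integral_id_gaussianReal] using h

lemma integral_abs_gaussianReal_le (v : ℝ≥0) : ∫ y, |y| ∂gaussianReal 0 v ≤ √v := by
  have h := variance_nonneg (fun y : ℝ => |y|) (gaussianReal 0 v)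
  have hm : MemLp (fun y : ℝ => |y|) 2 (gaussianReal 0 v) :=
    (memLp_id_gaussianReal (μ := 0) (v := v) 2).abs
  rw [variance_eq_sub hm] at h
  simp only [Pi.pow_apply, sq_abs, integral_sq_gaussianReal] at h
  exact Real.le_sqrt_of_sq_le (by linarith)

lemma lipschitzWith_comp_const_add {K : ℝ≥0} {h : ℝ → ℝ} (hh : LipschitzWith K h) (x : ℝ) :
    LipschitzWith K fun y => h (x + y) := by
  refine LipschitzWith.of_dist_le_mul fun y z => ?_
  simpa using hh.dist_le_mul (x + y) (x + z)

lemma LipschitzWith.integrable_gaussianReal {K : ℝ≥0} {h : ℝ → ℝ} (hh : LipschitzWith K h)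
    (m : ℝ) (v : ℝ≥0) : Integrable h (gaussianReal m v) :=
  hh.integrable_of_integrable_id (integrable_id_gaussianReal m v)

lemma LipschitzWith.gaussSmooth {K : ℝ≥0} {h : ℝ → ℝ} (hh : LipschitzWith K h) (v : ℝ≥0) :
    LipschitzWith K (gaussSmooth v h) := by
  refine LipschitzWith.of_dist_le_mul fun x y => ?_
  have hi := fun x => (lipschitzWith_comp_const_add hh x).integrable_gaussianReal 0 v
  rw [Real.dist_eq, _root_.gaussSmooth, _root_.gaussSmooth, ← integral_sub (hi x) (hi y),
    ← Real.norm_eq_abs]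
  refine (norm_integral_le_of_norm_le_const (C := K * dist x y) (ae_of_all _ fun z => ?_)).trans
    (by simp)
  simpa [Real.dist_eq] using hh.dist_le_mul (x + z) (y + z)

lemma gaussSmooth_add {K : ℝ≥0} {h : ℝ → ℝ} (hh : LipschitzWith K h) (v w : ℝ≥0) :
    gaussSmooth (v + w) h = gaussSmooth v (gaussSmooth w h) := by
  ext x
  have hc : gaussianReal 0 (v + w) = gaussianReal 0 v ∗ gaussianReal 0 w := by
    rw [gaussianReal_conv_gaussianReal, add_zero]
  have hi := (lipschitzWith_comp_const_add hh x).integrable_gaussianReal 0 (v + w)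
  unfold gaussSmooth
  rw [hc] at hi ⊢
  rw [integral_conv hi]
  simp only [add_assoc]

lemma abs_gaussSmooth_le {h : ℝ → ℝ} {C : ℝ} (hC : ∀ x, |h x| ≤ C) (v : ℝ≥0) (x : ℝ) :
    |gaussSmooth v h x| ≤ C := by
  rw [gaussSmooth, ← Real.norm_eq_abs]
  exact (norm_integral_le_of_norm_le_const (ae_of_all _ fun z => hC (x + z))).trans (by simp)

lemma abs_gaussSmooth_sub_le {h : ℝ → ℝ} (hh : LipschitzWith 1 h) (v : ℝ≥0) (x : ℝ) :
    |gaussSmooth v h x - h x| ≤ √v := by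
  have hi := (lipschitzWith_comp_const_add hh x).integrable_gaussianReal 0 v
  have : gaussSmooth v h x - h x = ∫ y, (h (x + y) - h x) ∂gaussianReal 0 v := by
    rw [integral_sub hi (integrable_const _), gaussSmooth]
    simp
  rw [this]
  refine abs_integral_le_integral_abs.trans (le_trans ?_ (integral_abs_gaussianReal_le v))
  refine integral_mono (hi.sub (integrable_const _)).abs (integrable_id_gaussianReal 0 v).abs
    fun y => ?_
  simpa [Real.dist_eq] using hh.dist_le_mul (x + y) x

lemma gaussSmooth_eq_integral {v : ℝ≥0} (hv : v ≠ 0) (h : ℝ → ℝ) (x : ℝ) :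
    gaussSmooth v h x = ∫ y, gaussianPDFReal x v y * h y := by
  have hx : gaussianReal x v = (gaussianReal 0 v).map (fun y => x + y) := by
    rw [gaussianReal_map_const_add, zero_add]
  have h1 := integral_gaussianReal_eq_integral_smul (μ := x) (f := h) hv
  rw [hx, (measurableEmbedding_addLeft x).integral_map] at h1
  simpa [gaussSmooth] using h1

lemma integrable_quadratic_mul_exp {b : ℝ} (hb : 0 < b) (a₀ a₁ a₂ m : ℝ) :
    Integrable fun y : ℝ => (a₀ + a₁ * |y - m| + a₂ * |y - m| ^ 2) * Real.exp (-b * (y - m) ^ 2) := by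
  have h0 := (integrable_exp_neg_mul_sq hb).const_mul a₀
  have h1 := (integrable_mul_exp_neg_mul_sq hb).abs.const_mul a₁
  have h2 := (integrable_rpow_mul_exp_neg_mul_sq hb (s := 2) (by norm_num)).const_mul a₂
  refine (((h0.add h1).add h2).comp_sub_right m).congr (ae_of_all _ fun y => ?_)
  simp only [Pi.add_apply, abs_mul, Real.abs_exp, Real.rpow_two, sq_abs]
  ring

lemma hasDerivAt_gaussianPDFReal {v : ℝ≥0} (hv : v ≠ 0) (x y : ℝ) :
    HasDerivAt (fun x => gaussianPDFReal x v y) (gaussianPDFReal x v y * ((y - x) / v)) x := by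
  have hv' : (v:ℝ) ≠ 0 := by exact_mod_cast hv
  simp only [gaussianPDFReal]
  have h1 : HasDerivAt (fun x : ℝ => -(y - x) ^ 2 / (2 * v)) ((y - x) / v) x := by
    have := ((((hasDerivAt_id x).const_sub y).pow 2).neg).div_const (2 * (v:ℝ))
    refine this.congr_deriv ?_
    simp only [id, Nat.cast_ofNat]
    field_simp
    ring
  refine (h1.exp.const_mul (√(2 * Real.pi * v))⁻¹).congr_deriv ?_
  ring

lemma gaussianPDFReal_le_of_abs_sub_le {v : ℝ≥0} (hv : v ≠ 0) {x m : ℝ} (hx : |x - m| ≤ 1)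
    (y : ℝ) : gaussianPDFReal x v y ≤
      (√(2 * Real.pi * v))⁻¹ * Real.exp (1 / (2 * v)) * Real.exp (-(1 / (4 * v)) * (y - m) ^ 2) := by
  have hv' : (0:ℝ) < v := by positivity
  rw [gaussianPDFReal, mul_assoc (√(2 * Real.pi * v))⁻¹, ← Real.exp_add]
  gcongr
  have h1 : (x - m) ^ 2 ≤ 1 := by
    rw [← sq_abs]
    exact pow_le_one₀ (abs_nonneg _) hx
  have h2 : (y - m) ^ 2 ≤ 2 * (y - x) ^ 2 + 2 := by nlinarith [sq_nonneg (y - x - (x - m))]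
  have h3 : -(y - x) ^ 2 / (2 * v) = (-(2 * (y - x) ^ 2)) / (4 * v) := by field_simp; ring
  have h4 : 1 / (2 * (v:ℝ)) + -(1 / (4 * v)) * (y - m) ^ 2 = (2 - (y - m) ^ 2) / (4 * v) := by
    field_simp
    ring
  rw [h3, h4]
  gcongr
  linarith

/-- Differentiation of a Gaussian convolution by moving the derivative to the density. -/
lemma hasDerivAt_gaussSmooth {v : ℝ≥0} (hv : v ≠ 0) {G : ℝ → ℝ} (hG : Measurable G) {A D : ℝ}
    (hD : 0 ≤ D) (hGb : ∀ y, |G y| ≤ A + D * |y|) (x : ℝ) :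
    HasDerivAt (gaussSmooth v G) (gaussSmooth v (fun y => G y * ((y - x) / v)) x) x := by
  have hv' : (0:ℝ) < v := by positivity
  have hA : 0 ≤ A := by simpa using (abs_nonneg _).trans (hGb 0)
  have hfun : gaussSmooth v G = fun x => ∫ y, gaussianPDFReal x v y * G y :=
    funext fun x => gaussSmooth_eq_integral hv G x
  rw [gaussSmooth_eq_integral hv, hfun]
  set c := (√(2 * Real.pi * v))⁻¹ * Real.exp (1 / (2 * v)) with hc
  have hc0 : 0 ≤ c := by positivity
  set A' := A + D * |x| with hA'
  have hA0 : 0 ≤ A' := by positivity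
  have hGb' : ∀ y, |G y| ≤ A' + D * |y - x| := fun y => by
    have h1 : |y| ≤ |y - x| + |x| := by simpa using abs_add_le (y - x) x
    nlinarith [hGb y, mul_le_mul_of_nonneg_left h1 hD]
  have hb : (0:ℝ) < 1 / (4 * v) := by positivity
  have hpdf : ∀ z, |z - x| ≤ 1 → ∀ y, |gaussianPDFReal z v y| ≤
      c * Real.exp (-(1 / (4 * v)) * (y - x) ^ 2) := fun z hz y => by
    rw [abs_of_nonneg (gaussianPDFReal_nonneg _ _ _)]
    exact gaussianPDFReal_le_of_abs_sub_le hv hz y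
  refine ((hasDerivAt_integral_of_dominated_loc_of_deriv_le
    (F := fun x y => gaussianPDFReal x v y * G y)
    (F' := fun x y => gaussianPDFReal x v y * ((y - x) / v) * G y)
    (bound := fun y => c / v * (((A' + (A' + D) * |y - x| + D * |y - x| ^ 2)) *
      Real.exp (-(1 / (4 * v)) * (y - x) ^ 2)))
    (Metric.closedBall_mem_nhds x one_pos) ?_ ?_ ?_ ?_ ?_ ?_).2).congr_deriv ?_
  · exact Eventually.of_forall fun z =>
      ((measurable_gaussianPDFReal z v).mul hG).aestronglyMeasurable
  · refine Integrable.mono' ((integrable_quadratic_mul_exp hb A' D 0 x).const_mul c)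
      ((measurable_gaussianPDFReal x v).mul hG).aestronglyMeasurable (ae_of_all _ fun y => ?_)
    rw [Real.norm_eq_abs, abs_mul]
    refine (mul_le_mul (hpdf x (by simp) y) (hGb' y) (abs_nonneg _) (by positivity)).trans_eq ?_
    ring
  · exact (((measurable_gaussianPDFReal x v).mul (by fun_prop)).mul hG).aestronglyMeasurable
  · refine ae_of_all _ fun y z hz => ?_
    rw [Metric.mem_closedBall, Real.dist_eq] at hz
    rw [Real.norm_eq_abs, abs_mul, abs_mul, abs_div, abs_of_pos hv']
    have h1 : |y - z| ≤ 1 + |y - x| := by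
      have := abs_sub_le y x z
      rw [abs_sub_comm x z] at this
      linarith
    have h2 : |y - z| / v ≤ (1 + |y - x|) / v := by gcongr
    refine (mul_le_mul (mul_le_mul (hpdf z hz y) h2 (by positivity) (by positivity)) (hGb' y)
      (abs_nonneg _) (by positivity)).trans_eq ?_
    ring
  · exact (integrable_quadratic_mul_exp hb _ _ _ x).const_mul _
  · exact ae_of_all _ fun y z _ => (hasDerivAt_gaussianPDFReal hv z y).mul_const (G y)
  · exact integral_congr_ae (ae_of_all _ fun y => by ring)

lemma abs_gaussSmooth_mul_le {v : ℝ≥0} (hv : v ≠ 0) {G : ℝ → ℝ} {C : ℝ}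
    (hGb : ∀ y, |G y| ≤ C) (x : ℝ) :
    |gaussSmooth v (fun y => G y * ((y - x) / v)) x| ≤ C / √v := by
  have hv' : (0:ℝ) < v := by positivity
  have hC : 0 ≤ C := (abs_nonneg _).trans (hGb 0)
  have hi := (integrable_id_gaussianReal 0 v).abs
  rw [gaussSmooth]
  calc |∫ y, G (x + y) * ((x + y - x) / v) ∂gaussianReal 0 v|
      ≤ ∫ y, C / v * |y| ∂gaussianReal 0 v := by
        rw [← Real.norm_eq_abs]
        refine norm_integral_le_of_norm_le (hi.const_mul _) (ae_of_all _ fun y => ?_)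
        rw [add_sub_cancel_left, Real.norm_eq_abs, abs_mul, abs_div, abs_of_pos hv',
          div_mul_eq_mul_div, mul_div_assoc]
        exact mul_le_mul_of_nonneg_right (hGb _) (by positivity)
    _ ≤ C / v * √v := by
        rw [integral_const_mul]
        exact mul_le_mul_of_nonneg_left (integral_abs_gaussianReal_le v) (by positivity)
    _ = C / √v := by
        rw [div_mul_eq_mul_div, div_eq_div_iff hv'.ne' (by positivity), mul_assoc,
          Real.mul_self_sqrt hv'.le]

/-- Differentiation of a Gaussian convolution by moving the derivative to the function. -/
lemma hasDerivAt_gaussSmooth_of_hasDerivAt (v : ℝ≥0) {H H' : ℝ → ℝ}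
    (hd : ∀ x, HasDerivAt H (H' x) x) {C : ℝ≥0} (hb : ∀ x, |H' x| ≤ C) (x : ℝ) :
    HasDerivAt (gaussSmooth v H) (gaussSmooth v H' x) x := by
  have hL : LipschitzWith C H := by
    refine lipschitzWith_of_nnnorm_deriv_le (fun x => (hd x).differentiableAt) fun x => ?_
    rw [(hd x).deriv, ← NNReal.coe_le_coe]
    simpa using hb x
  have hm : Measurable H' := by
    have : H' = deriv H := funext fun x => (hd x).deriv.symm
    rw [this]
    exact measurable_deriv H
  refine (hasDerivAt_integral_of_dominated_loc_of_deriv_le (F := fun x y => H (x + y))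
    (F' := fun x y => H' (x + y)) (bound := fun _ => (C:ℝ)) univ_mem ?_ ?_ ?_ ?_ ?_ ?_).2
  · exact Eventually.of_forall fun z =>
      (lipschitzWith_comp_const_add hL z).continuous.aestronglyMeasurable
  · exact (lipschitzWith_comp_const_add hL x).integrable_gaussianReal 0 v
  · exact (hm.comp (measurable_const_add x)).aestronglyMeasurable
  · exact ae_of_all _ fun y z _ => hb _
  · exact integrable_const _
  · exact ae_of_all _ fun y z _ => (hd (z + y)).comp_add_const z y

/-- A Gaussian convolution of a Lipschitz function has controlled derivatives up to order three. -/
theorem exists_derivs_gaussSmooth {h : ℝ → ℝ} (hh : LipschitzWith 1 h) {v : ℝ≥0} (hv : v ≠ 0) :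
    ∃ A B : ℝ → ℝ, (∀ x, HasDerivAt (gaussSmooth v h) (A x) x) ∧ (∀ x, HasDerivAt A (B x) x) ∧
      (∀ x, |A x| ≤ 1) ∧ (∀ x, |B x| ≤ 2 / √v) ∧ ∀ x y, |B x - B y| ≤ 3 / v * |x - y| := by
  have hv' : (0:ℝ) < v := by positivity
  set w : ℝ≥0 := v / 3 with hw
  have hw0 : w ≠ 0 := by positivity
  have hwv : (w:ℝ) = v / 3 := by simp [hw]
  have hvw : v = w + (w + w) := by
    ext
    push_cast [hwv]
    ring
  have hw' : (0:ℝ) < w := by positivity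
  have hsw : 0 < √(w:ℝ) := by positivity
  set u := gaussSmooth w h with hu
  have hul : LipschitzWith 1 u := hh.gaussSmooth w
  have hgrow : ∀ y, |h y| ≤ |h 0| + 1 * |y| := fun y => by
    have h1 := hh.dist_le_mul y 0
    rw [Real.dist_eq, Real.dist_eq, sub_zero] at h1
    have h2 := abs_sub_abs_le_abs_sub (h y) (h 0)
    push_cast at h1
    linarith
  set A₁ := fun x => gaussSmooth w (fun y => h y * ((y - x) / w)) x with hA₁
  have hd1 : ∀ x, HasDerivAt u (A₁ x) x :=
    hasDerivAt_gaussSmooth hw0 hh.continuous.measurable zero_le_one hgrow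
  have hb1 : ∀ x, |A₁ x| ≤ (1:ℝ≥0) := fun x => by
    simpa using (hd1 x).le_of_lipschitz hul
  have hm1 : Measurable A₁ := by
    have : A₁ = deriv u := funext fun x => (hd1 x).deriv.symm
    rw [this]
    exact measurable_deriv u
  set A₂ := gaussSmooth w A₁ with hA₂
  have hd2 : ∀ x, HasDerivAt (gaussSmooth w u) (A₂ x) x :=
    hasDerivAt_gaussSmooth_of_hasDerivAt w hd1 hb1
  have hb2 : ∀ x, |A₂ x| ≤ (1:ℝ≥0) := abs_gaussSmooth_le hb1 w
  set B₂ := fun x => gaussSmooth w (fun y => A₁ y * ((y - x) / w)) x with hB₂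
  have hd2' : ∀ x, HasDerivAt A₂ (B₂ x) x :=
    hasDerivAt_gaussSmooth hw0 hm1 le_rfl (A := 1) (by simpa using hb1)
  have hbB : ∀ x, |B₂ x| ≤ (1 / √w : ℝ) := abs_gaussSmooth_mul_le hw0 (by simpa using hb1)
  have hmB : Measurable B₂ := by
    have : B₂ = deriv A₂ := funext fun x => (hd2' x).deriv.symm
    rw [this]
    exact measurable_deriv A₂
  have hbB' : ∀ x, |B₂ x| ≤ ((1 / √w).toNNReal : ℝ≥0) := fun x =>
    (hbB x).trans (Real.le_coe_toNNReal _)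
  have heq : gaussSmooth v h = gaussSmooth w (gaussSmooth w u) := by
    rw [hvw, gaussSmooth_add hh, gaussSmooth_add hh]
  refine ⟨gaussSmooth w A₂, gaussSmooth w B₂, ?_, ?_, ?_, ?_, ?_⟩
  · rw [heq]
    exact hasDerivAt_gaussSmooth_of_hasDerivAt w hd2 hb2
  · exact hasDerivAt_gaussSmooth_of_hasDerivAt w hd2' hbB'
  · exact abs_gaussSmooth_le (by simpa using hb2) w
  · intro x
    refine (abs_gaussSmooth_le hbB w x).trans ?_
    rw [div_le_div_iff₀ hsw (by positivity), one_mul, hwv]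
    refine (Real.sqrt_le_sqrt (show (v:ℝ) ≤ 2 ^ 2 * (v / 3) by linarith)).trans_eq ?_
    rw [Real.sqrt_mul (by norm_num), Real.sqrt_sq (by norm_num)]
  · have hd3 : ∀ x, HasDerivAt (gaussSmooth w B₂)
        (gaussSmooth w (fun y => B₂ y * ((y - x) / w)) x) x :=
      hasDerivAt_gaussSmooth hw0 hmB le_rfl (A := 1 / √w) (by simpa using hbB)
    have hb3 : ∀ x, ‖gaussSmooth w (fun y => B₂ y * ((y - x) / w)) x‖ ≤ 3 / v := fun x => by
      refine (abs_gaussSmooth_mul_le hw0 hbB x).trans_eq ?_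
      rw [div_div, Real.mul_self_sqrt hw'.le, hwv, one_div_div]
    intro x y
    exact convex_univ.norm_image_sub_le_of_norm_hasDerivWithin_le
      (fun z _ => (hd3 z).hasDerivWithinAt) (fun z _ => hb3 z) (mem_univ y) (mem_univ x)

lemma abs_sub_sub_le_of_lipschitz_deriv {A B : ℝ → ℝ} (hA : ∀ x, HasDerivAt A (B x) x) {L : ℝ}
    (hL : 0 ≤ L) (hB : ∀ x y, |B x - B y| ≤ L * |x - y|) (x y : ℝ) :
    |A (x + y) - A x - B x * y| ≤ L * y ^ 2 := by
  have hseg : ∀ z ∈ segment ℝ x (x + y), |z - x| ≤ |y| := fun z hz => by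
    simpa using norm_sub_le_of_mem_segment hz
  have h := (convex_segment x (x + y)).norm_image_sub_le_of_norm_hasDerivWithin_le
    (f := fun z => A z - B x * z) (f' := fun z => B z - B x * 1) (C := L * |y|)
    (fun z _ => ((hA z).sub ((hasDerivAt_id z).const_mul (B x))).hasDerivWithinAt)
    (fun z hz => by
      rw [mul_one, Real.norm_eq_abs]
      exact (hB z x).trans (mul_le_mul_of_nonneg_left (hseg z hz) hL))
    (left_mem_segment ℝ x (x + y)) (right_mem_segment ℝ x (x + y))
  rw [Real.norm_eq_abs, Real.norm_eq_abs, add_sub_cancel_left, mul_assoc, ← sq, sq_abs] at h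
  convert h using 2
  ring

lemma abs_sub_sub_sub_le_of_lipschitz_deriv {u A B : ℝ → ℝ} (hu : ∀ x, HasDerivAt u (A x) x)
    (hA : ∀ x, HasDerivAt A (B x) x) {L : ℝ}
    (hL : 0 ≤ L) (hB : ∀ x y, |B x - B y| ≤ L * |x - y|) (x y : ℝ) :
    |u (x + y) - u x - A x * y - B x * y ^ 2 / 2| ≤ L * |y| ^ 3 := by
  have hseg : ∀ z ∈ segment ℝ x (x + y), |z - x| ≤ |y| := fun z hz => by
    simpa using norm_sub_le_of_mem_segment hz
  have hd : ∀ z, HasDerivAt (fun z => u z - A x * z - B x * ((z - x) ^ 2 / 2))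
      (A z - A x - B x * (z - x)) z := fun z => by
    refine (((hu z).sub ((hasDerivAt_id z).const_mul (A x))).sub
      (((((hasDerivAt_id z).sub_const x).pow 2).div_const 2).const_mul (B x))).congr_deriv ?_
    simp only [id, Nat.cast_ofNat]
    ring
  have h := (convex_segment x (x + y)).norm_image_sub_le_of_norm_hasDerivWithin_le
    (C := L * |y| ^ 2) (fun z _ => (hd z).hasDerivWithinAt)
    (fun z hz => by
      have h1 := abs_sub_sub_le_of_lipschitz_deriv hA hL hB x (z - x)
      rw [add_sub_cancel] at h1
      refine h1.trans (mul_le_mul_of_nonneg_left ?_ hL)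
      rw [← sq_abs]
      exact pow_le_pow_left₀ (abs_nonneg _) (hseg z hz) 2)
    (left_mem_segment ℝ x (x + y)) (right_mem_segment ℝ x (x + y))
  rw [Real.norm_eq_abs, Real.norm_eq_abs, add_sub_cancel_left, mul_assoc, ← pow_succ] at h
  convert h using 2
  ring

/-- A centred adapted sequence with three moments, stationary covariances `γ`, and polynomial
decay of the dependence between the past and one or two future values. -/
structure WeakDep {Ω : Type*} [m0 : MeasurableSpace Ω] (P : Measure Ω) (Y : ℕ → Ω → ℝ)
    (𝓕 : ℕ → MeasurableSpace Ω) (γ : ℕ → ℝ) (C δ : ℝ) : Prop where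
  mono : Monotone 𝓕
  le : ∀ i, 𝓕 i ≤ m0
  meas : ∀ i, Measurable[𝓕 i] (Y i)
  integrable_cube : ∀ i, Integrable (fun ω => |Y i ω| ^ 3) P
  cube_le : ∀ i, ∫ ω, |Y i ω| ^ 3 ∂P ≤ C
  mean : ∀ i, ∫ ω, Y i ω ∂P = 0
  cov : ∀ b i, ∫ ω, Y b ω * Y (b + i) ω ∂P = γ i
  decay : ∀ i : ℕ, |γ i| ≤ C * ((i:ℝ) + 1) ^ (-(1 + δ))
  dep₁ : ∀ (a d : ℕ) (ρ : Ω → ℝ) (r : ℝ), Measurable[𝓕 a] ρ → (∀ ω, |ρ ω| ≤ r) →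
    |∫ ω, ρ ω * Y (a + d + 1) ω ∂P| ≤ r * (C * ((d:ℝ) + 1) ^ (-(1 + δ)))
  dep₂ : ∀ (a d : ℕ) (ρ : Ω → ℝ) (r : ℝ), Measurable[𝓕 a] ρ → (∀ ω, |ρ ω| ≤ r) →
    |∫ ω, ρ ω * (Y a ω ^ 2 * Y (a + d + 1) ω) ∂P| ≤ r * (C * ((d:ℝ) + 1) ^ (-(1 + δ)))
  dep₃ : ∀ (a d i : ℕ) (ρ : Ω → ℝ) (r : ℝ), Measurable[𝓕 a] ρ → (∀ ω, |ρ ω| ≤ r) →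
    |∫ ω, ρ ω * (Y (a + d + 1) ω * Y (a + d + 1 + i) ω - γ i) ∂P| ≤
      r * (C * ((d:ℝ) + 1) ^ (-(1 + δ)))
  dep₄ : ∀ (a d i : ℕ) (ρ : Ω → ℝ) (r : ℝ), Measurable[𝓕 a] ρ → (∀ ω, |ρ ω| ≤ r) →
    |∫ ω, ρ ω * (Y a ω * (Y (a + d + 1) ω * Y (a + d + 1 + i) ω - γ i)) ∂P| ≤
      r * (C * (((d:ℝ) + 1) ^ (-((1 + δ) / 2)) * ((i:ℝ) + 1) ^ (-((1 + δ) / 2))))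

namespace WeakDep

variable {Ω : Type*} [m0 : MeasurableSpace Ω] {P : Measure Ω}
  {Y : ℕ → Ω → ℝ} {𝓕 : ℕ → MeasurableSpace Ω} {γ : ℕ → ℝ} {C δ : ℝ}

/-- Partial sums of `Y`. -/
def psum (Y : ℕ → Ω → ℝ) (k : ℕ) (ω : Ω) : ℝ := ∑ i ∈ Finset.range k, Y i ω

lemma psum_succ (Y : ℕ → Ω → ℝ) (k : ℕ) (ω : Ω) : psum Y (k + 1) ω = psum Y k ω + Y k ω :=
  Finset.sum_range_succ _ _

lemma measurable (hY : WeakDep P Y 𝓕 γ C δ) (i : ℕ) : Measurable (Y i) :=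
  (hY.meas i).mono (hY.le i) le_rfl

lemma psum_meas (hY : WeakDep P Y 𝓕 γ C δ) {k a : ℕ} (hk : k ≤ a + 1) :
    Measurable[𝓕 a] (psum Y k) := by
  refine Finset.measurable_fun_sum _ fun i hi => (hY.meas i).mono (hY.mono ?_) le_rfl
  have := Finset.mem_range.1 hi
  omega

lemma measurable_psum (hY : WeakDep P Y 𝓕 γ C δ) (k : ℕ) : Measurable (psum Y k) :=
  (hY.psum_meas k.le_succ).mono (hY.le k) le_rfl

lemma C_nonneg (hY : WeakDep P Y 𝓕 γ C δ) : 0 ≤ C :=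
  (integral_nonneg fun ω => by positivity).trans (hY.cube_le 0)

variable [IsProbabilityMeasure P]

lemma integrable_of_le (hY : WeakDep P Y 𝓕 γ C δ) {f : Ω → ℝ} (hf : Measurable f) (a b c : ℕ)
    (K : ℝ) (hfb : ∀ ω, |f ω| ≤ K * (1 + |Y a ω| ^ 3 + |Y b ω| ^ 3 + |Y c ω| ^ 3)) :
    Integrable f P :=
  Integrable.mono' (((((integrable_const 1).add (hY.integrable_cube a)).add
    (hY.integrable_cube b)).add (hY.integrable_cube c)).const_mul K) hf.aestronglyMeasurable
    (ae_of_all _ hfb)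

lemma abs_le_one_add_cube (x : ℝ) : |x| ≤ 1 + |x| ^ 3 := by
  have := abs_nonneg x
  nlinarith [sq_nonneg (|x| - 1), mul_nonneg this (sq_nonneg (|x| - 1))]

lemma mul_mul_le_cubes {x y z : ℝ} (hx : 0 ≤ x) (hy : 0 ≤ y) (hz : 0 ≤ z) :
    x * y * z ≤ x ^ 3 + y ^ 3 + z ^ 3 := by
  nlinarith [mul_nonneg (add_nonneg (add_nonneg hx hy) hz)
    (add_nonneg (add_nonneg (sq_nonneg (x - y)) (sq_nonneg (y - z))) (sq_nonneg (x - z))),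
    mul_nonneg (mul_nonneg hx hy) hz]

lemma abs_mul_le_cubes (x y : ℝ) : |x * y| ≤ 1 + |x| ^ 3 + |y| ^ 3 := by
  have := mul_mul_le_cubes (abs_nonneg x) (abs_nonneg y) zero_le_one
  rw [abs_mul]
  linarith

lemma abs_mul_mul_le_cubes (x y z : ℝ) : |x * y * z| ≤ |x| ^ 3 + |y| ^ 3 + |z| ^ 3 := by
  rw [abs_mul, abs_mul]
  exact mul_mul_le_cubes (abs_nonneg x) (abs_nonneg y) (abs_nonneg z)

lemma integrable_Y (hY : WeakDep P Y 𝓕 γ C δ) (a : ℕ) : Integrable (Y a) P :=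
  hY.integrable_of_le (hY.measurable a) a a a 1 fun ω => by
    have := abs_le_one_add_cube (Y a ω)
    have h0 : 0 ≤ |Y a ω| ^ 3 := by positivity
    linarith

lemma integrable_mul (hY : WeakDep P Y 𝓕 γ C δ) (a b : ℕ) :
    Integrable (fun ω => Y a ω * Y b ω) P :=
  hY.integrable_of_le ((hY.measurable a).mul (hY.measurable b)) a b b 1 fun ω => by
    have := abs_mul_le_cubes (Y a ω) (Y b ω)
    have h0 : 0 ≤ |Y b ω| ^ 3 := by positivity
    linarith

lemma integrable_mul_mul (hY : WeakDep P Y 𝓕 γ C δ) (a b c : ℕ) :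
    Integrable (fun ω => Y a ω * (Y b ω * Y c ω)) P :=
  hY.integrable_of_le ((hY.measurable a).mul ((hY.measurable b).mul (hY.measurable c))) a b c 1
    fun ω => by
      have := abs_mul_mul_le_cubes (Y a ω) (Y b ω) (Y c ω)
      rw [mul_assoc] at this
      linarith

lemma integrable_psum (hY : WeakDep P Y 𝓕 γ C δ) (k : ℕ) : Integrable (psum Y k) P :=
  integrable_finsetSum _ fun i _ => hY.integrable_Y i

lemma integral_abs_le (hY : WeakDep P Y 𝓕 γ C δ) (a : ℕ) : ∫ ω, |Y a ω| ∂P ≤ 1 + C := by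
  calc ∫ ω, |Y a ω| ∂P ≤ ∫ ω, (1 + |Y a ω| ^ 3) ∂P :=
        integral_mono (hY.integrable_Y a).abs ((integrable_const 1).add (hY.integrable_cube a))
          fun ω => abs_le_one_add_cube _
    _ ≤ 1 + C := by
        rw [integral_add (integrable_const 1) (hY.integrable_cube a)]
        simpa using hY.cube_le a

lemma integrable_bdd_mul {f g : Ω → ℝ} {K : ℝ} (hf : Measurable f) (hfb : ∀ ω, |f ω| ≤ K)
    (hg : Integrable g P) : Integrable (fun ω => f ω * g ω) P :=
  hg.bdd_mul hf.aestronglyMeasurable (ae_of_all _ hfb)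

/-- Covariance between a Lipschitz function of the past sum and a product of two increments. -/
lemma abs_integral_mul_sub_le_aux (hY : WeakDep P Y 𝓕 γ C δ) {B : ℝ → ℝ} (hBm : Measurable B)
    {β L : ℝ} (hβ : ∀ x, |B x| ≤ β) (hL : ∀ x y, |B x - B y| ≤ L * |x - y|) (b i m : ℕ)
    (hm : m ≤ b) :
    |∫ ω, B (psum Y b ω) * (Y b ω * Y (b + i) ω - γ i) ∂P| ≤
      |∫ ω, B (psum Y (b - m) ω) * (Y b ω * Y (b + i) ω - γ i) ∂P| +
        L * (C * ((i:ℝ) + 1) ^ (-((1 + δ) / 2))) *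
          ∑ j ∈ Finset.range m, ((j:ℝ) + 1) ^ (-((1 + δ) / 2)) := by
  induction m with
  | zero => simp
  | succ m ih =>
    refine (ih (by omega)).trans ?_
    obtain ⟨t, rfl⟩ : ∃ t, b = t + m + 1 := ⟨b - m - 1, by omega⟩
    have e1 : t + m + 1 - m = t + 1 := by omega
    have e2 : t + m + 1 - (m + 1) = t := by omega
    rw [e1, e2, Finset.sum_range_succ, mul_add]
    set Z := fun ω => Y (t + m + 1) ω * Y (t + m + 1 + i) ω - γ i with hZ
    have hZi : Integrable Z P := (hY.integrable_mul _ _).sub (integrable_const _)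
    have hint : ∀ k, Integrable (fun ω => B (psum Y k ω) * Z ω) P := fun k =>
      integrable_bdd_mul (hBm.comp (hY.measurable_psum k)) (fun ω => hβ _) hZi
    set ρ := fun ω => (B (psum Y (t + 1) ω) - B (psum Y t ω)) / Y t ω with hρ
    have hρm : Measurable[𝓕 t] ρ :=
      ((hBm.comp (hY.psum_meas le_rfl)).sub (hBm.comp (hY.psum_meas t.le_succ))).div (hY.meas t)
    have hL0 : 0 ≤ L := by simpa using (abs_nonneg _).trans (hL 1 0)
    have hρb : ∀ ω, |ρ ω| ≤ L := fun ω => by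
      rw [hρ, abs_div]
      refine div_le_of_le_mul₀ (abs_nonneg _) hL0 ?_
      simpa [psum_succ] using hL (psum Y (t + 1) ω) (psum Y t ω)
    have hρY : ∀ ω, ρ ω * Y t ω = B (psum Y (t + 1) ω) - B (psum Y t ω) := fun ω => by
      rcases eq_or_ne (Y t ω) 0 with h | h
      · simp [hρ, psum_succ, h]
      · exact div_mul_cancel₀ _ h
    have hkey := hY.dep₄ t m i ρ L hρm hρb
    have hsplit : ∫ ω, B (psum Y (t + 1) ω) * Z ω ∂P = ∫ ω, B (psum Y t ω) * Z ω ∂P +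
        ∫ ω, ρ ω * (Y t ω * Z ω) ∂P := by
      rw [← sub_eq_iff_eq_add', ← integral_sub (hint _) (hint _)]
      refine integral_congr_ae (ae_of_all _ fun ω => ?_)
      simp only
      rw [← mul_assoc, hρY, sub_mul]
    rw [hsplit]
    have := abs_add_le (∫ ω, B (psum Y t ω) * Z ω ∂P) (∫ ω, ρ ω * (Y t ω * Z ω) ∂P)
    nlinarith [hkey, this]

lemma abs_integral_mul_sub_le (hY : WeakDep P Y 𝓕 γ C δ) {B : ℝ → ℝ} (hBm : Measurable B)
    {β L : ℝ} (hβ : ∀ x, |B x| ≤ β) (hL : ∀ x y, |B x - B y| ≤ L * |x - y|)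
    (b i m : ℕ) :
    |∫ ω, B (psum Y b ω) * (Y b ω * Y (b + i) ω - γ i) ∂P| ≤
      β * (C * ((m:ℝ) + 1) ^ (-(1 + δ))) + L * (C * ((i:ℝ) + 1) ^ (-((1 + δ) / 2))) *
          ∑ j ∈ Finset.range m, ((j:ℝ) + 1) ^ (-((1 + δ) / 2)) := by
  have hC := hY.C_nonneg
  have hL0 : 0 ≤ L := by simpa using (abs_nonneg _).trans (hL 1 0)
  have hβ0 : 0 ≤ β := (abs_nonneg _).trans (hβ 0)
  rcases lt_or_ge m b with hmb | hmb
  · refine (hY.abs_integral_mul_sub_le_aux hBm hβ hL b i m hmb.le).trans ?_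
    gcongr
    obtain ⟨t, rfl⟩ : ∃ t, b = t + m + 1 := ⟨b - m - 1, by omega⟩
    have e1 : t + m + 1 - m = t + 1 := by omega
    rw [e1]
    exact hY.dep₃ t m i (fun ω => B (psum Y (t + 1) ω)) β (hBm.comp (hY.psum_meas le_rfl))
      fun ω => hβ _
  · refine (hY.abs_integral_mul_sub_le_aux hBm hβ hL b i b le_rfl).trans ?_
    have hz : ∫ ω, B (psum Y (b - b) ω) * (Y b ω * Y (b + i) ω - γ i) ∂P = 0 := by
      simp only [psum, Nat.sub_self, Finset.range_zero, Finset.sum_empty]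
      rw [integral_const_mul, integral_sub (hY.integrable_mul _ _) (integrable_const _), hY.cov]
      simp
    rw [hz, abs_zero]
    gcongr
    positivity

end WeakDep

namespace WeakDep

variable {Ω : Type*} [m0 : MeasurableSpace Ω] {P : Measure Ω} [IsProbabilityMeasure P]
  {Y : ℕ → Ω → ℝ} {𝓕 : ℕ → MeasurableSpace Ω} {γ : ℕ → ℝ} {C δ : ℝ}

lemma abs_integral_sub_psum_le (hY : WeakDep P Y 𝓕 γ C δ) {B : ℝ → ℝ} (hBm : Measurable B)
    {β L : ℝ} (hβ : ∀ x, |B x| ≤ β) (hL : ∀ x y, |B x - B y| ≤ L * |x - y|) (t j : ℕ) :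
    |∫ ω, B (psum Y (t + j) ω) ∂P - ∫ ω, B (psum Y t ω) ∂P| ≤ L * (j * (1 + C)) := by
  have hL0 : 0 ≤ L := by simpa using (abs_nonneg _).trans (hL 1 0)
  have hint : ∀ k, Integrable (fun ω => B (psum Y k ω)) P := fun k =>
    Integrable.of_bound (hBm.comp (hY.measurable_psum k)).aestronglyMeasurable β
      (ae_of_all _ fun ω => hβ _)
  induction j with
  | zero => simp
  | succ j ih =>
    have h1 : |∫ ω, B (psum Y (t + j + 1) ω) ∂P - ∫ ω, B (psum Y (t + j) ω) ∂P| ≤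
        L * (1 + C) := by
      rw [← integral_sub (hint _) (hint _)]
      refine (abs_integral_le_integral_abs).trans ?_
      calc ∫ ω, |B (psum Y (t + j + 1) ω) - B (psum Y (t + j) ω)| ∂P
          ≤ ∫ ω, L * |Y (t + j) ω| ∂P := by
            refine integral_mono ((hint _).sub (hint _)).abs
              ((hY.integrable_Y _).abs.const_mul L) fun ω => ?_
            simpa [psum_succ] using hL (psum Y (t + j + 1) ω) (psum Y (t + j) ω)
        _ ≤ L * (1 + C) := by
            rw [integral_const_mul]
            exact mul_le_mul_of_nonneg_left (hY.integral_abs_le _) hL0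
    have h2 := abs_sub_le (∫ ω, B (psum Y (t + j + 1) ω) ∂P) (∫ ω, B (psum Y (t + j) ω) ∂P)
      (∫ ω, B (psum Y t ω) ∂P)
    rw [← add_assoc]
    push_cast
    nlinarith

/-- Expansion of `E[A(S_k) Y_k]` in terms of the covariances, peeling off the last `N` terms. -/
lemma abs_integral_deriv_mul_sub_le_aux (hY : WeakDep P Y 𝓕 γ C δ) (hδ : δ ∈ Ioo (0:ℝ) 1)
    {A B : ℝ → ℝ}
    (hA : ∀ x, HasDerivAt A (B x) x) (hBm : Measurable B)
    {α β L : ℝ} (hα : ∀ x, |A x| ≤ α) (hβ : ∀ x, |B x| ≤ β)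
    (hL : ∀ x y, |B x - B y| ≤ L * |x - y|) (k m N : ℕ)
    (hN : N ≤ k) :
    |∫ ω, A (psum Y k ω) * Y k ω ∂P - ∫ ω, A (psum Y (k - N) ω) * Y k ω ∂P -
        (∑ i ∈ Finset.range N, γ (i + 1)) * ∫ ω, B (psum Y k ω) ∂P| ≤
        ∑ i ∈ Finset.range N, (β * (C * ((m:ℝ) + 1) ^ (-(1 + δ))) +
          L * C * (∑ j ∈ Finset.range m, ((j:ℝ) + 1) ^ (-((1 + δ) / 2))) *
            ((i:ℝ) + 1) ^ (-((1 + δ) / 2)) + L * C * (2 + C) * ((i:ℝ) + 1) ^ (-δ)) := by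
  obtain ⟨hδ0, hδ1⟩ := hδ
  have hL0 : 0 ≤ L := by simpa using (abs_nonneg _).trans (hL 1 0)
  have hC := hY.C_nonneg
  have hAm : Measurable A :=
    (continuous_iff_continuousAt.2 fun x => (hA x).continuousAt).measurable
  induction N with
  | zero => simp
  | succ i ih =>
    have ih := ih (by omega)
    obtain ⟨t, rfl⟩ : ∃ t, k = t + i + 1 := ⟨k - i - 1, by omega⟩
    have e1 : t + i + 1 - i = t + 1 := by omega
    have e2 : t + i + 1 - (i + 1) = t := by omega
    rw [e1] at ih
    rw [e2, Finset.sum_range_succ, Finset.sum_range_succ]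
    set Z := Y (t + i + 1) with hZ
    set b := ∫ ω, B (psum Y (t + i + 1) ω) ∂P with hb
    set s := ∑ j ∈ Finset.range m, ((j:ℝ) + 1) ^ (-((1 + δ) / 2)) with hs
    have hs0 : 0 ≤ s := Finset.sum_nonneg fun j _ => by positivity
    have hintA : ∀ k, Integrable (fun ω => A (psum Y k ω) * Z ω) P := fun k =>
      integrable_bdd_mul (hAm.comp (hY.measurable_psum k)) (fun ω => hα _) (hY.integrable_Y _)
    have hZi : Integrable (fun ω => Y t ω * Z ω - γ (i + 1)) P :=
      (hY.integrable_mul _ _).sub (integrable_const _)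
    have hintB : Integrable (fun ω => B (psum Y t ω) * (Y t ω * Z ω - γ (i + 1))) P :=
      integrable_bdd_mul (hBm.comp (hY.measurable_psum t)) (fun ω => hβ _) hZi
    have hintB' : Integrable (fun ω => B (psum Y t ω) * γ (i + 1)) P :=
      (Integrable.of_bound (hBm.comp (hY.measurable_psum t)).aestronglyMeasurable β
        (ae_of_all _ fun ω => hβ _)).mul_const _
    set ρ := fun ω =>
      (A (psum Y (t + 1) ω) - A (psum Y t ω) - B (psum Y t ω) * Y t ω) / (Y t ω) ^ 2 with hρ
    have hρm : Measurable[𝓕 t] ρ :=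
      (((hAm.comp (hY.psum_meas le_rfl)).sub (hAm.comp (hY.psum_meas t.le_succ))).sub
        ((hBm.comp (hY.psum_meas t.le_succ)).mul (hY.meas t))).div ((hY.meas t).pow_const 2)
    have hT : ∀ ω, |A (psum Y (t + 1) ω) - A (psum Y t ω) - B (psum Y t ω) * Y t ω| ≤
        L * Y t ω ^ 2 := fun ω => by
      rw [psum_succ]
      exact abs_sub_sub_le_of_lipschitz_deriv hA hL0 hL _ _
    have hρb : ∀ ω, |ρ ω| ≤ L := fun ω => by
      rw [hρ, abs_div, abs_of_nonneg (sq_nonneg (Y t ω))]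
      exact div_le_of_le_mul₀ (sq_nonneg _) hL0 (hT ω)
    have hρY : ∀ ω, ρ ω * Y t ω ^ 2 =
        A (psum Y (t + 1) ω) - A (psum Y t ω) - B (psum Y t ω) * Y t ω := fun ω => by
      rcases eq_or_ne (Y t ω) 0 with h | h
      · simp [hρ, psum_succ, h]
      · exact div_mul_cancel₀ _ (pow_ne_zero 2 h)
    have hρi : Integrable (fun ω => ρ ω * (Y t ω ^ 2 * Z ω)) P := by
      refine integrable_bdd_mul (hρm.mono (hY.le t) le_rfl) hρb ?_
      convert hY.integrable_mul_mul t t (t + i + 1) using 2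
      rw [← hZ]; ring
    have h2 := hY.dep₂ t i ρ L hρm hρb
    have h3 := hY.abs_integral_mul_sub_le hBm hβ hL t (i + 1) m
    have h4 := hY.abs_integral_sub_psum_le hBm hβ hL t (i + 1)
    rw [← add_assoc] at h3 h4
    have hsplit : ∫ ω, A (psum Y (t + 1) ω) * Z ω ∂P = ∫ ω, A (psum Y t ω) * Z ω ∂P +
        (∫ ω, ρ ω * (Y t ω ^ 2 * Z ω) ∂P +
          (∫ ω, B (psum Y t ω) * (Y t ω * Z ω - γ (i + 1)) ∂P +
            (∫ ω, B (psum Y t ω) ∂P) * γ (i + 1))) := by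
      rw [← integral_mul_const, ← integral_add' hintB hintB', ← integral_add' hρi (hintB.add hintB'),
        ← integral_add' (hintA t) (hρi.add (hintB.add hintB'))]
      refine integral_congr_ae (ae_of_all _ fun ω => ?_)
      simp only [Pi.add_apply]
      rw [← mul_assoc, hρY]
      ring
    have hdec := hY.decay (i + 1)
    have hi1 : (0:ℝ) < (i:ℝ) + 1 := by positivity
    have hstep : ∀ r : ℝ, 0 ≤ r → (((i + 1 : ℕ):ℝ) + 1) ^ (-r) ≤ ((i:ℝ) + 1) ^ (-r) := fun r hr =>
      Real.rpow_le_rpow_of_nonpos hi1 (by push_cast; linarith) (by linarith)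
    have hpow : ((i:ℝ) + 1) ^ (-(1 + δ)) * ((i:ℝ) + 1) = ((i:ℝ) + 1) ^ (-δ) := by
      rw [← Real.rpow_add_one hi1.ne']
      congr 1; ring
    have hpow' : ((i:ℝ) + 1) ^ (-(1 + δ)) ≤ ((i:ℝ) + 1) ^ (-δ) :=
      Real.rpow_le_rpow_of_exponent_le (by linarith [Nat.cast_nonneg (α := ℝ) i]) (by linarith)
    have b1 : |∫ ω, ρ ω * (Y t ω ^ 2 * Z ω) ∂P| ≤ L * C * ((i:ℝ) + 1) ^ (-δ) := by
      refine h2.trans ?_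
      rw [mul_assoc]
      gcongr
    have b2 : |∫ ω, B (psum Y t ω) * (Y t ω * Z ω - γ (i + 1)) ∂P| ≤
        β * (C * ((m:ℝ) + 1) ^ (-(1 + δ))) + L * C * s * ((i:ℝ) + 1) ^ (-((1 + δ) / 2)) := by
      refine h3.trans ?_
      have := hstep ((1 + δ) / 2) (by positivity)
      rw [show L * C * s * ((i:ℝ) + 1) ^ (-((1 + δ) / 2)) =
        L * (C * ((i:ℝ) + 1) ^ (-((1 + δ) / 2))) * s by ring]
      gcongr
    have b3 : |(∫ ω, B (psum Y t ω) ∂P) * γ (i + 1) - γ (i + 1) * b| ≤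
        L * C * (1 + C) * ((i:ℝ) + 1) ^ (-δ) := by
      rw [show (∫ ω, B (psum Y t ω) ∂P) * γ (i + 1) - γ (i + 1) * b =
        (-γ (i + 1)) * (b - ∫ ω, B (psum Y t ω) ∂P) by ring, abs_mul, abs_neg]
      calc |γ (i + 1)| * |b - ∫ ω, B (psum Y t ω) ∂P|
          ≤ (C * ((i:ℝ) + 1) ^ (-(1 + δ))) * (L * (((i + 1 : ℕ) : ℝ) * (1 + C))) := by
            gcongr
            exact hdec.trans (mul_le_mul_of_nonneg_left (hstep _ (by linarith)) hC)
        _ = L * C * (1 + C) * ((i:ℝ) + 1) ^ (-δ) := by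
            rw [← hpow]; push_cast; ring
    set X := ∫ ω, A (psum Y (t + i + 1) ω) * Z ω ∂P
    set X0 := ∫ ω, A (psum Y t ω) * Z ω ∂P
    set R := ∫ ω, ρ ω * (Y t ω ^ 2 * Z ω) ∂P
    set U := ∫ ω, B (psum Y t ω) * (Y t ω * Z ω - γ (i + 1)) ∂P
    set V := ∫ ω, B (psum Y t ω) ∂P
    rw [hsplit] at ih
    rw [abs_le] at *
    constructor <;> linarith [ih.1, ih.2, b1.1, b1.2, b2.1, b2.2, b3.1, b3.2]

end WeakDep

namespace WeakDep

variable {Ω : Type*} [m0 : MeasurableSpace Ω] {P : Measure Ω} [IsProbabilityMeasure P]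
  {Y : ℕ → Ω → ℝ} {𝓕 : ℕ → MeasurableSpace Ω} {γ : ℕ → ℝ} {C δ : ℝ}

lemma abs_integral_deriv_mul_sub_le (hY : WeakDep P Y 𝓕 γ C δ) (hδ : δ ∈ Ioo (0:ℝ) 1)
    {A B : ℝ → ℝ} (hA : ∀ x, HasDerivAt A (B x) x) (hBm : Measurable B)
    {α β L : ℝ} (hα : ∀ x, |A x| ≤ α) (hβ : ∀ x, |B x| ≤ β)
    (hL : ∀ x y, |B x - B y| ≤ L * |x - y|) (k m : ℕ) :
    |∫ ω, A (psum Y k ω) * Y k ω ∂P -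
        (∑ i ∈ Finset.range (min m k), γ (i + 1)) * ∫ ω, B (psum Y k ω) ∂P| ≤
      α * (C * ((m:ℝ) + 1) ^ (-(1 + δ))) + (m * (β * (C * ((m:ℝ) + 1) ^ (-(1 + δ)))) +
        L * C * (∑ j ∈ Finset.range m, ((j:ℝ) + 1) ^ (-((1 + δ) / 2))) *
          (∑ j ∈ Finset.range m, ((j:ℝ) + 1) ^ (-((1 + δ) / 2))) +
            L * C * (2 + C) * ∑ i ∈ Finset.range m, ((i:ℝ) + 1) ^ (-δ)) := by
  have hC := hY.C_nonneg
  have hL0 : 0 ≤ L := by simpa using (abs_nonneg _).trans (hL 1 0)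
  have hα0 : 0 ≤ α := (abs_nonneg _).trans (hα 0)
  have hβ0 : 0 ≤ β := (abs_nonneg _).trans (hβ 0)
  have hAm : Measurable A :=
    (continuous_iff_continuousAt.2 fun x => (hA x).continuousAt).measurable
  have h1 := hY.abs_integral_deriv_mul_sub_le_aux hδ hA hBm hα hβ hL k m (min m k) (min_le_right _ _)
  have h2 : |∫ ω, A (psum Y (k - min m k) ω) * Y k ω ∂P| ≤
      α * (C * ((m:ℝ) + 1) ^ (-(1 + δ))) := by
    rcases lt_or_ge m k with hmk | hmk
    · obtain ⟨t, rfl⟩ : ∃ t, k = t + m + 1 := ⟨k - m - 1, by omega⟩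
      have e1 : t + m + 1 - min m (t + m + 1) = t + 1 := by omega
      rw [e1]
      exact hY.dep₁ t m (fun ω => A (psum Y (t + 1) ω)) α (hAm.comp (hY.psum_meas le_rfl))
        fun ω => hα _
    · rw [min_eq_right hmk, Nat.sub_self]
      simp only [psum, Finset.range_zero, Finset.sum_empty]
      rw [integral_const_mul, hY.mean, mul_zero, abs_zero]
      positivity
  have h3 := h1.trans (Finset.sum_le_sum_of_subset_of_nonneg
    (Finset.range_mono (min_le_left m k)) fun i _ _ => by positivity)
  rw [Finset.sum_add_distrib, Finset.sum_add_distrib, Finset.sum_const, Finset.card_range,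
    nsmul_eq_mul, ← Finset.mul_sum, ← Finset.mul_sum] at h3
  rw [sub_right_comm] at h3
  have h4 := abs_sub_abs_le_abs_sub (∫ ω, A (psum Y k ω) * Y k ω ∂P -
        (∑ i ∈ Finset.range (min m k), γ (i + 1)) * ∫ ω, B (psum Y k ω) ∂P)
        (∫ ω, A (psum Y (k - min m k) ω) * Y k ω ∂P)
  linarith

lemma summable_cov (hY : WeakDep P Y 𝓕 γ C δ) (hδ : δ ∈ Ioo (0:ℝ) 1) : Summable fun i => γ (i + 1) := by
  have h : Summable γ := Summable.of_norm_bounded ((summable_rpow_neg_one_add hδ).mul_left C)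
    hY.decay
  exact (summable_nat_add_iff 1).2 h

/-- The limiting variance. -/
def limVar (γ : ℕ → ℝ) : ℝ := γ 0 + 2 * ∑' i, γ (i + 1)

lemma abs_tsum_sub_sum_cov_le (hY : WeakDep P Y 𝓕 γ C δ) (hδ : δ ∈ Ioo (0:ℝ) 1) (N : ℕ) :
    |∑' i, γ (i + 1) - ∑ i ∈ Finset.range N, γ (i + 1)| ≤ C * (4 / δ * ((N:ℝ) + 1) ^ (-δ)) := by
  have hC := hY.C_nonneg
  rw [← (hY.summable_cov hδ).sum_add_tsum_nat_add N, add_sub_cancel_left]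
  have hs : Summable fun i : ℕ => ((i + N : ℕ) + 1 : ℝ) ^ (-(1 + δ)) :=
    (summable_nat_add_iff (f := fun i : ℕ => ((i:ℝ) + 1) ^ (-(1 + δ))) N).2
      (summable_rpow_neg_one_add hδ)
  rw [← Real.norm_eq_abs]
  refine (tsum_of_norm_bounded (hs.mul_left C).hasSum fun i => ?_).trans ?_
  · refine (hY.decay (i + N + 1)).trans (mul_le_mul_of_nonneg_left ?_ hC)
    exact Real.rpow_le_rpow_of_nonpos (by positivity) (by push_cast; linarith) (by linarith [hδ.1])
  · rw [tsum_mul_left]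
    exact mul_le_mul_of_nonneg_left (tsum_rpow_neg_one_add_le hδ N) hC

lemma integrable_comp_psum (hY : WeakDep P Y 𝓕 γ C δ) {u : ℝ → ℝ} (hu : LipschitzWith 1 u)
    (k : ℕ) : Integrable (fun ω => u (psum Y k ω)) P := by
  refine Integrable.mono' ((hY.integrable_psum k).abs.add (integrable_const |u 0|))
    (hu.continuous.measurable.comp (hY.measurable_psum k)).aestronglyMeasurable
    (ae_of_all _ fun ω => ?_)
  have h := hu.dist_le_mul (psum Y k ω) 0
  simp only [NNReal.coe_one, one_mul, Real.dist_eq, sub_zero] at h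
  have := abs_sub_abs_le_abs_sub (u (psum Y k ω)) (u 0)
  simp only [Real.norm_eq_abs, Pi.add_apply]
  linarith

/-- One step of the Lindeberg scheme. -/
lemma exists_step_bound (hY : WeakDep P Y 𝓕 γ C δ) (hδ : δ ∈ Ioo (0:ℝ) 1) :
    ∃ K, 0 ≤ K ∧ ∀ (u A B : ℝ → ℝ) (β L : ℝ), LipschitzWith 1 u →
      (∀ x, HasDerivAt u (A x) x) → (∀ x, HasDerivAt A (B x) x) → Measurable B →
      (∀ x, |A x| ≤ 1) → (∀ x, |B x| ≤ β) → (∀ x y, |B x - B y| ≤ L * |x - y|) →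
      ∀ k m : ℕ, 1 ≤ m →
        |∫ ω, u (psum Y (k + 1) ω) ∂P - ∫ ω, u (psum Y k ω) ∂P -
          limVar γ / 2 * ∫ ω, B (psum Y k ω) ∂P| ≤
        K * (L * (m:ℝ) ^ (1 - δ) + β * ((m:ℝ) ^ (-δ) + ((k:ℝ) + 1) ^ (-δ)) +
          (m:ℝ) ^ (-(1 + δ))) := by
  have hC := hY.C_nonneg
  obtain ⟨hδ0, hδ1⟩ := hδ
  set E := (1 - (1 + δ) / 2)⁻¹ with hE
  set D := (1 - δ)⁻¹ with hD
  have hE0 : 0 ≤ E := inv_nonneg.2 (by linarith)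
  have hD0 : 0 ≤ D := inv_nonneg.2 (by linarith)
  refine ⟨C + C * (E * E) + C * (2 + C) * D + C * E + C + C + C * (4 / δ), by positivity, ?_⟩
  intro u A B β L hu hA hB hBm hα hβ hL k m hm
  have hL0 : 0 ≤ L := by simpa using (abs_nonneg _).trans (hL 1 0)
  have hβ0 : 0 ≤ β := (abs_nonneg _).trans (hβ 0)
  have hm1 : (1:ℝ) ≤ m := by exact_mod_cast hm
  have hm0 : (0:ℝ) < m := by linarith
  set s := ∑ j ∈ Finset.range m, ((j:ℝ) + 1) ^ (-((1 + δ) / 2)) with hs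
  have hs0 : 0 ≤ s := Finset.sum_nonneg fun j _ => by positivity
  have hsb : s ≤ E * (m:ℝ) ^ (1 - (1 + δ) / 2) := sum_range_rpow_neg_le ⟨by linarith, by linarith⟩ m
  have hss : s * s ≤ E * E * (m:ℝ) ^ (1 - δ) := by
    calc s * s ≤ (E * (m:ℝ) ^ (1 - (1 + δ) / 2)) * (E * (m:ℝ) ^ (1 - (1 + δ) / 2)) := by gcongr
      _ = E * E * ((m:ℝ) ^ (1 - (1 + δ) / 2) * (m:ℝ) ^ (1 - (1 + δ) / 2)) := by ring
      _ = _ := by rw [← Real.rpow_add hm0]; congr 2; ring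
  have hs1 : s ≤ E * (m:ℝ) ^ (1 - δ) := hsb.trans <| mul_le_mul_of_nonneg_left
    (Real.rpow_le_rpow_of_exponent_le hm1 (by linarith)) hE0
  have hd : ∑ i ∈ Finset.range m, ((i:ℝ) + 1) ^ (-δ) ≤ D * (m:ℝ) ^ (1 - δ) :=
    sum_range_rpow_neg_le ⟨hδ0, hδ1⟩ m
  set T := (m:ℝ) ^ (1 - δ) with hT
  have hT1 : 1 ≤ T := Real.one_le_rpow hm1 (by linarith)
  set V := (m:ℝ) ^ (-δ) with hV
  have hV0 : 0 ≤ V := by positivity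
  set W := ((k:ℝ) + 1) ^ (-δ) with hW
  have hW0 : 0 ≤ W := by positivity
  set R := (m:ℝ) ^ (-(1 + δ)) with hR
  have hR0 : 0 ≤ R := by positivity
  have hm1R : ((m:ℝ) + 1) ^ (-(1 + δ)) ≤ R :=
    Real.rpow_le_rpow_of_nonpos hm0 (by linarith) (by linarith)
  have hmR : m * R = V := by
    rw [hR, mul_comm, ← Real.rpow_add_one hm0.ne']
    congr 1; ring
  have hRV : R ≤ V := by nlinarith
  set b := ∫ ω, B (psum Y k ω) ∂P with hb
  have hintB : Integrable (fun ω => B (psum Y k ω)) P :=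
    Integrable.of_bound (hBm.comp (hY.measurable_psum k)).aestronglyMeasurable β
      (ae_of_all _ fun ω => hβ _)
  have hbβ : |b| ≤ β := by
    have := norm_integral_le_of_norm_le_const (μ := P) (f := fun ω => B (psum Y k ω))
      (ae_of_all _ fun ω => hβ _)
    simpa using this
  -- the first order term
  have c1 : |∫ ω, A (psum Y k ω) * Y k ω ∂P -
      (∑ i ∈ Finset.range (min m k), γ (i + 1)) * b| ≤
      C * R + (β * (C * V) + L * C * (E * E * T) + L * C * (2 + C) * (D * T)) := by
    refine (hY.abs_integral_deriv_mul_sub_le ⟨hδ0, hδ1⟩ hB hBm hα hβ hL k m).trans ?_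
    rw [one_mul]
    refine add_le_add (by gcongr) (add_le_add (add_le_add ?_ ?_) (by gcongr))
    · rw [← hmR]
      calc _ ≤ (m:ℝ) * (β * (C * R)) := by gcongr
        _ = _ := by ring
    · rw [mul_assoc]
      gcongr
  -- the second order term
  have c2 : |∫ ω, B (psum Y k ω) * (Y k ω * Y k ω - γ 0) ∂P| ≤
      β * (C * V) + L * (C * (E * T)) := by
    have := hY.abs_integral_mul_sub_le hBm hβ hL k 0 m
    simp only [add_zero, Nat.cast_zero, zero_add, Real.one_rpow, mul_one] at this
    refine this.trans (add_le_add ?_ ?_)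
    · gcongr
      exact hm1R.trans hRV
    · rw [mul_assoc]
      gcongr
  -- the tail of the variance series
  have c3 : |∑' i, γ (i + 1) - ∑ i ∈ Finset.range (min m k), γ (i + 1)| ≤
      C * (4 / δ * (V + W)) := by
    refine (hY.abs_tsum_sub_sum_cov_le ⟨hδ0, hδ1⟩ _).trans ?_
    gcongr
    rcases le_total m k with h | h
    · rw [min_eq_left h]
      have : ((m:ℝ) + 1) ^ (-δ) ≤ V :=
        Real.rpow_le_rpow_of_nonpos hm0 (by linarith) (by linarith)
      linarith
    · rw [min_eq_right h]
      linarith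
  -- the Taylor remainder
  have hY2 : Integrable (fun ω => B (psum Y k ω) * (Y k ω * Y k ω)) P :=
    integrable_bdd_mul (hBm.comp (hY.measurable_psum k)) (fun ω => hβ _) (hY.integrable_mul k k)
  have hY1 : Integrable (fun ω => A (psum Y k ω) * Y k ω) P := by
    have hAm : Measurable A :=
      (continuous_iff_continuousAt.2 fun x => (hB x).continuousAt).measurable
    exact integrable_bdd_mul (hAm.comp (hY.measurable_psum k)) (fun ω => hα _) (hY.integrable_Y k)
  have c4 : |∫ ω, u (psum Y (k + 1) ω) ∂P - ∫ ω, u (psum Y k ω) ∂P -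
      ∫ ω, A (psum Y k ω) * Y k ω ∂P - (∫ ω, B (psum Y k ω) * (Y k ω * Y k ω) ∂P) / 2| ≤ L * C := by
    have hi0 := (hY.integrable_comp_psum hu (k + 1)).sub (hY.integrable_comp_psum hu k)
    have hi1 := hi0.sub hY1
    rw [← integral_div, ← integral_sub' (hY.integrable_comp_psum hu _) (hY.integrable_comp_psum hu _),
      ← integral_sub' hi0 hY1, ← integral_sub' hi1 (hY2.div_const 2)]
    refine abs_integral_le_integral_abs.trans ?_
    refine (integral_mono (hi1.sub (hY2.div_const 2)).abs ((hY.integrable_cube k).const_mul L)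
      fun ω => ?_).trans ?_
    · have := abs_sub_sub_sub_le_of_lipschitz_deriv hA hB hL0 hL (psum Y k ω) (Y k ω)
      simpa only [Pi.sub_apply, psum_succ, ← sq] using this
    · rw [integral_const_mul]
      exact mul_le_mul_of_nonneg_left (hY.cube_le k) hL0
  have e2 : ∫ ω, B (psum Y k ω) * (Y k ω * Y k ω - γ 0) ∂P =
      ∫ ω, B (psum Y k ω) * (Y k ω * Y k ω) ∂P - γ 0 * b := by
    rw [← integral_const_mul, ← integral_sub hY2 (hintB.const_mul _)]
    congr 1 with ω
    ring
  have c3' : |(∑ i ∈ Finset.range (min m k), γ (i + 1)) * b - (∑' i, γ (i + 1)) * b| ≤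
      C * (4 / δ * (V + W)) * β := by
    rw [← sub_mul, abs_mul, abs_sub_comm]
    exact mul_le_mul c3 hbβ (abs_nonneg _) (by positivity)
  rw [e2] at c2
  have hlim : limVar γ / 2 * b = γ 0 * b / 2 + (∑' i, γ (i + 1)) * b := by
    rw [limVar]; ring
  rw [hlim]
  have hLT : L * 1 ≤ L * T := by gcongr
  have hβW : 0 ≤ β * W := by positivity
  have hβV : 0 ≤ β * V := by positivity
  have hLT0 : 0 ≤ L * T := by positivity
  calc _ ≤ L * C + (C * R + (β * (C * V) + L * C * (E * E * T) + L * C * (2 + C) * (D * T))) +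
        (β * (C * V) + L * (C * (E * T))) + C * (4 / δ * (V + W)) * β := by
        have hx : 0 ≤ β * (C * V) + L * (C * (E * T)) := by positivity
        rw [abs_le] at *
        constructor <;> linarith [c1.1, c1.2, c2.1, c2.2, c3'.1, c3'.2, c4.1, c4.2]
    _ = (C * (L * 1) + (C * (E * E) + C * (2 + C) * D + C * E) * (L * T)) +
        ((C + C + C * (4 / δ)) * (β * V) + C * (4 / δ) * (β * W)) + C * R := by ring
    _ ≤ _ := by
        set J := C + C * (E * E) + C * (2 + C) * D + C * E + C + C + C * (4 / δ) with hJ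
        have p1 : 0 ≤ C * (E * E) := by positivity
        have p2 : 0 ≤ C * (2 + C) * D := by positivity
        have p3 : 0 ≤ C * E := by positivity
        have p4 : 0 ≤ C * (4 / δ) := by positivity
        calc _ ≤ J * (L * T) + (J * (β * V) + J * (β * W)) + J * R := by
              have q1 : C * (L * 1) + (C * (E * E) + C * (2 + C) * D + C * E) * (L * T) ≤
                  (C + (C * (E * E) + C * (2 + C) * D + C * E)) * (L * T) := by
                have := mul_le_mul_of_nonneg_left hLT hC
                linarith
              refine (add_le_add (add_le_add q1 le_rfl) le_rfl).trans ?_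
              gcongr <;> linarith
          _ = _ := by ring

end WeakDep

lemma abs_gaussSmooth_sub_sub_le {u A B : ℝ → ℝ} (hlu : LipschitzWith 1 u)
    (hu : ∀ x, HasDerivAt u (A x) x)
    (hA : ∀ x, HasDerivAt A (B x) x) {L : ℝ}
    (hL : 0 ≤ L) (hB : ∀ x y, |B x - B y| ≤ L * |x - y|) (s : ℝ≥0) (x : ℝ) :
    |gaussSmooth s u x - u x - s / 2 * B x| ≤ L * ∫ y, |y| ^ 3 ∂gaussianReal 0 s := by
  have hi := (lipschitzWith_comp_const_add hlu x).integrable_gaussianReal 0 s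
  have h1 := (integrable_id_gaussianReal 0 s).const_mul (A x)
  have h2 : Integrable (fun y : ℝ => B x / 2 * y ^ 2) (gaussianReal 0 s) := by
    have := (integrable_pow_gaussianReal 0 s 2).const_mul (B x / 2)
    simpa only [sq_abs] using this
  have hi1 : Integrable (fun y => u (x + y) - u x) (gaussianReal 0 s) :=
    hi.sub (integrable_const _)
  have hi2 : Integrable (fun y => u (x + y) - u x - A x * y) (gaussianReal 0 s) := hi1.sub h1
  have e : gaussSmooth s u x - u x - s / 2 * B x =
      ∫ y, (u (x + y) - u x - A x * y - B x / 2 * y ^ 2) ∂gaussianReal 0 s := by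
    rw [integral_sub hi2 h2, integral_sub hi1 h1, integral_sub hi (integrable_const _),
      integral_const_mul, integral_const_mul, integral_sq_gaussianReal, integral_id_gaussianReal,
      gaussSmooth]
    simp
    ring
  rw [e]
  refine abs_integral_le_integral_abs.trans ?_
  rw [← integral_const_mul]
  refine integral_mono (hi2.sub h2).abs ((integrable_pow_gaussianReal 0 s 3).const_mul L) fun y => ?_
  have := abs_sub_sub_sub_le_of_lipschitz_deriv hu hA hL hB x y
  rwa [mul_div_right_comm] at this

namespace WeakDep

variable {Ω : Type*} [m0 : MeasurableSpace Ω] {P : Measure Ω} [IsProbabilityMeasure P]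
  {Y : ℕ → Ω → ℝ} {𝓕 : ℕ → MeasurableSpace Ω} {γ : ℕ → ℝ} {C δ : ℝ}

lemma rpow_mul_rpow_le_add {J l δ : ℝ} (hJ : 1 ≤ J) (hl : 1 ≤ l) (hδ : 0 < δ) :
    J ^ (-(1 / 2) : ℝ) * l ^ (-δ) ≤ J ^ (-((1 + δ) / 2)) + l ^ (-((1 + δ) / 2)) := by
  have hJ0 : 0 < J := by linarith
  have hl0 : 0 < l := by linarith
  have key : ∀ t : ℝ, 1 ≤ t → t ^ (-(1 / 2) : ℝ) * t ^ (-δ) ≤ t ^ (-((1 + δ) / 2)) := fun t ht => by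
    rw [← Real.rpow_add (by linarith)]
    exact Real.rpow_le_rpow_of_exponent_le ht (by linarith)
  rcases le_total J l with h | h
  · have : l ^ (-δ) ≤ J ^ (-δ) := Real.rpow_le_rpow_of_nonpos hJ0 h (by linarith)
    have h1 := mul_le_mul_of_nonneg_left this (Real.rpow_nonneg hJ0.le (-(1 / 2)))
    have h2 := Real.rpow_nonneg hl0.le (-((1 + δ) / 2))
    linarith [key J hJ]
  · have : J ^ (-(1 / 2) : ℝ) ≤ l ^ (-(1 / 2) : ℝ) :=
      Real.rpow_le_rpow_of_nonpos hl0 h (by linarith)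
    have h1 := mul_le_mul_of_nonneg_right this (Real.rpow_nonneg hl0.le (-δ))
    have h2 := Real.rpow_nonneg hJ0.le (-((1 + δ) / 2))
    linarith [key l hl]

/-- The error of one Lindeberg step after Gaussian smoothing with variance `v ≥ c * J`. -/
lemma step_error_le {c v J l K G : ℝ} {δ : ℝ} (hδ : δ ∈ Ioo (0:ℝ) 1) (hc : 0 < c) (hJ : 1 ≤ J)
    (hl : 1 ≤ l) (hv : c * J ≤ v) (hK : 0 ≤ K) (hG : 0 ≤ G) :
    ∃ m : ℕ, 1 ≤ m ∧ K * (3 / v * (m:ℝ) ^ (1 - δ) + 2 / √v * ((m:ℝ) ^ (-δ) + l ^ (-δ)) +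
      (m:ℝ) ^ (-(1 + δ))) + 3 / v * G ≤
      (K * (6 / c + 4 / √c + 1) + 3 / c * G) *
        (J ^ (-((1 + δ) / 2)) + l ^ (-((1 + δ) / 2))) := by
  obtain ⟨hδ0, hδ1⟩ := hδ
  have hJ0 : 0 < J := by linarith
  have hl0 : 0 < l := by linarith
  have hJs : 1 ≤ √J := Real.one_le_sqrt.2 hJ
  refine ⟨⌈√J⌉₊, Nat.one_le_ceil_iff.2 (by linarith), ?_⟩
  set m : ℝ := (⌈√J⌉₊ : ℝ) with hm
  have hm1 : √J ≤ m := Nat.le_ceil _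
  have hm2 : m ≤ 2 * √J := by
    have := Nat.ceil_lt_add_one (Real.sqrt_nonneg J)
    linarith
  have hm0 : 0 < m := by linarith
  have hpow : ∀ r : ℝ, (√J) ^ r = J ^ (r / 2) := fun r => by
    rw [Real.sqrt_eq_rpow, ← Real.rpow_mul hJ0.le]; congr 1; ring
  set q := J ^ (-((1 + δ) / 2)) with hq
  set w := l ^ (-((1 + δ) / 2)) with hw
  have hq0 : 0 < q := by positivity
  have hw0 : 0 < w := by positivity
  have hv0 : 0 < v := lt_of_lt_of_le (by positivity) hv
  have b1 : m ^ (1 - δ) ≤ 2 * J ^ ((1 - δ) / 2) := by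
    calc m ^ (1 - δ) ≤ (2 * √J) ^ (1 - δ) := Real.rpow_le_rpow hm0.le hm2 (by linarith)
      _ = 2 ^ (1 - δ) * J ^ ((1 - δ) / 2) := by
        rw [Real.mul_rpow (by norm_num) (Real.sqrt_nonneg _), hpow]
      _ ≤ 2 ^ (1:ℝ) * J ^ ((1 - δ) / 2) := by
        gcongr
        · norm_num
        · linarith
      _ = _ := by rw [Real.rpow_one]
  have b2 : m ^ (-δ) ≤ J ^ (-δ / 2) := by
    rw [← hpow]
    exact Real.rpow_le_rpow_of_nonpos (by linarith) hm1 (by linarith)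
  have b3 : m ^ (-(1 + δ)) ≤ q := by
    have : q = (√J) ^ (-(1 + δ)) := by rw [hpow, hq]; congr 1; ring
    rw [this]
    exact Real.rpow_le_rpow_of_nonpos (by linarith) hm1 (by linarith)
  have d1 : 3 / v ≤ 3 / c * J⁻¹ := by
    rw [← div_eq_mul_inv, div_div]
    gcongr
  have d2 : 2 / √v ≤ 2 / √c * J ^ (-(1 / 2) : ℝ) := by
    rw [Real.rpow_neg hJ0.le, ← Real.sqrt_eq_rpow, ← div_eq_mul_inv, div_div,
      ← Real.sqrt_mul hc.le]
    have : 0 < √(c * J) := Real.sqrt_pos.2 (by positivity)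
    gcongr
  have e1 : J⁻¹ * J ^ ((1 - δ) / 2) = q := by
    rw [← Real.rpow_neg_one, ← Real.rpow_add hJ0]; congr 1; ring
  have e2 : J ^ (-(1 / 2) : ℝ) * J ^ (-δ / 2) = q := by
    rw [← Real.rpow_add hJ0]; congr 1; ring
  have e3 : J⁻¹ ≤ q := by
    rw [← Real.rpow_neg_one]
    exact Real.rpow_le_rpow_of_exponent_le hJ (by linarith)
  have e4 := rpow_mul_rpow_le_add hJ hl hδ0
  have f1 : 3 / v * m ^ (1 - δ) ≤ 6 / c * q := by
    calc 3 / v * m ^ (1 - δ) ≤ (3 / c * J⁻¹) * (2 * J ^ ((1 - δ) / 2)) := by gcongr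
      _ = 6 / c * q := by rw [← e1]; ring
  have f2 : 2 / √v * (m ^ (-δ) + l ^ (-δ)) ≤ 4 / √c * (q + w) := by
    calc 2 / √v * (m ^ (-δ) + l ^ (-δ)) ≤
          (2 / √c * J ^ (-(1 / 2) : ℝ)) * (J ^ (-δ / 2) + l ^ (-δ)) := by gcongr
      _ = 2 / √c * (q + J ^ (-(1 / 2) : ℝ) * l ^ (-δ)) := by rw [← e2]; ring
      _ ≤ 2 / √c * (q + (q + w)) := by gcongr
      _ ≤ 2 / √c * (2 * (q + w)) := by gcongr; linarith
      _ = _ := by ring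
  have f3 : 3 / v * G ≤ 3 / c * G * q := by
    calc 3 / v * G ≤ (3 / c * q) * G := by
          gcongr
          exact d1.trans (by gcongr)
      _ = _ := by ring
  calc _ ≤ K * (6 / c * q + 4 / √c * (q + w) + q) + 3 / c * G * q := by gcongr
    _ ≤ K * (6 / c * (q + w) + 4 / √c * (q + w) + (q + w)) + 3 / c * G * (q + w) := by
        gcongr <;> linarith
    _ = _ := by ring

theorem exists_lipschitz_bound_of_limVar_pos (hY : WeakDep P Y 𝓕 γ C δ) (hδ : δ ∈ Ioo (0:ℝ) 1)
    {s : ℝ≥0} (hs : limVar γ = s) (hs0 : s ≠ 0) :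
    ∃ D, ∀ n : ℕ, 1 ≤ n → ∀ h : ℝ → ℝ, LipschitzWith 1 h →
      |∫ ω, h (psum Y n ω) ∂P - ∫ x, h x ∂gaussianReal 0 (s * n)| ≤
        D * (n:ℝ) ^ ((1 - δ) / 2) := by
  obtain ⟨K, hK0, hK⟩ := hY.exists_step_bound hδ
  set G := ∫ y, |y| ^ 3 ∂gaussianReal 0 s with hG
  have hG0 : 0 ≤ G := integral_nonneg fun y => by positivity
  set c : ℝ := min s 1 with hc
  have hc0 : 0 < c := lt_min (by positivity) one_pos
  set D := K * (6 / c + 4 / √c + 1) + 3 / c * G with hD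
  have hD0 : 0 ≤ D := by positivity
  refine ⟨D * (2 * (1 - (1 + δ) / 2)⁻¹) + 2, fun n hn h hh => ?_⟩
  set w : ℕ → ℝ → ℝ := fun j => gaussSmooth (s * j + 1) h with hw
  have hwl : ∀ j, LipschitzWith 1 (w j) := fun j => hh.gaussSmooth _
  have hws : ∀ j, w (j + 1) = gaussSmooth s (w j) := fun j => by
    rw [hw]
    simp only
    rw [← gaussSmooth_add hh]
    congr 1
    push_cast
    ring
  have hstep : ∀ k j : ℕ,
      |∫ ω, w j (psum Y (k + 1) ω) ∂P - ∫ ω, w (j + 1) (psum Y k ω) ∂P| ≤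
      D * (((j:ℝ) + 1) ^ (-((1 + δ) / 2)) + ((k:ℝ) + 1) ^ (-((1 + δ) / 2))) := fun k j => by
    have hv : s * (j:ℝ≥0) + 1 ≠ 0 := by positivity
    obtain ⟨A, B, hA, hB, hA1, hB1, hBL⟩ := exists_derivs_gaussSmooth hh hv
    have hBc : Measurable B := by
      have : LipschitzWith ⟨3 / ((s * (j:ℝ≥0) + 1 : ℝ≥0) : ℝ), by positivity⟩ B :=
        LipschitzWith.of_dist_le_mul fun x y => by
          simp only [Real.dist_eq]; exact hBL x y
      exact this.continuous.measurable
    have hvJ : c * ((j:ℝ) + 1) ≤ ((s * (j:ℝ≥0) + 1 : ℝ≥0) : ℝ) := by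
      push_cast
      have h1 : c ≤ s := min_le_left _ _
      have h2 : c ≤ 1 := min_le_right _ _
      have := Nat.cast_nonneg (α := ℝ) j
      nlinarith
    obtain ⟨m, hm, hme⟩ := step_error_le (l := (k:ℝ) + 1) hδ hc0
      (by linarith [Nat.cast_nonneg (α := ℝ) j] : (1:ℝ) ≤ (j:ℝ) + 1)
      (by linarith [Nat.cast_nonneg (α := ℝ) k]) hvJ hK0 hG0
    refine le_trans ?_ hme
    have h1 := hK (w j) A B _ _ (hwl j) hA hB hBc hA1 hB1 hBL k m hm
    have h2 : |∫ ω, w (j + 1) (psum Y k ω) ∂P - ∫ ω, w j (psum Y k ω) ∂P -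
        limVar γ / 2 * ∫ ω, B (psum Y k ω) ∂P| ≤ 3 / ((s * (j:ℝ≥0) + 1 : ℝ≥0) : ℝ) * G := by
      have i1 := hY.integrable_comp_psum (hwl (j + 1)) k
      have i0 := hY.integrable_comp_psum (hwl j) k
      have iB : Integrable (fun ω => limVar γ / 2 * B (psum Y k ω)) P :=
        (Integrable.of_bound (hBc.comp (hY.measurable_psum k)).aestronglyMeasurable _
          (ae_of_all _ fun ω => hB1 _)).const_mul _
      rw [← integral_const_mul, ← integral_sub i1 i0, ← integral_sub (by exact i1.sub i0) iB,
        ← Real.norm_eq_abs]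
      refine (norm_integral_le_of_norm_le_const (ae_of_all _ fun ω => ?_)).trans_eq
        (by rw [probReal_univ, mul_one])
      rw [hws, hs, Real.norm_eq_abs]
      exact abs_gaussSmooth_sub_sub_le (hwl j) hA hB (by positivity) hBL s _
    rw [abs_le] at *
    constructor <;> linarith [h1.1, h1.2, h2.1, h2.2]
  have htel : ∀ k, k ≤ n → |∫ ω, w (n - k) (psum Y k ω) ∂P - ∫ ω, w n (psum Y 0 ω) ∂P| ≤
      ∑ i ∈ Finset.range k, D * ((((n - 1 - i : ℕ) : ℝ) + 1) ^ (-((1 + δ) / 2)) +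
        ((i:ℝ) + 1) ^ (-((1 + δ) / 2))) := fun k => by
    induction k with
    | zero => simp
    | succ k ih =>
      intro hk
      have ih := ih (by omega)
      have h1 := hstep k (n - 1 - k)
      rw [show n - 1 - k + 1 = n - k by omega] at h1
      rw [Finset.sum_range_succ, show n - (k + 1) = n - 1 - k by omega]
      refine (abs_sub_le _ (∫ ω, w (n - k) (psum Y k ω) ∂P) _).trans ?_
      linarith
  have hmain := htel n le_rfl
  have hsum : ∑ i ∈ Finset.range n, D * ((((n - 1 - i : ℕ) : ℝ) + 1) ^ (-((1 + δ) / 2)) +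
        ((i:ℝ) + 1) ^ (-((1 + δ) / 2))) ≤
      D * (2 * (1 - (1 + δ) / 2)⁻¹) * (n:ℝ) ^ ((1 - δ) / 2) := by
    rw [← Finset.mul_sum, Finset.sum_add_distrib,
      Finset.sum_range_reflect (fun i : ℕ => ((i:ℝ) + 1) ^ (-((1 + δ) / 2)))]
    have := sum_range_rpow_neg_le (s := (1 + δ) / 2) ⟨by linarith [hδ.1], by linarith [hδ.2]⟩ n
    rw [show (1 - δ) / 2 = 1 - (1 + δ) / 2 by ring, mul_assoc D]
    refine mul_le_mul_of_nonneg_left ?_ hD0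
    linarith
  have hend1 : |∫ ω, w 0 (psum Y n ω) ∂P - ∫ ω, h (psum Y n ω) ∂P| ≤ 1 := by
    rw [← integral_sub (hY.integrable_comp_psum (hwl 0) n) (hY.integrable_comp_psum hh n),
      ← Real.norm_eq_abs]
    refine (norm_integral_le_of_norm_le_const (C := 1) (ae_of_all _ fun ω => ?_)).trans_eq
      (by rw [probReal_univ, mul_one])
    simpa [hw] using abs_gaussSmooth_sub_le hh 1 (psum Y n ω)
  have hend2 : |∫ ω, w n (psum Y 0 ω) ∂P - ∫ x, h x ∂gaussianReal 0 (s * n)| ≤ 1 := by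
    have := abs_gaussSmooth_sub_le (hh.gaussSmooth (s * n)) 1 0
    rw [← gaussSmooth_add hh, add_comm] at this
    simpa [hw, psum, gaussSmooth] using this
  rw [Nat.sub_self] at hmain
  have hn1 : (1:ℝ) ≤ (n:ℝ) ^ ((1 - δ) / 2) :=
    Real.one_le_rpow (by exact_mod_cast hn) (by linarith [hδ.2])
  rw [abs_le] at *
  constructor <;> nlinarith [hmain.1, hmain.2, hend1.1, hend1.2, hend2.1, hend2.2]

end WeakDep

namespace WeakDep

variable {Ω : Type*} [m0 : MeasurableSpace Ω] {P : Measure Ω} [IsProbabilityMeasure P]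
  {Y : ℕ → Ω → ℝ} {𝓕 : ℕ → MeasurableSpace Ω} {γ : ℕ → ℝ} {C δ : ℝ}

lemma integrable_psum_mul (hY : WeakDep P Y 𝓕 γ C δ) (n k : ℕ) :
    Integrable (fun ω => psum Y n ω * Y k ω) P := by
  simp only [psum, Finset.sum_mul]
  exact integrable_finsetSum _ fun i _ => hY.integrable_mul i k

lemma integrable_psum_sq (hY : WeakDep P Y 𝓕 γ C δ) (n : ℕ) :
    Integrable (fun ω => psum Y n ω ^ 2) P := by
  simp only [sq, psum, Finset.sum_mul, Finset.mul_sum]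
  exact integrable_finsetSum _ fun i _ => integrable_finsetSum _ fun j _ => hY.integrable_mul _ _

lemma integral_psum_mul (hY : WeakDep P Y 𝓕 γ C δ) (n : ℕ) :
    ∫ ω, psum Y n ω * Y n ω ∂P = ∑ i ∈ Finset.range n, γ (i + 1) := by
  simp only [psum, Finset.sum_mul]
  rw [integral_finsetSum _ fun i _ => hY.integrable_mul i n,
    ← Finset.sum_range_reflect (fun i => γ (i + 1))]
  refine Finset.sum_congr rfl fun i hi => ?_
  have hi := Finset.mem_range.1 hi
  rw [← hY.cov i, show i + (n - 1 - i + 1) = n by omega]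

lemma integral_psum_succ_sq (hY : WeakDep P Y 𝓕 γ C δ) (n : ℕ) :
    ∫ ω, psum Y (n + 1) ω ^ 2 ∂P =
      ∫ ω, psum Y n ω ^ 2 ∂P + (γ 0 + 2 * ∑ i ∈ Finset.range n, γ (i + 1)) := by
  have h1 := (hY.integrable_psum_mul n n).const_mul 2
  rw [← hY.integral_psum_mul n, ← hY.cov n 0, ← integral_const_mul,
    ← integral_add' (hY.integrable_mul n (n + 0)) h1, ← integral_add' (hY.integrable_psum_sq n)
      ((hY.integrable_mul n (n + 0)).add h1)]
  congr 1 with ω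
  simp only [psum_succ, add_zero, Pi.add_apply]
  ring

lemma exists_abs_integral_psum_sq_sub_le (hY : WeakDep P Y 𝓕 γ C δ) (hδ : δ ∈ Ioo (0:ℝ) 1) :
    ∃ D, 0 ≤ D ∧ ∀ n : ℕ, |∫ ω, psum Y n ω ^ 2 ∂P - n * limVar γ| ≤ D * (n:ℝ) ^ (1 - δ) := by
  have hC := hY.C_nonneg
  have h : ∀ n : ℕ, |∫ ω, psum Y n ω ^ 2 ∂P - n * limVar γ| ≤
      ∑ i ∈ Finset.range n, 2 * (C * (4 / δ * ((i:ℝ) + 1) ^ (-δ))) := fun n => by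
    induction n with
    | zero => simp [psum]
    | succ n ih =>
      have h1 := hY.abs_tsum_sub_sum_cov_le hδ n
      rw [Finset.sum_range_succ, hY.integral_psum_succ_sq]
      unfold limVar at *
      push_cast
      rw [abs_le] at *
      constructor <;> linarith [h1.1, h1.2, ih.1, ih.2]
  have hδ0 := hδ.1
  refine ⟨2 * (C * (4 / δ * (1 - δ)⁻¹)), ?_, fun n => (h n).trans ?_⟩
  · have : 0 ≤ (1 - δ)⁻¹ := inv_nonneg.2 (by linarith [hδ.2])
    positivity
  · rw [← Finset.mul_sum, ← Finset.mul_sum, ← Finset.mul_sum]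
    simp only [mul_assoc]
    gcongr
    exact sum_range_rpow_neg_le hδ n

lemma limVar_nonneg (hY : WeakDep P Y 𝓕 γ C δ) (hδ : δ ∈ Ioo (0:ℝ) 1) : 0 ≤ limVar γ := by
  obtain ⟨D, hD0, hD⟩ := hY.exists_abs_integral_psum_sq_sub_le hδ
  have hlim : Tendsto (fun n : ℕ => -D * (n:ℝ) ^ (-δ)) atTop (𝓝 (-D * 0)) :=
    ((tendsto_rpow_neg_atTop hδ.1).comp tendsto_natCast_atTop_atTop).const_mul _
  rw [mul_zero] at hlim
  refine le_of_tendsto hlim ?_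
  filter_upwards [eventually_ge_atTop 1] with n hn
  have hn0 : (0:ℝ) < n := by exact_mod_cast hn
  have h1 := (abs_le.1 (hD n)).2
  have h2 : 0 ≤ ∫ ω, psum Y n ω ^ 2 ∂P := integral_nonneg fun ω => sq_nonneg _
  have h3 : (n:ℝ) ^ (1 - δ) = (n:ℝ) ^ (-δ) * n := by
    rw [← Real.rpow_add_one hn0.ne']; congr 1; ring
  rw [h3] at h1
  have h4 : (-D * (n:ℝ) ^ (-δ)) * n ≤ limVar γ * n := by linarith
  exact le_of_mul_le_mul_right h4 hn0

/-- Rate of normal approximation of the partial sums over Lipschitz test functions. -/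
theorem exists_lipschitz_bound (hY : WeakDep P Y 𝓕 γ C δ) (hδ : δ ∈ Ioo (0:ℝ) 1) :
    ∃ D, ∀ n : ℕ, 1 ≤ n → ∀ h : ℝ → ℝ, LipschitzWith 1 h →
      |∫ ω, h (psum Y n ω) ∂P - ∫ x, h x ∂gaussianReal 0 ((limVar γ).toNNReal * n)| ≤
        D * (n:ℝ) ^ ((1 - δ) / 2) := by
  have h0 := hY.limVar_nonneg hδ
  rcases h0.eq_or_lt with h | h
  · obtain ⟨D, hD0, hD⟩ := hY.exists_abs_integral_psum_sq_sub_le hδ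
    refine ⟨√D, fun n hn u hu => ?_⟩
    simp only [← h, Real.toNNReal_zero, zero_mul, gaussianReal_zero_var, integral_dirac]
    have h1 : ∫ ω, psum Y n ω ^ 2 ∂P ≤ D * (n:ℝ) ^ (1 - δ) := by
      have := (abs_le.1 (hD n)).2
      rw [← h] at this
      linarith
    have hm : MemLp (fun ω => |psum Y n ω|) 2 P :=
      ((memLp_two_iff_integrable_sq (hY.measurable_psum n).aestronglyMeasurable).2
        (hY.integrable_psum_sq n)).abs
    have hvar := variance_nonneg (fun ω => |psum Y n ω|) P
    rw [variance_eq_sub hm] at hvar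
    simp only [Pi.pow_apply, sq_abs] at hvar
    have h2 : |∫ ω, u (psum Y n ω) ∂P - u 0| ≤ ∫ ω, |psum Y n ω| ∂P := by
      have hi := hY.integrable_comp_psum hu n
      have : ∫ ω, u (psum Y n ω) ∂P - u 0 = ∫ ω, (u (psum Y n ω) - u 0) ∂P := by
        rw [integral_sub hi (integrable_const _)]; simp
      rw [this]
      refine abs_integral_le_integral_abs.trans (integral_mono (hi.sub (integrable_const _)).abs
        (hY.integrable_psum n).abs fun ω => ?_)
      have := hu.dist_le_mul (psum Y n ω) 0
      simpa [Real.dist_eq] using this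
    refine h2.trans ?_
    have h3 : ∫ ω, |psum Y n ω| ∂P ≤ √(D * (n:ℝ) ^ (1 - δ)) :=
      Real.le_sqrt_of_sq_le (by linarith)
    refine h3.trans_eq ?_
    rw [Real.sqrt_mul hD0, Real.sqrt_eq_rpow ((n:ℝ) ^ (1 - δ)), ← Real.rpow_mul (by positivity)]
    congr 2
    ring
  · exact hY.exists_lipschitz_bound_of_limVar_pos hδ (Real.coe_toNNReal _ h0).symm
      (Real.toNNReal_pos.2 h).ne'

end WeakDep

lemma ConcaveOn.le_two_mul_add {c : ℝ → ℝ} (hc : ConcaveOn ℝ (Ici (0:ℝ)) c) (hc0 : c 0 = 0)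
    (hcn : ∀ x, 0 ≤ x → 0 ≤ c x) {r t : ℝ} (hr : 0 < r) (ht : 0 ≤ t) :
    c t ≤ 2 * c r + c r / r * t := by
  have hcr := hcn r hr.le
  have hx : 0 ≤ c r / r * t := by positivity
  rcases lt_or_ge t r with h | h
  · have h1 := hc.2 (mem_Ici.2 ht) (mem_Ici.2 (by linarith : (0:ℝ) ≤ 2 * r - t))
      (by norm_num : (0:ℝ) ≤ 1 / 2) (by norm_num : (0:ℝ) ≤ 1 / 2) (by norm_num)
    simp only [smul_eq_mul] at h1
    rw [show 1 / 2 * t + 1 / 2 * (2 * r - t) = r by ring] at h1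
    have h2 := hcn (2 * r - t) (by linarith)
    linarith
  · have ht0 : 0 < t := hr.trans_le h
    have h1 := hc.2 (mem_Ici.2 ht) (mem_Ici.2 le_rfl) (by positivity : 0 ≤ r / t)
      (by rw [sub_nonneg, div_le_one ht0]; exact h : 0 ≤ 1 - r / t) (by ring)
    simp only [smul_eq_mul, hc0, mul_zero, add_zero] at h1
    rw [div_mul_cancel₀ _ ht0.ne'] at h1
    have h2 : c t ≤ c r / r * t := by
      rw [div_mul_eq_mul_div, le_div_iff₀ hr]
      rw [div_mul_eq_mul_div, div_le_iff₀ ht0] at h1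
      linarith
    linarith

/-- A function of modulus at most `a + ℓ|x - y|` is within `a` of an `ℓ`-Lipschitz function. -/
lemma exists_lipschitz_approx {g : ℝ → ℝ} {a ℓ : ℝ} (hℓ : 0 ≤ ℓ)
    (hg : ∀ x y, |g x - g y| ≤ a + ℓ * |x - y|) :
    ∃ h : ℝ → ℝ, (∀ x y, |h x - h y| ≤ ℓ * |x - y|) ∧ ∀ x, |g x - h x| ≤ a := by
  have hlow : ∀ x y, g x - a ≤ g y + ℓ * |x - y| := fun x y => by
    have := (abs_le.1 (hg x y)).2
    linarith
  have hbdd : ∀ x, BddBelow (range fun y => g y + ℓ * |x - y|) := fun x =>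
    ⟨g x - a, by rintro _ ⟨y, rfl⟩; exact hlow x y⟩
  have hle : ∀ x y, (⨅ z, g z + ℓ * |x - z|) ≤ (⨅ z, g z + ℓ * |y - z|) + ℓ * |x - y| :=
    fun x y => by
      rw [← sub_le_iff_le_add]
      refine le_ciInf fun z => ?_
      have h1 := ciInf_le (hbdd x) z
      have h2 := mul_le_mul_of_nonneg_left (abs_sub_le x y z) hℓ
      linarith
  refine ⟨fun x => ⨅ y, g y + ℓ * |x - y|, fun x y => ?_, fun x => ?_⟩
  · have h1 := hle x y
    have h2 := hle y x
    rw [abs_sub_comm y x] at h2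
    rw [abs_le]
    constructor <;> linarith
  · have h1 := ciInf_le (hbdd x) x
    have h2 := le_ciInf (hlow x)
    have h0 : 0 ≤ a := by simpa using (abs_nonneg _).trans (hg x x)
    simp only [sub_self, abs_zero, mul_zero, add_zero] at h1
    rw [abs_le]
    constructor <;> linarith

lemma abs_integral_sub_integral_le_of_lipschitz {P Q : Measure ℝ} [IsProbabilityMeasure P]
    [IsProbabilityMeasure Q] {W : ℝ}
    (hW : ∀ h : ℝ → ℝ, LipschitzWith 1 h → |∫ x, h x ∂P - ∫ x, h x ∂Q| ≤ W)
    {ℓ : ℝ} (hℓ : 0 ≤ ℓ) {h : ℝ → ℝ} (hh : ∀ x y, |h x - h y| ≤ ℓ * |x - y|) :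
    |∫ x, h x ∂P - ∫ x, h x ∂Q| ≤ ℓ * W := by
  rcases hℓ.eq_or_lt with rfl | hℓ
  · have hconst : ∀ x, h x = h 0 := fun x => by
      have := hh x 0
      rw [zero_mul, abs_nonpos_iff, sub_eq_zero] at this
      exact this
    simp [hconst]
  · have h1 := hW (fun x => ℓ⁻¹ * h x) <| LipschitzWith.of_dist_le_mul fun x y => by
      rw [Real.dist_eq, Real.dist_eq, ← mul_sub, abs_mul, abs_of_pos (inv_pos.2 hℓ),
        NNReal.coe_one, one_mul, inv_mul_le_iff₀ hℓ]
      exact hh x y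
    rw [integral_const_mul, integral_const_mul, ← mul_sub, abs_mul, abs_of_pos (inv_pos.2 hℓ),
      inv_mul_le_iff₀ hℓ] at h1
    exact h1

/-- A bound on the Wasserstein distance controls `dC` for every concave modulus. -/
theorem dC_le_of_lipschitz {P Q : Measure ℝ} [IsProbabilityMeasure P] [IsProbabilityMeasure Q]
    (hP : Integrable (fun x => x) P) (hQ : Integrable (fun x => x) Q) {W : ℝ}
    (hW : ∀ h : ℝ → ℝ, LipschitzWith 1 h → |∫ x, h x ∂P - ∫ x, h x ∂Q| ≤ W)
    {c : ℝ → ℝ} (hc : ConcaveOn ℝ (Ici (0:ℝ)) c) (hc0 : c 0 = 0)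
    (hcn : ∀ x, 0 ≤ x → 0 ≤ c x) {r B : ℝ} (hr : 0 < r) (hB : W ≤ B * r) :
    dC c P Q ≤ (4 + B) * c r := by
  have hcr := hcn r hr.le
  have hW0 : 0 ≤ W := (abs_nonneg _).trans (hW _ (LipschitzWith.const' 0))
  have hB0 : 0 ≤ B := nonneg_of_mul_nonneg_left (hW0.trans hB) hr
  have hR : 0 ≤ (4 + B) * c r := by positivity
  have hshift : ∀ g ∈ LipC c, ∀ a : ℝ, (fun x => g x + a) ∈ LipC c := fun g hg a x y => by
    simpa using hg x y
  have hunb : ∀ (P₁ P₂ : Measure ℝ) [IsProbabilityMeasure P₁] [IsProbabilityMeasure P₂],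
      ∀ g ∈ LipC c, Integrable g P₁ → ¬ Integrable g P₂ → ∀ R : ℝ,
      ∃ k ∈ LipC c, R < |∫ x, k x ∂P₁ - ∫ x, k x ∂P₂| := by
    intro P₁ P₂ _ _ g hg h1 h2 R
    refine ⟨fun x => g x + (|R| + 1 - ∫ x, g x ∂P₁), hshift g hg _, ?_⟩
    rw [integral_add h1 (integrable_const _), integral_undef (μ := P₂)]
    · simp only [integral_const, probReal_univ, smul_eq_mul, one_mul, sub_zero]
      rw [add_sub_cancel, abs_of_pos (by positivity)]
      linarith [le_abs_self R]
    · rwa [integrable_add_const_iff]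
  by_cases hmis : ∃ g ∈ LipC c, (Integrable g P ∧ ¬ Integrable g Q) ∨
      (Integrable g Q ∧ ¬ Integrable g P)
  · obtain ⟨g, hg, h | h⟩ := hmis
    · rw [dC, Real.iSup_of_not_bddAbove]
      · exact hR
      · rintro ⟨R, hRb⟩
        obtain ⟨k, hk, hlt⟩ := hunb P Q g hg h.1 h.2 R
        exact hlt.not_ge (hRb ⟨⟨k, hk⟩, rfl⟩)
    · rw [dC, Real.iSup_of_not_bddAbove]
      · exact hR
      · rintro ⟨R, hRb⟩
        obtain ⟨k, hk, hlt⟩ := hunb Q P g hg h.1 h.2 R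
        rw [abs_sub_comm] at hlt
        exact hlt.not_ge (hRb ⟨⟨k, hk⟩, rfl⟩)
  · push Not at hmis
    refine Real.iSup_le (fun g => ?_) hR
    obtain ⟨g, hg⟩ := g
    by_cases hgP : Integrable g P
    · have hgQ := (hmis g hg).1 hgP
      set ℓ := c r / r with hℓ
      have hℓ0 : 0 ≤ ℓ := by positivity
      obtain ⟨h, hh, hgh⟩ := exists_lipschitz_approx (g := g) (a := 2 * c r) hℓ0 fun x y =>
        (hg x y).trans (hc.le_two_mul_add hc0 hcn hr (abs_nonneg _))
      have hlip : LipschitzWith ⟨ℓ, hℓ0⟩ h := LipschitzWith.of_dist_le_mul fun x y => hh x y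
      have hint : ∀ (P₁ : Measure ℝ) [IsProbabilityMeasure P₁], Integrable (fun x => x) P₁ →
          Integrable g P₁ → |∫ x, g x ∂P₁ - ∫ x, h x ∂P₁| ≤ 2 * c r := by
        intro P₁ _ hP₁ hgP₁
        rw [← integral_sub hgP₁ (hlip.integrable_of_integrable_id hP₁), ← Real.norm_eq_abs]
        exact (norm_integral_le_of_norm_le_const (ae_of_all _ hgh)).trans_eq
          (by rw [probReal_univ, mul_one])
      have h1 := hint P hP hgP
      have h2 := hint Q hQ hgQ
      have h3 := abs_integral_sub_integral_le_of_lipschitz hW hℓ0 hh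
      have h4 : ℓ * W ≤ B * c r := by
        calc ℓ * W ≤ ℓ * (B * r) := by gcongr
          _ = B * c r := by rw [hℓ]; field_simp
      rw [abs_le] at *
      constructor <;> linarith [h1.1, h1.2, h2.1, h2.2, h3.1, h3.2]
    · have hgQ : ¬ Integrable g Q := fun h => hgP ((hmis g hg).2 h)
      simp only [integral_undef hgP, integral_undef hgQ, sub_self, abs_zero]
      exact hR

/-- Functions with a finite absolute third moment. -/
def L3 (μ : Measure ℝ) (h : ℝ → ℝ) : Prop := Measurable h ∧ Integrable (fun x => |h x| ^ 3) μ

lemma abs_add_pow_three_le (x y : ℝ) : |x + y| ^ 3 ≤ 4 * (|x| ^ 3 + |y| ^ 3) := by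
  have h1 : |x + y| ^ 3 ≤ (|x| + |y|) ^ 3 := pow_le_pow_left₀ (abs_nonneg _) (abs_add_le x y) 3
  have hx := abs_nonneg x
  have hy := abs_nonneg y
  nlinarith [mul_nonneg (add_nonneg hx hy) (sq_nonneg (|x| - |y|))]

namespace L3

variable {μ : Measure ℝ} {h k : ℝ → ℝ}

lemma add (hh : L3 μ h) (hk : L3 μ k) : L3 μ (fun x => h x + k x) := by
  refine ⟨hh.1.add hk.1, Integrable.mono' ((hh.2.add hk.2).const_mul 4)
    ((hh.1.add hk.1).abs.pow_const 3).aestronglyMeasurable (ae_of_all _ fun x => ?_)⟩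
  rw [Real.norm_eq_abs, abs_of_nonneg (by positivity)]
  exact abs_add_pow_three_le _ _

lemma const_mul (hh : L3 μ h) (c : ℝ) : L3 μ (fun x => c * h x) := by
  refine ⟨hh.1.const_mul c, ?_⟩
  simp only [abs_mul, mul_pow]
  exact hh.2.const_mul _

lemma neg (hh : L3 μ h) : L3 μ (fun x => - h x) := by simpa using hh.const_mul (-1)

lemma sub (hh : L3 μ h) (hk : L3 μ k) : L3 μ (fun x => h x - k x) := by
  simpa [sub_eq_add_neg] using hh.add hk.neg

lemma of_bounded [IsFiniteMeasure μ] (hh : Measurable h) {C : ℝ} (hC : ∀ x, |h x| ≤ C) :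
    L3 μ h := by
  refine ⟨hh, Integrable.of_bound (hh.abs.pow_const 3).aestronglyMeasurable (C ^ 3)
    (ae_of_all _ fun x => ?_)⟩
  rw [Real.norm_eq_abs, abs_of_nonneg (by positivity)]
  exact pow_le_pow_left₀ (abs_nonneg _) (hC x) 3

lemma zero [IsFiniteMeasure μ] : L3 μ (fun _ => 0) :=
  of_bounded measurable_const (C := 0) (by simp)

lemma sum [IsFiniteMeasure μ] {ι : Type*} (s : Finset ι) {g : ι → ℝ → ℝ}
    (hg : ∀ i, L3 μ (g i)) : L3 μ (fun x => ∑ i ∈ s, g i x) := by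
  classical
  induction s using Finset.induction_on with
  | empty => simpa using zero
  | insert i s hi ih => simpa [Finset.sum_insert hi] using (hg i).add ih

end L3

lemma L3.integrable {μ : Measure ℝ} [IsFiniteMeasure μ] {h : ℝ → ℝ} (hh : L3 μ h) :
    Integrable h μ :=
  Integrable.mono' ((integrable_const 1).add hh.2) hh.1.aestronglyMeasurable
    (ae_of_all _ fun _ => WeakDep.abs_le_one_add_cube _)

/-- A functional which is linear on functions with finite third moments. -/
structure Lin3 (μ : Measure ℝ) (Ψ : (ℝ → ℝ) → ℝ) : Prop where
  add : ∀ h k, L3 μ h → L3 μ k → Ψ (fun x => h x + k x) = Ψ h + Ψ k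
  const_mul : ∀ (c : ℝ) h, L3 μ h → Ψ (fun x => c * h x) = c * Ψ h

namespace Lin3

variable {μ : Measure ℝ} {Ψ : (ℝ → ℝ) → ℝ}

lemma sub (hΨ : Lin3 μ Ψ) {h k : ℝ → ℝ} (hh : L3 μ h) (hk : L3 μ k) :
    Ψ (fun x => h x - k x) = Ψ h - Ψ k := by
  have h1 := hΨ.add h (fun x => -1 * k x) hh (hk.const_mul _)
  rw [hΨ.const_mul _ _ hk] at h1
  simpa [sub_eq_add_neg] using h1

lemma sum [IsFiniteMeasure μ] (hΨ : Lin3 μ Ψ) {ι : Type*} (s : Finset ι) {g : ι → ℝ → ℝ}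
    (hg : ∀ i, L3 μ (g i)) : Ψ (fun x => ∑ i ∈ s, g i x) = ∑ i ∈ s, Ψ (g i) := by
  classical
  induction s using Finset.induction_on with
  | empty => simpa using hΨ.const_mul 0 (fun _ => 0) L3.zero
  | insert i s hi ih =>
    simp only [Finset.sum_insert hi]
    rw [hΨ.add _ _ (hg i) (L3.sum s hg), ih]

end Lin3

/-- A trilinear form controlled by the three marginals. -/
structure TriForm (μ : Measure ℝ) (Λ : (ℝ → ℝ) → (ℝ → ℝ) → (ℝ → ℝ) → ℝ) : Prop where
  lin₁ : ∀ k l, L3 μ k → L3 μ l → Lin3 μ fun h => Λ h k l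
  lin₂ : ∀ h l, L3 μ h → L3 μ l → Lin3 μ fun k => Λ h k l
  lin₃ : ∀ h k, L3 μ h → L3 μ k → Lin3 μ fun l => Λ h k l
  bound : ∀ h k l : ℝ → ℝ, L3 μ h → L3 μ k → L3 μ l → ∀ u v w : ℝ → ℝ,
    Measurable u → Measurable v → Measurable w → Integrable u μ → Integrable v μ → Integrable w μ →
    (∀ x y z, |h x * k y * l z| ≤ u x + v y + w z) →
    |Λ h k l| ≤ 2 * (∫ x, u x ∂μ + ∫ x, v x ∂μ + ∫ x, w x ∂μ)

lemma TriForm.rot {μ : Measure ℝ} {Λ : (ℝ → ℝ) → (ℝ → ℝ) → (ℝ → ℝ) → ℝ} (hΛ : TriForm μ Λ) :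
    TriForm μ fun k l h => Λ h k l where
  lin₁ l h hl hh := hΛ.lin₂ h l hh hl
  lin₂ k h hk hh := hΛ.lin₃ h k hh hk
  lin₃ k l hk hl := hΛ.lin₁ k l hk hl
  bound k l h hk hl hh v w u hvm hwm hum hv hw hu hb := by
    refine (hΛ.bound h k l hh hk hl u v w hum hvm hwm hu hv hw fun x y z => ?_).trans_eq (by ring)
    have := hb y z x
    rw [show h x * k y * l z = k y * l z * h x by ring]
    linarith

/-- Monotone on an open interval and zero elsewhere. -/
def PieceMono (g : ℝ → ℝ) : Prop :=
  ∃ I : Set ℝ, IsOpen I ∧ I.OrdConnected ∧ (MonotoneOn g I ∨ AntitoneOn g I) ∧ ∀ x ∉ I, g x = 0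

namespace PieceMono

variable {g : ℝ → ℝ}

lemma comp (hg : PieceMono g) {φ : ℝ → ℝ} (hφ : Monotone φ) (h0 : φ 0 = 0) :
    PieceMono fun x => φ (g x) := by
  obtain ⟨I, hIo, hIc, hm, hz⟩ := hg
  refine ⟨I, hIo, hIc, hm.imp (fun h => hφ.comp_monotoneOn h) (fun h => hφ.comp_antitoneOn h),
    fun x hx => ?_⟩
  simp only [hz x hx, h0]

lemma neg (hg : PieceMono g) : PieceMono fun x => - g x := by
  obtain ⟨I, hIo, hIc, hm, hz⟩ := hg
  exact ⟨I, hIo, hIc, hm.symm.imp (fun h => h.neg) (fun h => h.neg), fun x hx => by simp [hz x hx]⟩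

lemma ordConnected_lt (hg : PieceMono g) {s : ℝ} (hs : 0 ≤ s) : {x | s < g x}.OrdConnected := by
  obtain ⟨I, hIo, hIc, hm, hz⟩ := hg
  have hI : ∀ x, s < g x → x ∈ I := fun x hx => by
    by_contra h
    rw [hz x h] at hx
    linarith
  refine ⟨fun x hx y hy z hzz => ?_⟩
  have hzI := hIc.out (hI x hx) (hI y hy) hzz
  rcases hm with hm | hm
  · exact lt_of_lt_of_le hx (hm (hI x hx) hzI hzz.1)
  · exact lt_of_lt_of_le hy (hm hzI (hI y hy) hzz.2)

lemma ordConnected_le (hg : PieceMono g) {s : ℝ} (hs : 0 < s) : {x | s ≤ g x}.OrdConnected := by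
  obtain ⟨I, hIo, hIc, hm, hz⟩ := hg
  have hI : ∀ x, s ≤ g x → x ∈ I := fun x hx => by
    by_contra h
    rw [hz x h] at hx
    linarith
  refine ⟨fun x hx y hy z hzz => ?_⟩
  have hzI := hIc.out (hI x hx) (hI y hy) hzz
  rcases hm with hm | hm
  · exact le_trans hx (hm (hI x hx) hzI hzz.1)
  · exact le_trans hy (hm hzI (hI y hy) hzz.2)

lemma measurable (hg : PieceMono g) : Measurable g := by
  refine measurable_of_Ioi fun t => ?_
  rcases le_or_gt 0 t with ht | ht
  · exact (hg.ordConnected_lt ht).measurableSet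
  · have h1 : g ⁻¹' Ioi t = {x | -t ≤ -g x}ᶜ := by ext x; simp
    rw [h1]
    exact (hg.neg.ordConnected_le (neg_pos.2 ht)).measurableSet.compl

end PieceMono

namespace Lin3

variable {μ : Measure ℝ} [IsProbabilityMeasure μ] {Ψ : (ℝ → ℝ) → ℝ} {b : ℝ}

lemma abs_isLowerSet_le (hΨ : Lin3 μ Ψ)
    (hB : ∀ h, Measurable h → (∀ x, |h x| ≤ 1) → |Ψ h| ≤ 2 * ∫ x, |h x| ∂μ)
    (hb : ∀ t, |Ψ (indic t)| ≤ b) {S : Set ℝ} (hS : IsLowerSet S) :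
    |Ψ (S.indicator fun _ => 1)| ≤ b := by
  have hSm : MeasurableSet S := hS.ordConnected.measurableSet
  have hb0 : 0 ≤ b := (abs_nonneg _).trans (hb 0)
  have key : ∀ A ⊆ S, MeasurableSet A →
      |Ψ (S.indicator fun _ => 1)| ≤ |Ψ (A.indicator fun _ => 1)| + 2 * μ.real (S \ A) := by
    intro A hAS hA
    have hd : MeasurableSet (S \ A) := hSm.diff hA
    have h3 : ∀ B : Set ℝ, ∀ x, |B.indicator (fun _ => (1:ℝ)) x| ≤ 1 := fun B x => by
      by_cases h : x ∈ B <;> simp [h]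
    have h3m : ∀ B : Set ℝ, MeasurableSet B → Measurable (B.indicator fun _ => (1:ℝ)) :=
      fun B hB => measurable_const.indicator hB
    have h1 := hΨ.add (A.indicator fun _ => 1) ((S \ A).indicator fun _ => 1)
      (L3.of_bounded (h3m _ hA) (h3 _)) (L3.of_bounded (h3m _ hd) (h3 _))
    have h2 : (fun x => A.indicator (fun _ => (1:ℝ)) x + (S \ A).indicator (fun _ => (1:ℝ)) x)
        = S.indicator fun _ => 1 := by
      funext x
      by_cases hx : x ∈ A
      · simp [hx, hAS hx]
      · by_cases hx' : x ∈ S <;> simp [hx, hx']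
    rw [h2] at h1
    rw [h1]
    refine (abs_add_le _ _).trans (add_le_add_right ?_ _)
    refine (hB _ (h3m _ hd) (h3 _)).trans_eq ?_
    congr 1
    rw [← integral_indicator_one hd]
    refine integral_congr_ae (ae_of_all _ fun x => ?_)
    exact abs_of_nonneg (indicator_nonneg (fun _ _ => zero_le_one) x)
  refine le_of_forall_pos_le_add fun ε hε => ?_
  obtain ⟨A, hAS, hA, hμ⟩ := hSm.exists_isCompact_sdiff_lt (μ := μ) (measure_ne_top _ _)
    (ENNReal.ofReal_pos.2 (half_pos hε)).ne'
  have hμ' : μ.real (S \ A) < ε / 2 := by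
    rw [Measure.real, ← ENNReal.toReal_ofReal (half_pos hε).le]
    exact (ENNReal.toReal_lt_toReal (measure_ne_top _ _) ENNReal.ofReal_ne_top).2 hμ
  rcases A.eq_empty_or_nonempty with rfl | hne
  · have h0 : Ψ ((∅ : Set ℝ).indicator fun _ => 1) = 0 := by
      have := hΨ.const_mul 0 (fun _ => 0) L3.zero
      simpa [indicator_empty'] using this
    have := key ∅ (empty_subset _) MeasurableSet.empty
    rw [h0, abs_zero] at this
    linarith
  · have hmax := hA.sSup_mem hne
    have hsub : Iic (sSup A) ⊆ S := fun x hx => hS hx (hAS hmax)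
    have hle : μ.real (S \ Iic (sSup A)) ≤ μ.real (S \ A) :=
      measureReal_mono (sdiff_subset_sdiff_right fun x hx => le_csSup hA.bddAbove hx)
    have h1 := key _ hsub measurableSet_Iic
    have h2 := hb (sSup A)
    rw [indic] at h2
    linarith

lemma abs_ordConnected_le (hΨ : Lin3 μ Ψ)
    (hB : ∀ h, Measurable h → (∀ x, |h x| ≤ 1) → |Ψ h| ≤ 2 * ∫ x, |h x| ∂μ)
    (hb : ∀ t, |Ψ (indic t)| ≤ b) {S : Set ℝ} (hS : S.OrdConnected) :
    |Ψ (S.indicator fun _ => 1)| ≤ 2 * b := by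
  set U : Set ℝ := SetLike.coe (lowerClosure S)
  have hU : IsLowerSet U := (lowerClosure S).lower
  have hV : IsLowerSet (U \ S) := by
    rintro x y hyx ⟨hxU, hxS⟩
    refine ⟨hU hyx hxU, fun hyS => hxS ?_⟩
    obtain ⟨z, hz, hxz⟩ := mem_lowerClosure.1 hxU
    exact hS.out hyS hz ⟨hyx, hxz⟩
  have hSU : S ⊆ U := subset_lowerClosure
  have h3 : ∀ B : Set ℝ, ∀ x, |B.indicator (fun _ => (1:ℝ)) x| ≤ 1 := fun B x => by
    by_cases h : x ∈ B <;> simp [h]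
  have h3m : ∀ B : Set ℝ, B.OrdConnected → Measurable (B.indicator fun _ => (1:ℝ)) :=
    fun B hB => measurable_const.indicator hB.measurableSet
  have h1 := hΨ.sub (L3.of_bounded (h3m _ hU.ordConnected) (h3 _))
    (L3.of_bounded (μ := μ) (h3m _ hV.ordConnected) (h3 _))
  have h2 : (fun x => U.indicator (fun _ => (1:ℝ)) x - (U \ S).indicator (fun _ => (1:ℝ)) x)
      = S.indicator fun _ => 1 := by
    funext x
    by_cases hx : x ∈ S
    · simp [hx, hSU hx]
    · by_cases hx' : x ∈ U <;> simp [hx, hx']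
  rw [h2] at h1
  rw [h1]
  refine (abs_sub _ _).trans ?_
  linarith [hΨ.abs_isLowerSet_le hB hb hU, hΨ.abs_isLowerSet_le hB hb hV]

lemma abs_sub_avg_indicator_le {y : ℝ} (hy0 : 0 ≤ y) (hy1 : y ≤ 1) {N : ℕ} (hN : 0 < N) :
    |y - (1 / N : ℝ) * ∑ j ∈ Finset.range N, if (j : ℝ) / N < y then (1:ℝ) else 0| ≤ 1 / N := by
  have hN' : (0:ℝ) < N := by exact_mod_cast hN
  have h1 : ∑ j ∈ Finset.range N, (if (j : ℝ) / N < y then (1:ℝ) else 0) = (⌈N * y⌉₊ : ℝ) := by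
    have h2 : ∀ j : ℕ, (j : ℝ) / N < y ↔ j < ⌈N * y⌉₊ := fun j => by
      rw [Nat.lt_ceil, div_lt_iff₀ hN', mul_comm]
    simp only [h2]
    rw [Finset.sum_boole]
    congr 1
    have : (Finset.range N).filter (fun j => j < ⌈N * y⌉₊) = Finset.range ⌈N * y⌉₊ := by
      ext j
      simp only [Finset.mem_filter, Finset.mem_range, and_iff_right_iff_imp]
      intro hj
      refine hj.trans_le (Nat.ceil_le.2 ?_)
      nlinarith
    rw [this, Finset.card_range]
  rw [h1]
  have h3 := Nat.le_ceil (N * y)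
  have h4 := Nat.ceil_lt_add_one (mul_nonneg hN'.le hy0)
  rw [abs_le]
  constructor
  · have : (1 / N : ℝ) * (⌈N * y⌉₊ : ℝ) ≤ 1 / N * (N * y + 1) := by gcongr
    have e : (1 / N : ℝ) * (N * y + 1) = y + 1 / N := by field_simp
    linarith
  · have : (1 / N : ℝ) * (N * y) ≤ 1 / N * (⌈N * y⌉₊ : ℝ) := by gcongr
    have e : (1 / N : ℝ) * (N * y) = y := by field_simp
    have : (0:ℝ) < 1 / N := by positivity
    linarith

lemma abs_pieceMono_le (hΨ : Lin3 μ Ψ)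
    (hB : ∀ h, Measurable h → (∀ x, |h x| ≤ 1) → |Ψ h| ≤ 2 * ∫ x, |h x| ∂μ)
    (hb : ∀ t, |Ψ (indic t)| ≤ b) {h : ℝ → ℝ} (hh : PieceMono h) (h1 : ∀ x, |h x| ≤ 1) :
    |Ψ h| ≤ 4 * b := by
  have hN : ∀ N : ℕ, 0 < N → |Ψ h| ≤ 4 * b + 2 * (1 / N) := by
    intro N hN
    have hN' : (0:ℝ) < N := by exact_mod_cast hN
    set A : ℕ → Set ℝ := fun j => {x | (j : ℝ) / N < h x}
    set A' : ℕ → Set ℝ := fun j => {x | (j : ℝ) / N < - h x}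
    have hA : ∀ j, (A j).OrdConnected := fun j => hh.ordConnected_lt (by positivity)
    have hA' : ∀ j, (A' j).OrdConnected := fun j => hh.neg.ordConnected_lt (by positivity)
    have h3 : ∀ B : Set ℝ, ∀ x, |B.indicator (fun _ => (1:ℝ)) x| ≤ 1 := fun B x => by
      by_cases h : x ∈ B <;> simp [h]
    have h3m : ∀ B : Set ℝ, B.OrdConnected → L3 μ (B.indicator fun _ => (1:ℝ)) :=
      fun B hB => L3.of_bounded (measurable_const.indicator hB.measurableSet) (h3 B)
    set q : ℕ → ℝ → ℝ := fun j x =>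
      (A j).indicator (fun _ => (1:ℝ)) x - (A' j).indicator (fun _ => (1:ℝ)) x
    have hq : ∀ j, L3 μ (q j) := fun j => (h3m _ (hA j)).sub (h3m _ (hA' j))
    have hs : L3 μ (fun x => ∑ j ∈ Finset.range N, q j x) := L3.sum _ hq
    have hhL : L3 μ h := L3.of_bounded hh.measurable h1
    set r : ℝ → ℝ := fun x => h x - (1 / N : ℝ) * ∑ j ∈ Finset.range N, q j x
    have hr : L3 μ r := hhL.sub (hs.const_mul _)
    have hrb : ∀ x, |r x| ≤ 1 / N := by
      intro x
      have e : ∑ j ∈ Finset.range N, q j x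
          = (∑ j ∈ Finset.range N, if (j : ℝ) / N < h x then (1:ℝ) else 0)
          - ∑ j ∈ Finset.range N, if (j : ℝ) / N < - h x then (1:ℝ) else 0 := by
        rw [← Finset.sum_sub_distrib]
        refine Finset.sum_congr rfl fun j _ => ?_
        simp only [q, A, A', indicator_apply, mem_ofPred_eq]
      have hz : ∀ y : ℝ, y ≤ 0 →
          ∑ j ∈ Finset.range N, (if (j : ℝ) / N < y then (1:ℝ) else 0) = 0 := fun y hy =>
        Finset.sum_eq_zero fun j _ => if_neg (not_lt.2 (hy.trans (by positivity)))
      have hx := abs_le.1 (h1 x)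
      simp only [r, e]
      rcases le_total 0 (h x) with h0 | h0
      · rw [hz (- h x) (by linarith), sub_zero]
        exact abs_sub_avg_indicator_le h0 hx.2 hN
      · rw [hz (h x) h0, zero_sub, ← abs_neg]
        have := abs_sub_avg_indicator_le (y := - h x) (by linarith) (by linarith) hN
        convert this using 2
        ring
    have hN1 : (1 / N : ℝ) ≤ 1 := by
      rw [div_le_one hN']
      exact_mod_cast hN
    have hΨr : |Ψ r| ≤ 2 * (1 / N) := by
      refine (hB r hr.1 fun x => (hrb x).trans hN1).trans ?_
      gcongr
      calc ∫ x, |r x| ∂μ ≤ ∫ x, (1 / N : ℝ) ∂μ :=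
            integral_mono hr.integrable.abs (integrable_const _) hrb
        _ = 1 / N := by simp
    have hΨq : ∀ j, |Ψ (q j)| ≤ 4 * b := fun j => by
      simp only [q]
      rw [hΨ.sub (h3m _ (hA j)) (h3m _ (hA' j))]
      refine (abs_sub _ _).trans ?_
      linarith [hΨ.abs_ordConnected_le hB hb (hA j), hΨ.abs_ordConnected_le hB hb (hA' j)]
    have hdec : Ψ h = Ψ r + (1 / N) * ∑ j ∈ Finset.range N, Ψ (q j) := by
      simp only [r]
      rw [hΨ.sub hhL (hs.const_mul _), hΨ.const_mul _ _ hs, hΨ.sum _ hq]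
      ring
    rw [hdec]
    refine (abs_add_le _ _).trans ?_
    rw [abs_mul, abs_of_pos (by positivity : (0:ℝ) < 1 / N)]
    have : |∑ j ∈ Finset.range N, Ψ (q j)| ≤ N * (4 * b) := by
      refine (Finset.abs_sum_le_sum_abs _ _).trans ?_
      refine (Finset.sum_le_sum fun j _ => hΨq j).trans_eq (by simp)
    have : (1 / N : ℝ) * |∑ j ∈ Finset.range N, Ψ (q j)| ≤ (1 / N) * (N * (4 * b)) := by gcongr
    have e : (1 / N : ℝ) * (N * (4 * b)) = 4 * b := by field_simp
    linarith
  have hlim : Tendsto (fun N : ℕ => 4 * b + 2 * (1 / ((N : ℝ) + 1))) atTop (𝓝 (4 * b + 2 * 0)) :=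
    (tendsto_one_div_add_atTop_nhds_zero_nat.const_mul 2).const_add _
  have := ge_of_tendsto' hlim fun N => by simpa using hN (N + 1) N.succ_pos
  simpa using this

end Lin3

namespace TriForm

variable {μ : Measure ℝ} [IsProbabilityMeasure μ] {Λ : (ℝ → ℝ) → (ℝ → ℝ) → (ℝ → ℝ) → ℝ} {b : ℝ}

lemma abs_le_of_bounded (hΛ : TriForm μ Λ) {h k l : ℝ → ℝ} (hh : Measurable h) (hk : Measurable k)
    (hl : Measurable l) (hh1 : ∀ x, |h x| ≤ 1) (hk1 : ∀ x, |k x| ≤ 1) (hl1 : ∀ x, |l x| ≤ 1) :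
    |Λ h k l| ≤ 2 * ∫ x, |h x| ∂μ := by
  have hhL := L3.of_bounded (μ := μ) hh hh1
  have := hΛ.bound h k l hhL (L3.of_bounded hk hk1) (L3.of_bounded hl hl1)
    (fun x => |h x|) (fun _ => 0) (fun _ => 0) hh.abs measurable_const measurable_const
    hhL.integrable.abs (integrable_zero _ _ _) (integrable_zero _ _ _) fun x y z => by
      rw [abs_mul, abs_mul]
      have h1 := abs_nonneg (h x)
      have : |h x| * |k y| ≤ |h x| * 1 := by gcongr; exact hk1 y
      have : |h x| * |k y| * |l z| ≤ |h x| * |k y| * 1 := by gcongr; exact hl1 z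
      linarith
  simpa using this

lemma abs_pieceMono_slot_le (hΛ : TriForm μ Λ) {k l : ℝ → ℝ} (hk : Measurable k)
    (hl : Measurable l) (hk1 : ∀ x, |k x| ≤ 1) (hl1 : ∀ x, |l x| ≤ 1)
    (hb : ∀ t, |Λ (indic t) k l| ≤ b) {h : ℝ → ℝ} (hh : PieceMono h) (hh1 : ∀ x, |h x| ≤ 1) :
    |Λ h k l| ≤ 4 * b :=
  (hΛ.lin₁ k l (L3.of_bounded hk hk1) (L3.of_bounded hl hl1)).abs_pieceMono_le
    (fun _ hm h1 => hΛ.abs_le_of_bounded hm hk hl h1 hk1 hl1) hb hh hh1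

lemma measurable_indic (t : ℝ) : Measurable (indic t) :=
  measurable_const.indicator measurableSet_Iic

lemma abs_indic_le (t x : ℝ) : |indic t x| ≤ 1 := by
  by_cases h : x ∈ Iic t <;> simp [indic, h]

lemma abs_pieceMono_le (hΛ : TriForm μ Λ) (hb : ∀ s t u, |Λ (indic s) (indic t) (indic u)| ≤ b)
    {h k l : ℝ → ℝ} (hh : PieceMono h) (hk : PieceMono k) (hl : PieceMono l)
    (hh1 : ∀ x, |h x| ≤ 1) (hk1 : ∀ x, |k x| ≤ 1) (hl1 : ∀ x, |l x| ≤ 1) :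
    |Λ h k l| ≤ 64 * b := by
  have h1 : ∀ t u, |Λ h (indic t) (indic u)| ≤ 4 * b := fun t u =>
    hΛ.abs_pieceMono_slot_le (measurable_indic t) (measurable_indic u) (abs_indic_le t)
      (abs_indic_le u) (fun s => hb s t u) hh hh1
  have h2 : ∀ u, |Λ h k (indic u)| ≤ 4 * (4 * b) := fun u =>
    hΛ.rot.abs_pieceMono_slot_le (measurable_indic u) hh.measurable (abs_indic_le u)
      hh1 (fun t => h1 t u) hk hk1
  have h3 : |Λ h k l| ≤ 4 * (4 * (4 * b)) :=
    hΛ.rot.rot.abs_pieceMono_slot_le hh.measurable hk.measurable hh1 hk1 h2 hl hl1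
  linarith

end TriForm

/-- The cube of the excess of `|y|` over the level `T`. -/
def cubeExcess (T y : ℝ) : ℝ := (max (|y| - T) 0) ^ 3

lemma cubeExcess_nonneg (T y : ℝ) : 0 ≤ cubeExcess T y := pow_nonneg (le_max_right _ _) 3

lemma cubeExcess_le {T : ℝ} (hT : 0 ≤ T) (y : ℝ) : cubeExcess T y ≤ |y| ^ 3 :=
  pow_le_pow_left₀ (le_max_right _ _) (max_le (by linarith) (abs_nonneg y)) 3

lemma measurable_cubeExcess (T : ℝ) : Measurable (cubeExcess T) := by
  unfold cubeExcess
  fun_prop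

lemma continuous_cubeExcess (T : ℝ) : Continuous (cubeExcess T) := by
  unfold cubeExcess
  fun_prop

lemma abs_pow_three_le_cubeExcess {T y : ℝ} (hy : T < |y|) :
    |y| ^ 3 ≤ 8 * cubeExcess (T / 2) y := by
  have h1 : |y| ≤ 2 * max (|y| - T / 2) 0 := by
    have := le_max_left (|y| - T / 2) 0
    linarith
  calc |y| ^ 3 ≤ (2 * max (|y| - T / 2) 0) ^ 3 := pow_le_pow_left₀ (abs_nonneg _) h1 3
    _ = 8 * cubeExcess (T / 2) y := by rw [cubeExcess]; ring

lemma L3.integrable_cubeExcess {μ : Measure ℝ} {h : ℝ → ℝ} (hh : L3 μ h) {T : ℝ} (hT : 0 ≤ T) :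
    Integrable (fun x => cubeExcess T (h x)) μ :=
  Integrable.mono' hh.2 ((measurable_cubeExcess T).comp hh.1).aestronglyMeasurable
    (ae_of_all _ fun x => by
      rw [Real.norm_eq_abs, abs_of_nonneg (cubeExcess_nonneg _ _)]
      exact cubeExcess_le hT _)

lemma abs_mul_mul_le_cubeExcess {T a b c x y z : ℝ} (ha : |a| ≤ |x|)
    (hb : |b| ≤ |y|) (hc : |c| ≤ |z|)
    (h : T < |x| ∨ T < |y| ∨ T < |z| ∨ a * b * c = 0) :
    |a * b * c| ≤ 8 * cubeExcess (T / 2) x + 8 * cubeExcess (T / 2) y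
      + 8 * cubeExcess (T / 2) z := by
  have n1 := cubeExcess_nonneg (T / 2) x
  have n2 := cubeExcess_nonneg (T / 2) y
  have n3 := cubeExcess_nonneg (T / 2) z
  rcases eq_or_ne (a * b * c) 0 with h0 | h0
  · rw [h0, abs_zero]
    linarith
  have hle : ∀ m : ℝ, |x| ≤ m → |y| ≤ m → |z| ≤ m → |a * b * c| ≤ m ^ 3 := fun m hx hy hz => by
    rw [abs_mul, abs_mul]
    have hm : 0 ≤ m := (abs_nonneg _).trans hx
    calc |a| * |b| * |c| ≤ m * m * m := by
          gcongr <;> [exact ha.trans hx; exact hb.trans hy; exact hc.trans hz]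
      _ = m ^ 3 := by ring
  have key : ∀ w : ℝ, |x| ≤ |w| → |y| ≤ |w| → |z| ≤ |w| →
      |a * b * c| ≤ 8 * cubeExcess (T / 2) w := fun w hx hy hz => by
    refine (hle _ hx hy hz).trans (abs_pow_three_le_cubeExcess ?_)
    rcases h with h | h | h | h
    · linarith
    · linarith
    · linarith
    · exact absurd h h0
  rcases le_total |x| |y| with hxy | hxy <;> rcases le_total |y| |z| with hyz | hyz <;>
    rcases le_total |x| |z| with hxz | hxz
  · linarith [key z hxz hyz le_rfl]
  · linarith [key z (hxy.trans hyz) hyz le_rfl]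
  · linarith [key y hxy le_rfl hyz]
  · linarith [key y hxy le_rfl hyz]
  · linarith [key z hxz hyz le_rfl]
  · linarith [key x le_rfl hxy hxz]
  · linarith [key x le_rfl hxy (hyz.trans hxy)]
  · linarith [key x le_rfl hxy hxz]

namespace TriForm

variable {μ : Measure ℝ} {Λ : (ℝ → ℝ) → (ℝ → ℝ) → (ℝ → ℝ) → ℝ} {b : ℝ}

lemma abs_le_cubeExcess (hΛ : TriForm μ Λ) {a₁ a₂ a₃ z₁ z₂ z₃ : ℝ → ℝ} (ha₁ : L3 μ a₁)
    (ha₂ : L3 μ a₂) (ha₃ : L3 μ a₃) (hz₁ : L3 μ z₁) (hz₂ : L3 μ z₂) (hz₃ : L3 μ z₃)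
    (h₁ : ∀ x, |a₁ x| ≤ |z₁ x|) (h₂ : ∀ x, |a₂ x| ≤ |z₂ x|) (h₃ : ∀ x, |a₃ x| ≤ |z₃ x|)
    {T : ℝ} (hT : 0 < T)
    (h : ∀ x y z, T < |z₁ x| ∨ T < |z₂ y| ∨ T < |z₃ z| ∨ a₁ x * a₂ y * a₃ z = 0) :
    |Λ a₁ a₂ a₃| ≤ 16 * (∫ x, cubeExcess (T / 2) (z₁ x) ∂μ + ∫ x, cubeExcess (T / 2) (z₂ x) ∂μ
      + ∫ x, cubeExcess (T / 2) (z₃ x) ∂μ) := by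
  have hT2 : 0 ≤ T / 2 := by positivity
  have hm : ∀ z : ℝ → ℝ, L3 μ z → Measurable fun x => 8 * cubeExcess (T / 2) (z x) := fun z hz =>
    ((measurable_cubeExcess _).comp hz.1).const_mul 8
  refine (hΛ.bound a₁ a₂ a₃ ha₁ ha₂ ha₃ _ _ _ (hm _ hz₁) (hm _ hz₂) (hm _ hz₃)
    ((hz₁.integrable_cubeExcess hT2).const_mul 8) ((hz₂.integrable_cubeExcess hT2).const_mul 8)
    ((hz₃.integrable_cubeExcess hT2).const_mul 8)
    fun x y z => abs_mul_mul_le_cubeExcess (h₁ x) (h₂ y) (h₃ z) (h x y z)).trans_eq ?_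
  simp only [integral_const_mul]
  ring

lemma abs_pieceMono_le_cubeExcess [IsProbabilityMeasure μ] (hΛ : TriForm μ Λ)
    (hb : ∀ s t u, |Λ (indic s) (indic t) (indic u)| ≤ b)
    {g₁ g₂ g₃ : ℝ → ℝ} (hg₁ : PieceMono g₁) (hg₂ : PieceMono g₂) (hg₃ : PieceMono g₃)
    (hL₁ : L3 μ g₁) (hL₂ : L3 μ g₂) (hL₃ : L3 μ g₃) {T : ℝ} (hT : 0 < T) :
    |Λ g₁ g₂ g₃| ≤ 64 * b * T ^ 3 + 48 * (∫ x, cubeExcess (T / 2) (g₁ x) ∂μ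
      + ∫ x, cubeExcess (T / 2) (g₂ x) ∂μ + ∫ x, cubeExcess (T / 2) (g₃ x) ∂μ) := by
  set φ : ℝ → ℝ := fun y => max (-1) (min 1 (y / T))
  have hφm : Monotone φ := fun x y hxy => by
    simp only [φ]
    gcongr
  have hφ0 : φ 0 = 0 := by simp [φ]
  have hφ1 : ∀ y, |φ y| ≤ 1 := fun y =>
    abs_le.2 ⟨le_max_left _ _, max_le (by norm_num) (min_le_left _ _)⟩
  have hφa : ∀ y, |T * φ y| ≤ |y| ∧ |y - T * φ y| ≤ |y| ∧ (y - T * φ y = 0 ∨ T < |y|) := by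
    intro y
    rcases le_or_gt |y| T with hy | hy
    · have h1 := abs_le.1 hy
      have h2 : φ y = y / T := by
        have : y / T ≤ 1 := by rw [div_le_one hT]; exact h1.2
        have : -1 ≤ y / T := by rw [le_div_iff₀ hT]; linarith
        simp only [φ]
        rw [min_eq_right (by assumption), max_eq_right (by assumption)]
      have h3 : T * φ y = y := by rw [h2]; field_simp
      simp [h3]
    · have hT' : |T * φ y| ≤ T := by
        rw [abs_mul, abs_of_pos hT]
        nlinarith [hφ1 y]
      have h4 := abs_le.1 hT'
      refine ⟨hT'.trans hy.le, ?_, Or.inr hy⟩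
      rcases le_total 0 y with h0 | h0
      · have : 0 ≤ T * φ y := mul_nonneg hT.le (hφ0 ▸ hφm h0)
        rw [abs_of_nonneg h0] at hy ⊢
        rw [abs_le]
        constructor <;> linarith
      · have : T * φ y ≤ 0 := mul_nonpos_of_nonneg_of_nonpos hT.le (hφ0 ▸ hφm h0)
        rw [abs_of_nonpos h0] at hy ⊢
        rw [abs_le]
        constructor <;> linarith
  have hc : ∀ g, PieceMono g → PieceMono fun x => φ (g x) := fun g hg => hg.comp hφm hφ0
  have hcL : ∀ g, PieceMono g → L3 μ fun x => φ (g x) := fun g hg =>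
    L3.of_bounded (hc g hg).measurable fun x => hφ1 _
  have hτL : ∀ g, PieceMono g → L3 μ fun x => T * φ (g x) := fun g hg => (hcL g hg).const_mul T
  have hmain : |Λ (fun x => T * φ (g₁ x)) (fun x => T * φ (g₂ x)) (fun x => T * φ (g₃ x))|
      ≤ 64 * b * T ^ 3 := by
    have e1 := (hΛ.lin₁ _ _ (hτL _ hg₂) (hτL _ hg₃)).const_mul T _ (hcL _ hg₁)
    have e2 := (hΛ.lin₂ _ _ (hcL _ hg₁) (hτL _ hg₃)).const_mul T _ (hcL _ hg₂)
    have e3 := (hΛ.lin₃ _ _ (hcL _ hg₁) (hcL _ hg₂)).const_mul T _ (hcL _ hg₃)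
    rw [e1, e2, e3, abs_mul, abs_mul, abs_mul, abs_of_pos hT]
    have := hΛ.abs_pieceMono_le hb (hc _ hg₁) (hc _ hg₂) (hc _ hg₃) (fun _ => hφ1 _)
      (fun _ => hφ1 _) (fun _ => hφ1 _)
    calc T * (T * (T * |Λ (fun x => φ (g₁ x)) (fun x => φ (g₂ x)) (fun x => φ (g₃ x))|))
        = T ^ 3 * |Λ (fun x => φ (g₁ x)) (fun x => φ (g₂ x)) (fun x => φ (g₃ x))| := by ring
      _ ≤ T ^ 3 * (64 * b) := by gcongr
      _ = _ := by ring
  have d1 := (hΛ.lin₁ _ _ hL₂ hL₃).sub hL₁ (hτL _ hg₁)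
  have d2 := (hΛ.lin₂ _ _ (hτL _ hg₁) hL₃).sub hL₂ (hτL _ hg₂)
  have d3 := (hΛ.lin₃ _ _ (hτL _ hg₁) (hτL _ hg₂)).sub hL₃ (hτL _ hg₃)
  have b1 := hΛ.abs_le_cubeExcess (hL₁.sub (hτL _ hg₁)) hL₂ hL₃ hL₁ hL₂ hL₃
    (fun _ => (hφa _).2.1) (fun _ => le_rfl) (fun _ => le_rfl) hT fun x y z => by
      rcases (hφa (g₁ x)).2.2 with h | h
      · simp [h]
      · exact Or.inl h
  have b2 := hΛ.abs_le_cubeExcess (hτL _ hg₁) (hL₂.sub (hτL _ hg₂)) hL₃ hL₁ hL₂ hL₃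
    (fun _ => (hφa _).1) (fun _ => (hφa _).2.1) (fun _ => le_rfl) hT fun x y z => by
      rcases (hφa (g₂ y)).2.2 with h | h
      · simp [h]
      · exact Or.inr (Or.inl h)
  have b3 := hΛ.abs_le_cubeExcess (hτL _ hg₁) (hτL _ hg₂) (hL₃.sub (hτL _ hg₃)) hL₁ hL₂ hL₃
    (fun _ => (hφa _).1) (fun _ => (hφa _).1) (fun _ => (hφa _).2.1) hT fun x y z => by
      rcases (hφa (g₃ z)).2.2 with h | h
      · simp [h]
      · exact Or.inr (Or.inr (Or.inl h))
  rw [d1] at b1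
  rw [d2] at b2
  rw [d3] at b3
  rw [abs_le] at *
  constructor <;> linarith [b1.1, b1.2, b2.1, b2.2, b3.1, b3.2, hmain.1, hmain.2]

end TriForm

lemma integral_Ioi_add_rpow_of_lt {a T : ℝ} (ha : a < -1) (hT : 0 < T) :
    ∫ t in Ioi (0:ℝ), (t + T) ^ a = - (T ^ (a + 1) / (a + 1)) := by
  have hd : ∀ x ∈ Ici (0:ℝ), HasDerivAt (fun t => (t + T) ^ (a + 1) / (a + 1)) ((x + T) ^ a) x := by
    intro x hx
    convert! (((hasDerivAt_id _).add_const _).rpow_const _).div_const _ using 1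
    · simp [show a + 1 ≠ 0 by linarith]
    left; linarith [mem_Ici.mp hx, id_eq x]
  have ht : Tendsto (fun t => ((t + T) ^ (a + 1)) / (a + 1)) atTop (nhds (0 / (a + 1))) := by
    rw [← neg_neg (a + 1)]
    exact (tendsto_rpow_neg_atTop (by linarith)).comp
      (tendsto_atTop_add_const_right _ T tendsto_id) |>.div_const _
  rw [integral_Ioi_of_hasDerivAt_of_tendsto' hd
    (integrableOn_add_rpow_Ioi_of_lt ha (by linarith)) ht]
  simp

namespace Mon

variable {M : ℝ} {p : ℝ≥0∞} {μ : Measure ℝ} {g : ℝ → ℝ}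

lemma pieceMono (hg : Mon M p μ g) : PieceMono g := hg.1

lemma lintegral_cubeExcess_le_of_ne_top (hM : 0 < M) (hp : 3 < p) (hp' : p ≠ ∞)
    (hg : Mon M p μ g) {T : ℝ} (hT : 0 < T) :
    ∫⁻ x, ENNReal.ofReal (cubeExcess T (g x)) ∂μ ≤
      ENNReal.ofReal (3 * M ^ p.toReal / (p.toReal - 3) * T ^ (3 - p.toReal)) := by
  set q := p.toReal
  have hq : 3 < q := by
    have := (ENNReal.toReal_lt_toReal (by simp) hp').2 hp
    simpa using this
  have hgm := hg.pieceMono.measurable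
  have h2 := hg.2
  rw [if_neg hp'] at h2
  have h1 := lintegral_rpow_eq_lintegral_meas_lt_mul μ (f := fun x => max (|g x| - T) 0)
    (ae_of_all _ fun x => le_max_right _ _) (by fun_prop) (p := 3) (by norm_num)
  have e1 : ∫⁻ x, ENNReal.ofReal (cubeExcess T (g x)) ∂μ
      = ∫⁻ x, ENNReal.ofReal ((max (|g x| - T) 0) ^ (3:ℝ)) ∂μ := by
    refine lintegral_congr fun x => ?_
    rw [cubeExcess, ← Real.rpow_natCast]
    norm_num
  rw [e1, h1]
  have h3 : ∫⁻ t in Ioi (0:ℝ), μ {x | t < max (|g x| - T) 0} * ENNReal.ofReal (t ^ ((3:ℝ) - 1))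
      ≤ ∫⁻ t in Ioi (0:ℝ), ENNReal.ofReal (M ^ q * (t + T) ^ (2 - q)) := by
    refine setLIntegral_mono' measurableSet_Ioi fun t ht => ?_
    have ht' : 0 < t := ht
    have hs : {x | t < max (|g x| - T) 0} ⊆ {x | t + T < |g x|} := fun x hx => by
      have hx' : t < max (|g x| - T) 0 := hx
      rcases lt_max_iff.1 hx' with h | h
      · exact (lt_sub_iff_add_lt.1 h)
      · exact absurd h (not_lt.2 ht'.le)
    calc μ {x | t < max (|g x| - T) 0} * ENNReal.ofReal (t ^ ((3:ℝ) - 1))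
        ≤ ENNReal.ofReal (M ^ q * (t + T) ^ (-q)) * ENNReal.ofReal ((t + T) ^ (2:ℝ)) := by
          gcongr
          · exact (measure_mono hs).trans (h2 _ (by positivity))
          · norm_num
            gcongr
            linarith
      _ = ENNReal.ofReal (M ^ q * (t + T) ^ (2 - q)) := by
          rw [← ENNReal.ofReal_mul (by positivity), mul_assoc, ← Real.rpow_add (by positivity)]
          congr 3
          ring
  refine (mul_le_mul_right h3 _).trans ?_
  rw [← ofReal_integral_eq_lintegral_ofReal
    ((integrableOn_add_rpow_Ioi_of_lt (by linarith) (by linarith)).const_mul _)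
    ((ae_restrict_iff' measurableSet_Ioi).2 (ae_of_all _ fun t ht => by
      have : 0 < t := ht
      positivity)), integral_const_mul, integral_Ioi_add_rpow_of_lt (by linarith) hT,
    ← ENNReal.ofReal_mul (by norm_num)]
  refine ENNReal.ofReal_le_ofReal (le_of_eq ?_)
  have e : 2 - q + 1 = 3 - q := by ring
  have n1 : 3 - q ≠ 0 := by linarith
  have n2 : q - 3 ≠ 0 := by linarith
  rw [e]
  field_simp
  ring

lemma lintegral_cubeExcess_le_of_top [IsProbabilityMeasure μ] (hg : Mon M ∞ μ g)
    {T : ℝ} (hT : 0 < T) :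
    ∫⁻ x, ENNReal.ofReal (cubeExcess T (g x)) ∂μ ≤
      ENNReal.ofReal (if M ≤ T then 0 else M ^ 3) := by
  have h2 := hg.2
  rw [if_pos rfl] at h2
  have h3 : ∀ᵐ x ∂μ, |g x| ≤ M := by
    rw [ae_iff]
    simpa using h2
  have h4 : ∀ᵐ x ∂μ, ENNReal.ofReal (cubeExcess T (g x))
      ≤ ENNReal.ofReal (if M ≤ T then 0 else M ^ 3) := by
    filter_upwards [h3] with x hx
    refine ENNReal.ofReal_le_ofReal ?_
    split_ifs with h
    · rw [cubeExcess, max_eq_right (by linarith)]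
      norm_num
    · exact (cubeExcess_le hT.le _).trans (pow_le_pow_left₀ (abs_nonneg _) hx 3)
  exact (lintegral_mono_ae h4).trans_eq (by simp)

/-- A uniform tail bound for the third moments in the class `Mon M p μ`, together with the
truncation level balancing it against a mixing rate. -/
lemma exists_cubeExcess_bound [IsProbabilityMeasure μ] (hM : 0 < M) (hp : 3 < p) :
    ∃ κ : ℝ → ℝ, (∀ T, 0 < T → 0 ≤ κ T) ∧ Tendsto κ atTop (𝓝 0) ∧
      (∀ g, Mon M p μ g → ∀ T, 0 < T →
        ∫⁻ x, ENNReal.ofReal (cubeExcess T (g x)) ∂μ ≤ ENNReal.ofReal (κ T)) ∧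
      ∀ r : ℝ, 0 < r → ∃ C : ℝ, 0 ≤ C ∧ ∀ k : ℕ, 1 ≤ k → ∃ T : ℝ, 0 < T ∧
        (k : ℝ) ^ (-(r * (((1:ℝ≥0∞) - 3 / p)⁻¹).toReal)) * T ^ 3 ≤ C * (k : ℝ) ^ (-r) ∧
        κ (T / 2) ≤ C * (k : ℝ) ^ (-r) := by
  rcases eq_or_ne p ∞ with rfl | hp'
  · refine ⟨fun T => if M ≤ T then 0 else M ^ 3, fun T hT => ?_, ?_,
      fun g hg T hT => hg.lintegral_cubeExcess_le_of_top hT, fun r hr =>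
      ⟨(2 * M) ^ 3, by positivity, fun k hk => ⟨2 * M, by positivity, ?_, ?_⟩⟩⟩
    · dsimp only
      split_ifs <;> positivity
    · refine tendsto_const_nhds.congr' ?_
      filter_upwards [eventually_ge_atTop M] with T hT
      rw [if_pos hT]
    · simp only [ENNReal.div_top, tsub_zero, inv_one, ENNReal.toReal_one, mul_one]
      exact le_of_eq (mul_comm _ _)
    · beta_reduce
      rw [if_pos (by linarith)]
      positivity
  · set q := p.toReal with hq_def
    have hq : 3 < q := by
      have := (ENNReal.toReal_lt_toReal (by simp) hp').2 hp
      simpa using this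
    have hq3 : 0 < q - 3 := by linarith
    have he : (((1:ℝ≥0∞) - 3 / p)⁻¹).toReal = q / (q - 3) := by
      have h3p : 3 / p ≤ 1 := ENNReal.div_le_of_le_mul (by simpa using hp.le)
      rw [ENNReal.toReal_inv, ENNReal.toReal_sub_of_le h3p (by simp), ENNReal.toReal_div]
      simp only [ENNReal.toReal_one, ENNReal.toReal_ofNat]
      rw [← hq_def]
      have : q ≠ 0 := by linarith
      field_simp
    set A := 3 * M ^ q / (q - 3)
    have hA : 0 ≤ A := by positivity
    refine ⟨fun T => A * T ^ (3 - q), fun T hT => by positivity, ?_,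
      fun g hg T hT => hg.lintegral_cubeExcess_le_of_ne_top hM hp hp' hT, fun r hr =>
      ⟨1 + A * (1 / 2) ^ (3 - q), by positivity, fun k hk =>
        ⟨(k : ℝ) ^ (r / (q - 3)), ?_, ?_, ?_⟩⟩⟩
    · have := (tendsto_rpow_neg_atTop hq3).const_mul A
      rw [mul_zero] at this
      simpa only [neg_sub] using this
    · have : (0:ℝ) < k := by exact_mod_cast hk
      positivity
    · have hk' : (0:ℝ) < k := by exact_mod_cast hk
      rw [he, ← Real.rpow_natCast, ← Real.rpow_mul hk'.le, ← Real.rpow_add hk']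
      have : -(r * (q / (q - 3))) + r / (q - 3) * ((3 : ℕ) : ℝ) = -r := by
        push_cast
        field_simp
        ring
      rw [this]
      have h0 : 0 ≤ (k:ℝ) ^ (-r) := by positivity
      have h1 : 0 ≤ A * (1 / 2) ^ (3 - q) := by positivity
      nlinarith
    · have hk' : (0:ℝ) < k := by exact_mod_cast hk
      have e : ((k:ℝ) ^ (r / (q - 3)) / 2) ^ (3 - q) = (1 / 2) ^ (3 - q) * (k:ℝ) ^ (-r) := by
        rw [div_eq_mul_one_div, Real.mul_rpow (by positivity) (by norm_num), ← Real.rpow_mul hk'.le,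
          mul_comm]
        congr 2
        field_simp
        ring
      beta_reduce
      rw [e]
      have h0 : 0 ≤ (k:ℝ) ^ (-r) := by positivity
      nlinarith

end Mon

lemma L3.of_lintegral_cubeExcess_le {μ : Measure ℝ} {g κ : ℝ → ℝ} [IsFiniteMeasure μ] (hgm : Measurable g)
    (hκ : ∀ T, 0 < T →
      ∫⁻ x, ENNReal.ofReal (cubeExcess T (g x)) ∂μ ≤ ENNReal.ofReal (κ T)) : L3 μ g := by
  have hi : Integrable (fun x => cubeExcess (1 / 2) (g x)) μ := by
    refine ⟨((measurable_cubeExcess _).comp hgm).aestronglyMeasurable, ?_⟩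
    rw [hasFiniteIntegral_iff_ofReal (ae_of_all _ fun x => cubeExcess_nonneg _ _)]
    exact (hκ _ (by norm_num)).trans_lt ENNReal.ofReal_lt_top
  refine ⟨hgm, ((integrable_const 1).add (hi.const_mul 8)).mono'
    (hgm.abs.pow_const 3).aestronglyMeasurable (ae_of_all _ fun x => ?_)⟩
  rw [Real.norm_eq_abs, abs_of_nonneg (by positivity)]
  have h0 := cubeExcess_nonneg (1 / 2) (g x)
  rcases le_or_gt |g x| 1 with h | h
  · have : |g x| ^ 3 ≤ 1 := pow_le_one₀ (abs_nonneg _) h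
    simp only [Pi.add_apply]
    linarith
  · have := abs_pow_three_le_cubeExcess h
    simp only [Pi.add_apply]
    linarith

lemma pow_three_sum_le {ι : Type*} (s : Finset ι) {w y : ι → ℝ} (hw : ∀ i, 0 ≤ w i)
    (hw1 : ∑ i ∈ s, w i ≤ 1) (hy : ∀ i, 0 ≤ y i) :
    (∑ i ∈ s, w i * y i) ^ 3 ≤ ∑ i ∈ s, w i * y i ^ 3 := by
  set m := ∑ i ∈ s, w i * y i with hm
  have hm0 : 0 ≤ m := Finset.sum_nonneg fun i _ => mul_nonneg (hw i) (hy i)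
  have h1 : ∑ i ∈ s, w i * (3 * m ^ 2 * y i - 2 * m ^ 3) ≤ ∑ i ∈ s, w i * y i ^ 3 := by
    refine Finset.sum_le_sum fun i _ => mul_le_mul_of_nonneg_left ?_ (hw i)
    nlinarith [mul_nonneg (add_nonneg (hy i) hm0) (sq_nonneg (y i - m)),
      mul_nonneg hm0 (sq_nonneg (y i - m))]
  have h2 : ∑ i ∈ s, w i * (3 * m ^ 2 * y i - 2 * m ^ 3)
      = 3 * m ^ 2 * m - 2 * m ^ 3 * ∑ i ∈ s, w i := by
    rw [hm, Finset.mul_sum, Finset.mul_sum, ← Finset.sum_sub_distrib]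
    exact Finset.sum_congr rfl fun i _ => by ring
  have h3 : 2 * m ^ 3 * ∑ i ∈ s, w i ≤ 2 * m ^ 3 * 1 := by gcongr
  nlinarith

lemma cubeExcess_sum_le {ι : Type*} (s : Finset ι) {a y : ι → ℝ} (ha : ∑ i ∈ s, |a i| ≤ 1)
    {T : ℝ} (hT : 0 ≤ T) :
    cubeExcess T (∑ i ∈ s, a i * y i) ≤ ∑ i ∈ s, |a i| * cubeExcess T (y i) := by
  refine le_trans ?_ (pow_three_sum_le s (fun i => abs_nonneg (a i)) ha
    (y := fun i => max (|y i| - T) 0) fun i => le_max_right _ _)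
  have hn : 0 ≤ ∑ i ∈ s, |a i| * max (|y i| - T) 0 :=
    Finset.sum_nonneg fun i _ => mul_nonneg (abs_nonneg _) (le_max_right _ _)
  refine pow_le_pow_left₀ (le_max_right _ _) (max_le ?_ hn) 3
  have h1 : |∑ i ∈ s, a i * y i| ≤ ∑ i ∈ s, (|a i| * max (|y i| - T) 0 + |a i| * T) := by
    refine (Finset.abs_sum_le_sum_abs _ _).trans (Finset.sum_le_sum fun i _ => ?_)
    rw [abs_mul, ← mul_add]
    gcongr
    linarith [le_max_left (|y i| - T) 0]
  rw [Finset.sum_add_distrib, ← Finset.sum_mul] at h1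
  nlinarith

lemma abs_sub_pow_three_le_cubeExcess (T x y : ℝ) :
    |x - y| ^ 3 ≤ 16 * T ^ 2 * |x - y| + 64 * (cubeExcess T x + cubeExcess T y) := by
  have n1 := cubeExcess_nonneg T x
  have n2 := cubeExcess_nonneg T y
  have n3 := abs_nonneg (x - y)
  rcases le_or_gt |x - y| (4 * T) with h | h
  · have : |x - y| ^ 2 ≤ (4 * T) ^ 2 := pow_le_pow_left₀ n3 h 2
    nlinarith
  · set a := max (|x| - T) 0
    set b := max (|y| - T) 0
    have h1 : |x - y| ≤ 2 * (a + b) := by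
      have e1 : |x| - T ≤ a := le_max_left _ _
      have e2 : |y| - T ≤ b := le_max_left _ _
      have := abs_sub x y
      linarith
    have ha : 0 ≤ a := le_max_right _ _
    have hb : 0 ≤ b := le_max_right _ _
    have h2 : |x - y| ^ 3 ≤ (2 * (a + b)) ^ 3 := pow_le_pow_left₀ n3 h1 3
    have h3 := abs_add_pow_three_le a b
    rw [abs_of_nonneg ha, abs_of_nonneg hb, abs_of_nonneg (add_nonneg ha hb)] at h3
    have : 0 ≤ 16 * T ^ 2 * |x - y| := by positivity
    simp only [cubeExcess]
    nlinarith [pow_nonneg ha 3, pow_nonneg hb 3]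

section Hull

lemma integral_le_of_lintegral_ofReal_le {μ : Measure ℝ} {h : ℝ → ℝ} (hm : Measurable h) (h0 : ∀ x, 0 ≤ h x)
    {b : ℝ} (hb : 0 ≤ b) (hle : ∫⁻ x, ENNReal.ofReal (h x) ∂μ ≤ ENNReal.ofReal b) :
    ∫ x, h x ∂μ ≤ b := by
  rw [integral_eq_lintegral_of_nonneg_ae (ae_of_all _ h0) hm.aestronglyMeasurable]
  exact ENNReal.toReal_le_of_le_ofReal hb hle

lemma TriForm.exists_abs_le {μ : Measure ℝ} {Λ : (ℝ → ℝ) → (ℝ → ℝ) → (ℝ → ℝ) → ℝ} (hΛ : TriForm μ Λ)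
    {k l : ℝ → ℝ} (hk : L3 μ k) (hl : L3 μ l) {ε : ℝ} (hε : 0 < ε) :
    ∃ η > 0, ∀ h, L3 μ h → ∫ x, |h x| ^ 3 ∂μ ≤ η → |Λ h k l| ≤ ε := by
  set B := ∫ x, |k x| ^ 3 ∂μ
  set C := ∫ x, |l x| ^ 3 ∂μ
  have hB : 0 ≤ B := integral_nonneg fun x => by positivity
  have hC : 0 ≤ C := integral_nonneg fun x => by positivity
  set s := min 1 (ε / (4 * (B + C + 1)))
  have hs : 0 < s := lt_min one_pos (by positivity)
  have hs1 : s ≤ 1 := min_le_left _ _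
  have hs2 : s * (4 * (B + C + 1)) ≤ ε := by
    rw [← le_div_iff₀ (by positivity)]
    exact min_le_right _ _
  refine ⟨s ^ 6 * ε / 4, by positivity, fun h hh hη => ?_⟩
  have hb := hΛ.bound h k l hh hk hl (fun x => (s ^ 6)⁻¹ * |h x| ^ 3) (fun x => s ^ 3 * |k x| ^ 3)
    (fun x => s ^ 3 * |l x| ^ 3) ((hh.1.abs.pow_const 3).const_mul _)
    ((hk.1.abs.pow_const 3).const_mul _) ((hl.1.abs.pow_const 3).const_mul _)
    (hh.2.const_mul _) (hk.2.const_mul _) (hl.2.const_mul _) fun x y z => by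
      have := WeakDep.mul_mul_le_cubes (x := (s ^ 2)⁻¹ * |h x|) (y := s * |k y|) (z := s * |l z|)
        (by positivity) (by positivity) (by positivity)
      have e1 : (s ^ 2)⁻¹ * |h x| * (s * |k y|) * (s * |l z|) = |h x * k y * l z| := by
        rw [abs_mul, abs_mul]
        field_simp
      have e2 : ((s ^ 2)⁻¹ * |h x|) ^ 3 = (s ^ 6)⁻¹ * |h x| ^ 3 := by
        rw [mul_pow, inv_pow, ← pow_mul]
      rwa [e1, e2, mul_pow, mul_pow] at this
  simp only [integral_const_mul] at hb
  have h1 : (s ^ 6)⁻¹ * ∫ x, |h x| ^ 3 ∂μ ≤ (s ^ 6)⁻¹ * (s ^ 6 * ε / 4) := by gcongr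
  have h2 : (s ^ 6)⁻¹ * (s ^ 6 * ε / 4) = ε / 4 := by field_simp
  have h3 : s ^ 3 * (B + C) ≤ s * (B + C) := by
    gcongr
    calc s ^ 3 ≤ s ^ 1 := pow_le_pow_of_le_one hs.le hs1 (by norm_num)
      _ = s := pow_one s
  nlinarith

variable {μ : Measure ℝ} [IsProbabilityMeasure μ] {M : ℝ} {p : ℝ≥0∞} {κ : ℝ → ℝ}

lemma integral_cubeExcess_comb_le (hκ0 : ∀ T, 0 < T → 0 ≤ κ T)
    (hκ : ∀ g, Mon M p μ g → ∀ T, 0 < T →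
      ∫⁻ x, ENNReal.ofReal (cubeExcess T (g x)) ∂μ ≤ ENNReal.ofReal (κ T))
    {n : ℕ} {a : Fin n → ℝ} {g : Fin n → ℝ → ℝ} (ha : ∑ i, |a i| ≤ 1)
    (hg : ∀ i, Mon M p μ (g i)) {T : ℝ} (hT : 0 < T) :
    ∫ x, cubeExcess T (∑ i, a i * g i x) ∂μ ≤ κ T := by
  have hL : ∀ i, L3 μ (g i) := fun i =>
    L3.of_lintegral_cubeExcess_le (hg i).pieceMono.measurable (hκ _ (hg i))
  have hs : L3 μ fun x => ∑ i, a i * g i x := L3.sum _ fun i => (hL i).const_mul (a i)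
  have hi := fun i => (hL i).integrable_cubeExcess hT.le
  calc ∫ x, cubeExcess T (∑ i, a i * g i x) ∂μ
      ≤ ∫ x, ∑ i, |a i| * cubeExcess T (g i x) ∂μ :=
        integral_mono (hs.integrable_cubeExcess hT.le)
          (integrable_finsetSum _ fun i _ => (hi i).const_mul _)
          fun x => cubeExcess_sum_le _ ha hT.le
    _ = ∑ i, |a i| * ∫ x, cubeExcess T (g i x) ∂μ := by
        rw [integral_finsetSum _ fun i _ => (hi i).const_mul _]
        simp only [integral_const_mul]
    _ ≤ ∑ i, |a i| * κ T := by
        gcongr with i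
        exact integral_le_of_lintegral_ofReal_le
          ((measurable_cubeExcess T).comp (hL i).1) (fun x => cubeExcess_nonneg _ _)
          (hκ0 T hT) (hκ _ (hg i) T hT)
    _ ≤ κ T := by
        rw [← Finset.sum_mul]
        exact mul_le_of_le_one_left (hκ0 T hT) ha

lemma ClassC.lintegral_cubeExcess_le (hκ0 : ∀ T, 0 < T → 0 ≤ κ T)
    (hκ : ∀ g, Mon M p μ g → ∀ T, 0 < T →
      ∫⁻ x, ENNReal.ofReal (cubeExcess T (g x)) ∂μ ≤ ENNReal.ofReal (κ T))
    {F : ℝ → ℝ} (hF : ClassC M p μ F) {T : ℝ} (hT : 0 < T) :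
    ∫⁻ x, ENNReal.ofReal (cubeExcess T (F x)) ∂μ ≤ ENNReal.ofReal (κ T) := by
  have hch : ∀ j : ℕ, ∃ G : ℝ → ℝ, L3 μ G ∧ ∫ x, |F x - G x| ∂μ < 1 / ((j : ℝ) + 1) ∧
      ∫ x, cubeExcess T (G x) ∂μ ≤ κ T := fun j => by
    obtain ⟨n, a, g, ha, hg, h⟩ := hF.2 (1 / ((j : ℝ) + 1)) (by positivity)
    exact ⟨_, L3.sum _ fun i => (L3.of_lintegral_cubeExcess_le (hg i).pieceMono.measurable
      (hκ _ (hg i))).const_mul (a i), h, integral_cubeExcess_comb_le hκ0 hκ ha hg hT⟩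
  choose G hG hFG hGκ using hch
  have hmeas : TendstoInMeasure μ G atTop F := by
    refine tendstoInMeasure_of_tendsto_eLpNorm one_ne_zero
      (fun j => (hG j).1.aestronglyMeasurable) hF.1.aestronglyMeasurable ?_
    have h1 : ∀ j, eLpNorm (G j - F) 1 μ ≤ ENNReal.ofReal (1 / ((j : ℝ) + 1)) := fun j => by
      have hi : Integrable (G j - F) μ := (hG j).integrable.sub hF.1
      rw [eLpNorm_one_eq_lintegral_enorm, ← ofReal_integral_norm_eq_lintegral_enorm hi]
      refine ENNReal.ofReal_le_ofReal ((le_of_eq ?_).trans (hFG j).le)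
      refine integral_congr_ae (ae_of_all _ fun x => ?_)
      simp only [Pi.sub_apply, Real.norm_eq_abs, abs_sub_comm]
    have h2 : Tendsto (fun j : ℕ => ENNReal.ofReal (1 / ((j : ℝ) + 1))) atTop (𝓝 0) := by
      have := (ENNReal.continuous_ofReal.tendsto 0).comp tendsto_one_div_add_atTop_nhds_zero_nat
      rwa [ENNReal.ofReal_zero] at this
    exact tendsto_of_tendsto_of_tendsto_of_le_of_le tendsto_const_nhds h2 (fun _ => bot_le) h1
  obtain ⟨ns, -, hns⟩ := hmeas.exists_seq_tendsto_ae
  have hm : ∀ j, Measurable fun x => ENNReal.ofReal (cubeExcess T (G (ns j) x)) := fun j =>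
    ((measurable_cubeExcess T).comp (hG _).1).ennreal_ofReal
  calc ∫⁻ x, ENNReal.ofReal (cubeExcess T (F x)) ∂μ
      = ∫⁻ x, liminf (fun j => ENNReal.ofReal (cubeExcess T (G (ns j) x))) atTop ∂μ := by
        refine lintegral_congr_ae ?_
        filter_upwards [hns] with x hx
        refine (Tendsto.liminf_eq ?_).symm
        exact ((ENNReal.continuous_ofReal.comp (continuous_cubeExcess T)).tendsto _).comp hx
    _ ≤ liminf (fun j => ∫⁻ x, ENNReal.ofReal (cubeExcess T (G (ns j) x)) ∂μ) atTop :=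
        lintegral_liminf_le hm
    _ ≤ ENNReal.ofReal (κ T) := by
        refine (liminf_le_liminf (v := fun _ => ENNReal.ofReal (κ T))
          (Eventually.of_forall fun j => ?_)).trans_eq (liminf_const _)
        rw [← ofReal_integral_eq_lintegral_ofReal ((hG _).integrable_cubeExcess hT.le)
          (ae_of_all _ fun x => cubeExcess_nonneg _ _)]
        exact ENNReal.ofReal_le_ofReal (hGκ _)

lemma ClassC.l3 (hκ0 : ∀ T, 0 < T → 0 ≤ κ T)
    (hκ : ∀ g, Mon M p μ g → ∀ T, 0 < T →
      ∫⁻ x, ENNReal.ofReal (cubeExcess T (g x)) ∂μ ≤ ENNReal.ofReal (κ T))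
    {F : ℝ → ℝ} (hFm : Measurable F) (hF : ClassC M p μ F) : L3 μ F :=
  L3.of_lintegral_cubeExcess_le hFm fun _ hT => hF.lintegral_cubeExcess_le hκ0 hκ hT

lemma ClassC.exists_comb_near (hκ0 : ∀ T, 0 < T → 0 ≤ κ T) (hκt : Tendsto κ atTop (𝓝 0))
    (hκ : ∀ g, Mon M p μ g → ∀ T, 0 < T →
      ∫⁻ x, ENNReal.ofReal (cubeExcess T (g x)) ∂μ ≤ ENNReal.ofReal (κ T))
    {F : ℝ → ℝ} (hFm : Measurable F) (hF : ClassC M p μ F) {ε : ℝ} (hε : 0 < ε) :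
    ∃ (n : ℕ) (a : Fin n → ℝ) (g : Fin n → ℝ → ℝ), ∑ i, |a i| ≤ 1 ∧ (∀ i, Mon M p μ (g i)) ∧
      ∫ x, |F x - ∑ i, a i * g i x| ^ 3 ∂μ ≤ ε := by
  have hFL := hF.l3 hκ0 hκ hFm
  obtain ⟨T, hT, hκT⟩ : ∃ T, 0 < T ∧ 128 * κ T ≤ ε / 2 := by
    have h1 := hκt.eventually (gt_mem_nhds (show (0:ℝ) < ε / 256 by positivity))
    obtain ⟨T, h, h'⟩ := (h1.and (eventually_gt_atTop 0)).exists
    exact ⟨T, h', by linarith⟩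
  obtain ⟨n, a, g, ha, hg, h⟩ := hF.2 (ε / (32 * T ^ 2)) (by positivity)
  refine ⟨n, a, g, ha, hg, ?_⟩
  have hL : L3 μ fun x => ∑ i, a i * g i x := L3.sum _ fun i =>
    (L3.of_lintegral_cubeExcess_le (hg i).pieceMono.measurable (hκ _ (hg i))).const_mul (a i)
  have i1 := hFL.integrable_cubeExcess hT.le
  have i2 := hL.integrable_cubeExcess hT.le
  have i3 := (hFL.sub hL).integrable.abs
  have i12 : Integrable (fun x => cubeExcess T (F x) + cubeExcess T (∑ i, a i * g i x)) μ :=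
    i1.add i2
  have h1 : ∫ x, |F x - ∑ i, a i * g i x| ^ 3 ∂μ ≤
      ∫ x, (16 * T ^ 2 * |F x - ∑ i, a i * g i x|
        + 64 * (cubeExcess T (F x) + cubeExcess T (∑ i, a i * g i x))) ∂μ :=
    integral_mono (hFL.sub hL).2 ((i3.const_mul (16 * T ^ 2)).add (i12.const_mul 64))
      fun x => abs_sub_pow_three_le_cubeExcess _ _ _
  rw [integral_add (i3.const_mul _) (i12.const_mul _), integral_const_mul,
    integral_const_mul, integral_add i1 i2] at h1
  have h2 : ∫ x, cubeExcess T (F x) ∂μ ≤ κ T :=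
    integral_le_of_lintegral_ofReal_le ((measurable_cubeExcess T).comp hFm)
      (fun x => cubeExcess_nonneg _ _) (hκ0 T hT) (hF.lintegral_cubeExcess_le hκ0 hκ hT)
  have h3 := integral_cubeExcess_comb_le hκ0 hκ ha hg hT
  have h4 : 16 * T ^ 2 * ∫ x, |F x - ∑ i, a i * g i x| ∂μ ≤ 16 * T ^ 2 * (ε / (32 * T ^ 2)) := by
    gcongr
  have h5 : 16 * T ^ 2 * (ε / (32 * T ^ 2)) = ε / 2 := by field_simp; norm_num
  linarith

lemma TriForm.abs_classC_slot_le {Λ : (ℝ → ℝ) → (ℝ → ℝ) → (ℝ → ℝ) → ℝ} (hΛ : TriForm μ Λ)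
    (hκ0 : ∀ T, 0 < T → 0 ≤ κ T) (hκt : Tendsto κ atTop (𝓝 0))
    (hκ : ∀ g, Mon M p μ g → ∀ T, 0 < T →
      ∫⁻ x, ENNReal.ofReal (cubeExcess T (g x)) ∂μ ≤ ENNReal.ofReal (κ T))
    {k l : ℝ → ℝ} (hk : L3 μ k) (hl : L3 μ l) {b : ℝ} (hb0 : 0 ≤ b)
    (hb : ∀ g, Mon M p μ g → |Λ g k l| ≤ b)
    {F : ℝ → ℝ} (hFm : Measurable F) (hF : ClassC M p μ F) : |Λ F k l| ≤ b := by
  refine le_of_forall_pos_le_add fun ε hε => ?_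
  obtain ⟨η, hη, hη'⟩ := hΛ.exists_abs_le hk hl hε
  obtain ⟨n, a, g, ha, hg, h⟩ := hF.exists_comb_near hκ0 hκt hκ hFm hη
  have hgL : ∀ i, L3 μ (g i) := fun i =>
    L3.of_lintegral_cubeExcess_le (hg i).pieceMono.measurable (hκ _ (hg i))
  have hL : L3 μ fun x => ∑ i, a i * g i x := L3.sum _ fun i => (hgL i).const_mul (a i)
  have hFL := hF.l3 hκ0 hκ hFm
  have hlin := hΛ.lin₁ k l hk hl
  have h1 := hlin.sub hFL hL
  have h2 : Λ (fun x => ∑ i, a i * g i x) k l = ∑ i, a i * Λ (g i) k l := by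
    rw [hlin.sum Finset.univ (g := fun i x => a i * g i x) fun i => (hgL i).const_mul (a i)]
    exact Finset.sum_congr rfl fun i _ => hlin.const_mul _ _ (hgL i)
  have h3 : |Λ (fun x => ∑ i, a i * g i x) k l| ≤ b := by
    rw [h2]
    refine (Finset.abs_sum_le_sum_abs _ _).trans ?_
    calc ∑ i, |a i * Λ (g i) k l| ≤ ∑ i, |a i| * b := by
          refine Finset.sum_le_sum fun i _ => ?_
          rw [abs_mul]
          gcongr
          exact hb _ (hg i)
      _ ≤ b := by
          rw [← Finset.sum_mul]
          exact mul_le_of_le_one_left hb0 ha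
  have h4 := hη' _ (hFL.sub hL) h
  rw [h1] at h4
  have := abs_le.1 h4
  have := abs_le.1 h3
  rw [abs_le]
  constructor <;> linarith

/-- Trilinear forms which are small on indicators of half-lines are small on `ClassC`. -/
lemma exists_triForm_bound (μ : Measure ℝ) [IsProbabilityMeasure μ] (hM : 0 < M) (hp : 3 < p)
    {r : ℝ} (hr : 0 < r) (B : ℝ) :
    (∀ F, Measurable F → ClassC M p μ F → L3 μ F) ∧
    ∃ C : ℝ, 0 ≤ C ∧ ∀ Λ : (ℝ → ℝ) → (ℝ → ℝ) → (ℝ → ℝ) → ℝ, TriForm μ Λ → ∀ k : ℕ, 1 ≤ k →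
      (∀ s t u, |Λ (indic s) (indic t) (indic u)|
        ≤ B * (k : ℝ) ^ (-(r * (((1:ℝ≥0∞) - 3 / p)⁻¹).toReal))) →
      ∀ F₁ F₂ F₃, Measurable F₁ → Measurable F₂ → Measurable F₃ → ClassC M p μ F₁ →
        ClassC M p μ F₂ → ClassC M p μ F₃ → |Λ F₁ F₂ F₃| ≤ C * (k : ℝ) ^ (-r) := by
  obtain ⟨κ, hκ0, hκt, hκ, hrate⟩ := Mon.exists_cubeExcess_bound (μ := μ) hM hp
  refine ⟨fun F hFm hF => hF.l3 hκ0 hκ hFm, ?_⟩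
  obtain ⟨C, hC, hCT⟩ := hrate r hr
  refine ⟨64 * |B| * C + 144 * C, by positivity, fun Λ hΛ k hk hb F₁ F₂ F₃ m₁ m₂ m₃ c₁ c₂ c₃ => ?_⟩
  obtain ⟨T, hT, hT1, hT2⟩ := hCT k hk
  set e := (k : ℝ) ^ (-(r * (((1:ℝ≥0∞) - 3 / p)⁻¹).toReal))
  have he : 0 ≤ e := by positivity
  have hL : ∀ g, Mon M p μ g → L3 μ g := fun g hg =>
    L3.of_lintegral_cubeExcess_le hg.pieceMono.measurable (hκ _ hg)
  set D := (64 * |B| * C + 144 * C) * (k : ℝ) ^ (-r)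
  have hD : 0 ≤ D := by positivity
  have hex : ∀ g, Mon M p μ g → ∫ x, cubeExcess (T / 2) (g x) ∂μ ≤ C * (k : ℝ) ^ (-r) :=
    fun g hg => (integral_le_of_lintegral_ofReal_le
      ((measurable_cubeExcess _).comp (hL g hg).1) (fun x => cubeExcess_nonneg _ _)
      (hκ0 _ (half_pos hT)) (hκ _ hg _ (half_pos hT))).trans hT2
  have h0 : ∀ g₁ g₂ g₃, Mon M p μ g₁ → Mon M p μ g₂ → Mon M p μ g₃ → |Λ g₁ g₂ g₃| ≤ D := by
    intro g₁ g₂ g₃ q₁ q₂ q₃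
    have h1 := hΛ.abs_pieceMono_le_cubeExcess hb q₁.pieceMono q₂.pieceMono q₃.pieceMono
      (hL _ q₁) (hL _ q₂) (hL _ q₃) hT
    have h2 : 64 * (B * e) * T ^ 3 ≤ 64 * |B| * (C * (k : ℝ) ^ (-r)) := by
      calc 64 * (B * e) * T ^ 3 ≤ 64 * (|B| * e) * T ^ 3 := by
            gcongr
            exact le_abs_self B
        _ = 64 * |B| * (e * T ^ 3) := by ring
        _ ≤ _ := by gcongr
    have h3 := hex _ q₁
    have h4 := hex _ q₂
    have h5 := hex _ q₃
    have e : D = 64 * |B| * (C * (k : ℝ) ^ (-r)) + 48 * (3 * (C * (k : ℝ) ^ (-r))) := by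
      simp only [D]
      ring
    linarith
  have l₁ := c₁.l3 hκ0 hκ m₁
  have l₂ := c₂.l3 hκ0 hκ m₂
  have s₁ : ∀ g₂ g₃, Mon M p μ g₂ → Mon M p μ g₃ → |Λ F₁ g₂ g₃| ≤ D := fun g₂ g₃ q₂ q₃ =>
    hΛ.abs_classC_slot_le hκ0 hκt hκ (hL _ q₂) (hL _ q₃) hD (fun g q => h0 g g₂ g₃ q q₂ q₃) m₁ c₁
  have s₂ : ∀ g₃, Mon M p μ g₃ → |Λ F₁ F₂ g₃| ≤ D := fun g₃ q₃ =>
    hΛ.rot.abs_classC_slot_le hκ0 hκt hκ (hL _ q₃) l₁ hD (fun g q => s₁ g g₃ q q₃) m₂ c₂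
  exact hΛ.rot.rot.abs_classC_slot_le hκ0 hκt hκ l₁ l₂ hD s₂ m₃ c₃

end Hull

section ClassMembership

variable {μ : Measure ℝ} {M M' L : ℝ} {p : ℝ≥0∞} {f g : ℝ → ℝ}

lemma Mon.mono (hM : 0 < M) (hMM' : M ≤ M') (hg : Mon M p μ g) : Mon M' p μ g := by
  refine ⟨hg.1, ?_⟩
  have h := hg.2
  split_ifs at h ⊢ with hp
  · exact measure_mono_null (fun x hx => lt_of_le_of_lt hMM' hx) h
  · intro t ht
    refine (h t ht).trans (ENNReal.ofReal_le_ofReal ?_)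
    gcongr

lemma Mon.const_mul (hM : 0 < M) (hL : 0 < L) (hg : Mon M p μ g) :
    Mon (L * M) p μ fun x => L * g x := by
  refine ⟨PieceMono.comp hg.1 (φ := fun y => L * y) (fun x y h => by
    dsimp only; gcongr) (by simp), ?_⟩
  have h := hg.2
  have e : ∀ t x, t < |L * g x| ↔ t / L < |g x| := fun t x => by
    rw [abs_mul, abs_of_pos hL, div_lt_iff₀' hL]
  simp only [e]
  split_ifs at h ⊢ with hp
  · rwa [mul_div_cancel_left₀ _ hL.ne']
  · intro t ht
    refine (h (t / L) (by positivity)).trans_eq ?_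
    congr 1
    rw [Real.mul_rpow hL.le hM.le, Real.div_rpow ht.le hL.le, Real.rpow_neg hL.le]
    field_simp

lemma Mon.const [IsProbabilityMeasure μ] (hL : 0 < L) : Mon L p μ fun _ => L := by
  refine ⟨⟨univ, isOpen_univ, ordConnected_univ, Or.inl monotoneOn_const, by simp⟩, ?_⟩
  simp only [abs_of_pos hL]
  split_ifs with hp
  · simp
  · intro t ht
    rcases lt_or_ge t L with h | h
    · have h1 : (1:ℝ) ≤ L ^ p.toReal * t ^ (-p.toReal) := by
        rw [Real.rpow_neg ht.le, ← div_eq_mul_inv, ← Real.div_rpow hL.le ht.le]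
        exact Real.one_le_rpow (by rw [le_div_iff₀ ht]; linarith) ENNReal.toReal_nonneg
      exact prob_le_one.trans (by simpa using ENNReal.ofReal_le_ofReal h1)
    · simp [not_lt.2 h]

lemma ClassC.congr {f' : ℝ → ℝ} (hf : ClassC M p μ f) (h : f =ᵐ[μ] f') : ClassC M p μ f' := by
  refine ⟨hf.1.congr h, fun ε hε => ?_⟩
  obtain ⟨n, a, g, ha, hg, hlt⟩ := hf.2 ε hε
  refine ⟨n, a, g, ha, hg, lt_of_eq_of_lt (integral_congr_ae ?_) hlt⟩
  filter_upwards [h] with x hx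
  rw [hx]

lemma ClassC.one [IsProbabilityMeasure μ] (hM : 1 ≤ M) : ClassC M p μ fun _ => 1 :=
  ⟨integrable_const _, fun ε hε => ⟨1, fun _ => 1, fun _ _ => 1, by simp,
    fun _ => (Mon.const one_pos).mono one_pos hM, by simpa using hε⟩⟩

lemma ClassC.sub_const [IsProbabilityMeasure μ] (hM : 0 < M) (hf : ClassC M p μ f) (m : ℝ) :
    ClassC ((1 + |m|) * max M 1) p μ fun x => f x - m := by
  have hL : 0 < 1 + |m| := by positivity
  refine ⟨hf.1.sub (integrable_const _), fun ε hε => ?_⟩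
  obtain ⟨n, a, g, ha, hg, h⟩ := hf.2 ε hε
  refine ⟨n + 1, Fin.cons (- m / (1 + |m|)) fun i => a i / (1 + |m|),
    Fin.cons (fun _ => 1 + |m|) fun i x => (1 + |m|) * g i x, ?_, ?_, ?_⟩
  · rw [Fin.sum_univ_succ]
    simp only [Fin.cons_zero, Fin.cons_succ, abs_div, abs_neg, abs_of_pos hL, ← Finset.sum_div]
    rw [← add_div, div_le_one hL]
    linarith
  · intro i
    refine Fin.cases ?_ (fun i => ?_) i
    · simp only [Fin.cons_zero]
      exact (Mon.const hL).mono hL (le_mul_of_one_le_right hL.le (le_max_right _ _))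
    · simp only [Fin.cons_succ]
      exact ((hg i).const_mul hM hL).mono (by positivity) (by gcongr; exact le_max_left _ _)
  · refine lt_of_eq_of_lt (integral_congr_ae (ae_of_all _ fun x => ?_)) h
    simp only [Fin.sum_univ_succ, Fin.cons_zero, Fin.cons_succ]
    congr 1
    have e1 : - m / (1 + |m|) * (1 + |m|) = - m := by field_simp
    have e2 : ∀ i, a i / (1 + |m|) * ((1 + |m|) * g i x) = a i * g i x := fun i => by field_simp
    rw [e1]
    simp only [e2]
    ring

end ClassMembership

section Expectation

variable {Ω : Type*} [MeasurableSpace Ω] {P : Measure Ω} {μ : Measure ℝ}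
  {ρ : Ω → ℝ} {Z₁ Z₂ Z₃ : Ω → ℝ} {h k l : ℝ → ℝ}

/-- The data of a bounded weight and three random variables with law `μ`. -/
structure WeightedTriple (P : Measure Ω) (μ : Measure ℝ) (ρ Z₁ Z₂ Z₃ : Ω → ℝ) : Prop where
  meas : Measurable ρ
  abs_le : ∀ ω, |ρ ω| ≤ 1
  mp₁ : MeasurePreserving Z₁ P μ
  mp₂ : MeasurePreserving Z₂ P μ
  mp₃ : MeasurePreserving Z₃ P μ

namespace WeightedTriple

lemma abs_integrand_le (W : WeightedTriple P μ ρ Z₁ Z₂ Z₃) (ω : Ω) :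
    |ρ ω * (h (Z₁ ω) * k (Z₂ ω) * l (Z₃ ω))| ≤ |h (Z₁ ω) * k (Z₂ ω) * l (Z₃ ω)| := by
  rw [abs_mul]
  exact mul_le_of_le_one_left (abs_nonneg _) (W.abs_le ω)

lemma integrable (W : WeightedTriple P μ ρ Z₁ Z₂ Z₃) (hh : L3 μ h) (hk : L3 μ k) (hl : L3 μ l) :
    Integrable (fun ω => ρ ω * (h (Z₁ ω) * k (Z₂ ω) * l (Z₃ ω))) P := by
  refine Integrable.mono' (((W.mp₁.integrable_comp_of_integrable hh.2).add
    (W.mp₂.integrable_comp_of_integrable hk.2)).add (W.mp₃.integrable_comp_of_integrable hl.2))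
    (W.meas.mul (((hh.1.comp W.mp₁.measurable).mul (hk.1.comp W.mp₂.measurable)).mul
      (hl.1.comp W.mp₃.measurable))).aestronglyMeasurable (ae_of_all _ fun ω => ?_)
  refine (W.abs_integrand_le ω).trans ?_
  rw [abs_mul, abs_mul]
  exact WeakDep.mul_mul_le_cubes (abs_nonneg _) (abs_nonneg _) (abs_nonneg _)

lemma abs_integral_le (W : WeightedTriple P μ ρ Z₁ Z₂ Z₃) (hh : L3 μ h) (hk : L3 μ k)
    (hl : L3 μ l) {u v w : ℝ → ℝ} (hu : Integrable u μ) (hv : Integrable v μ)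
    (hw : Integrable w μ) (hb : ∀ x y z, |h x * k y * l z| ≤ u x + v y + w z) :
    |∫ ω, ρ ω * (h (Z₁ ω) * k (Z₂ ω) * l (Z₃ ω)) ∂P| ≤
      ∫ x, u x ∂μ + ∫ x, v x ∂μ + ∫ x, w x ∂μ := by
  have iu : Integrable (fun ω => u (Z₁ ω)) P := W.mp₁.integrable_comp_of_integrable hu
  have iv : Integrable (fun ω => v (Z₂ ω)) P := W.mp₂.integrable_comp_of_integrable hv
  have iw : Integrable (fun ω => w (Z₃ ω)) P := W.mp₃.integrable_comp_of_integrable hw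
  have iuv : Integrable (fun ω => u (Z₁ ω) + v (Z₂ ω)) P := iu.add iv
  have e : ∀ {Z : Ω → ℝ}, MeasurePreserving Z P μ → ∀ {q : ℝ → ℝ}, Integrable q μ →
      ∫ ω, q (Z ω) ∂P = ∫ x, q x ∂μ := fun {Z} hZ {q} hq => by
    rw [← hZ.map_eq] at hq ⊢
    rw [integral_map hZ.measurable.aemeasurable hq.aestronglyMeasurable]
  rw [← e W.mp₁ hu, ← e W.mp₂ hv, ← e W.mp₃ hw, ← integral_add iu iv, 
    ← integral_add iuv iw]
  refine (abs_integral_le_integral_abs).trans (integral_mono (W.integrable hh hk hl).abs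
    (iuv.add iw) fun ω => ?_)
  exact (W.abs_integrand_le ω).trans (hb _ _ _)

lemma lin₁ (W : WeightedTriple P μ ρ Z₁ Z₂ Z₃) (hk : L3 μ k) (hl : L3 μ l) :
    Lin3 μ fun h => ∫ ω, ρ ω * (h (Z₁ ω) * k (Z₂ ω) * l (Z₃ ω)) ∂P where
  add h h' hh hh' := by
    rw [← integral_add (W.integrable hh hk hl) (W.integrable hh' hk hl)]
    exact integral_congr_ae (ae_of_all _ fun ω => by ring)
  const_mul c h _ := by
    rw [← integral_const_mul]
    exact integral_congr_ae (ae_of_all _ fun ω => by ring)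

lemma rot (W : WeightedTriple P μ ρ Z₁ Z₂ Z₃) : WeightedTriple P μ ρ Z₂ Z₃ Z₁ :=
  ⟨W.meas, W.abs_le, W.mp₂, W.mp₃, W.mp₁⟩

lemma lin₂ (W : WeightedTriple P μ ρ Z₁ Z₂ Z₃) (hh : L3 μ h) (hl : L3 μ l) :
    Lin3 μ fun k => ∫ ω, ρ ω * (h (Z₁ ω) * k (Z₂ ω) * l (Z₃ ω)) ∂P := by
  convert W.rot.lin₁ hl hh using 2
  exact integral_congr_ae (ae_of_all _ fun ω => by ring)

lemma lin₃ (W : WeightedTriple P μ ρ Z₁ Z₂ Z₃) (hh : L3 μ h) (hk : L3 μ k) :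
    Lin3 μ fun l => ∫ ω, ρ ω * (h (Z₁ ω) * k (Z₂ ω) * l (Z₃ ω)) ∂P := by
  convert W.rot.rot.lin₁ hh hk using 2
  exact integral_congr_ae (ae_of_all _ fun ω => by ring)

end WeightedTriple

lemma Lin3.fun_sub {Ψ Ψ' : (ℝ → ℝ) → ℝ} (hΨ : Lin3 μ Ψ) (hΨ' : Lin3 μ Ψ') :
    Lin3 μ fun h => Ψ h - Ψ' h where
  add h k hh hk := by rw [hΨ.add h k hh hk, hΨ'.add h k hh hk]; ring
  const_mul c h hh := by rw [hΨ.const_mul c h hh, hΨ'.const_mul c h hh]; ring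

lemma WeightedTriple.triForm_sub {Ω' : Type*} [MeasurableSpace Ω'] {P' : Measure Ω'}
    {ρ' Z₁' Z₂' Z₃' : Ω' → ℝ} (W : WeightedTriple P μ ρ Z₁ Z₂ Z₃)
    (W' : WeightedTriple P' μ ρ' Z₁' Z₂' Z₃') :
    TriForm μ fun h k l => (∫ ω, ρ ω * (h (Z₁ ω) * k (Z₂ ω) * l (Z₃ ω)) ∂P)
      - ∫ ω, ρ' ω * (h (Z₁' ω) * k (Z₂' ω) * l (Z₃' ω)) ∂P' where
  lin₁ _ _ hk hl := (W.lin₁ hk hl).fun_sub (W'.lin₁ hk hl)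
  lin₂ _ _ hh hl := (W.lin₂ hh hl).fun_sub (W'.lin₂ hh hl)
  lin₃ _ _ hh hk := (W.lin₃ hh hk).fun_sub (W'.lin₃ hh hk)
  bound _ _ _ hh hk hl _ _ _ _ _ _ hu hv hw hb := by
    refine (abs_sub _ _).trans ?_
    linarith [W.abs_integral_le hh hk hl hu hv hw hb, W'.abs_integral_le hh hk hl hu hv hw hb]

lemma WeightedTriple.triForm_decouple_last [IsProbabilityMeasure P]
    (W : WeightedTriple P μ ρ Z₁ Z₂ Z₃) :
    TriForm μ fun h k l => (∫ ω, ρ ω * (h (Z₁ ω) * k (Z₂ ω) * l (Z₃ ω)) ∂P)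
      - (∫ ω, ρ ω * (h (Z₁ ω) * k (Z₂ ω)) ∂P) * ∫ ω, l (Z₃ ω) ∂P := by
  have W' : WeightedTriple (P.prod P) μ (fun ω => ρ ω.1) (fun ω => Z₁ ω.1) (fun ω => Z₂ ω.1)
      (fun ω => Z₃ ω.2) :=
    ⟨W.meas.comp measurable_fst, fun ω => W.abs_le _, W.mp₁.comp measurePreserving_fst,
      W.mp₂.comp measurePreserving_fst, W.mp₃.comp measurePreserving_snd⟩
  convert W.triForm_sub W' using 5 with h k l
  rw [← integral_prod_mul (fun ω => ρ ω * (h (Z₁ ω) * k (Z₂ ω))) (fun ω => l (Z₃ ω))]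
  exact integral_congr_ae (ae_of_all _ fun ω => by ring)

lemma WeightedTriple.triForm_decouple_first [IsProbabilityMeasure P]
    (W : WeightedTriple P μ ρ Z₁ Z₂ Z₃) :
    TriForm μ fun h k l => (∫ ω, ρ ω * (h (Z₁ ω) * k (Z₂ ω) * l (Z₃ ω)) ∂P)
      - (∫ ω, ρ ω * h (Z₁ ω) ∂P) * ∫ ω, k (Z₂ ω) * l (Z₃ ω) ∂P := by
  have W' : WeightedTriple (P.prod P) μ (fun ω => ρ ω.1) (fun ω => Z₁ ω.1) (fun ω => Z₂ ω.2)
      (fun ω => Z₃ ω.2) :=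
    ⟨W.meas.comp measurable_fst, fun ω => W.abs_le _, W.mp₁.comp measurePreserving_fst,
      W.mp₂.comp measurePreserving_snd, W.mp₃.comp measurePreserving_snd⟩
  convert W.triForm_sub W' using 5 with h k l
  rw [← integral_prod_mul (fun ω => ρ ω * h (Z₁ ω)) (fun ω => k (Z₂ ω) * l (Z₃ ω))]
  exact integral_congr_ae (ae_of_all _ fun ω => by ring)

end Expectation

section Markov

/-- The σ-algebra generated by `X 0, …, X n`. -/
abbrev past {Ω : Type*} (X : ℕ → Ω → ℝ) (n : ℕ) : MeasurableSpace Ω :=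
  MeasurableSpace.comap (fun ω => fun i : Fin (n + 1) => X i.1 ω) inferInstance

lemma measurable_past {Ω : Type*} {X : ℕ → Ω → ℝ} {i n : ℕ} (hi : i ≤ n) :
    Measurable[past X n] (X i) := by
  let _ : MeasurableSpace Ω := past X n
  have h : Measurable fun ω => fun i : Fin (n + 1) => X i.1 ω := comap_measurable _
  exact (measurable_pi_apply (⟨i, Nat.lt_succ_of_le hi⟩ : Fin (n + 1))).comp h

lemma past_le_of_measurable {Ω : Type*} {X : ℕ → Ω → ℝ} {m : MeasurableSpace Ω} {n : ℕ}
    (h : ∀ i ≤ n, Measurable[m] (X i)) : past X n ≤ m :=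
  Measurable.comap_le (measurable_pi_lambda _ fun i => h i.1 (Nat.le_of_lt_succ i.2))

lemma past_mono {Ω : Type*} {X : ℕ → Ω → ℝ} : Monotone (past X) := fun _ _ hmn =>
  past_le_of_measurable fun _ hi => measurable_past (hi.trans hmn)

variable {Ω : Type*} [m0 : MeasurableSpace Ω] {P : Measure Ω} {X : ℕ → Ω → ℝ} {μ : Measure ℝ}
  {K : Kernel ℝ ℝ}

/-- A stationary Markov chain with transition kernel `K` and invariant law `μ`. -/
structure StatMarkov (P : Measure Ω) (X : ℕ → Ω → ℝ) (μ : Measure ℝ) (K : Kernel ℝ ℝ) :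
    Prop where
  meas : ∀ i, Measurable (X i)
  inv : μ.bind (fun x => K x) = μ
  init : Measure.map (X 0) P = μ
  markov : ∀ n : ℕ, ∀ g : ℝ → ℝ, Measurable g → (∃ C, ∀ x, |g x| ≤ C) →
    P[fun ω => g (X (n + 1) ω) | past X n] =ᵐ[P] fun ω => Kop K g (X n ω)
  stat : ∀ k n : ℕ, Measure.map (fun ω => fun i : Fin n => X (i.1 + k) ω) P
    = Measure.map (fun ω => fun i : Fin n => X i.1 ω) P

lemma Kop_measurable [IsMarkovKernel K] {g : ℝ → ℝ} (hg : Measurable g) : Measurable (Kop K g) :=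
  (StronglyMeasurable.integral_kernel hg.stronglyMeasurable).measurable

lemma abs_Kop_le [IsMarkovKernel K] {g : ℝ → ℝ} {C : ℝ} (hg : ∀ x, |g x| ≤ C) (x : ℝ) :
    |Kop K g x| ≤ C := by
  have := norm_integral_le_of_norm_le_const (μ := K x) (f := g) (C := C) (ae_of_all _ hg)
  simpa [Kop] using this

lemma Kop_iterate_measurable [IsMarkovKernel K] {g : ℝ → ℝ} (hg : Measurable g) (m : ℕ) :
    Measurable ((Kop K)^[m] g) := by
  induction m generalizing g with
  | zero => exact hg
  | succ m ih => exact ih (Kop_measurable hg)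

lemma abs_Kop_iterate_le [IsMarkovKernel K] {g : ℝ → ℝ} {C : ℝ} (hg : ∀ x, |g x| ≤ C) (m : ℕ) :
    ∀ x, |(Kop K)^[m] g x| ≤ C := by
  induction m generalizing g with
  | zero => exact hg
  | succ m ih => exact ih (abs_Kop_le hg)

namespace StatMarkov

lemma past_le (hX : StatMarkov P X μ K) (n : ℕ) : past X n ≤ m0 :=
  past_le_of_measurable fun i _ => hX.meas i

lemma measurePreserving (hX : StatMarkov P X μ K) (i : ℕ) : MeasurePreserving (X i) P μ := by
  refine ⟨hX.meas i, ?_⟩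
  have h := congrArg (Measure.map fun v : Fin 1 → ℝ => v 0) (hX.stat i 1)
  rw [Measure.map_map (measurable_pi_apply _) (measurable_pi_lambda _ fun j => hX.meas _),
    Measure.map_map (measurable_pi_apply _) (measurable_pi_lambda _ fun j => hX.meas _)] at h
  simpa [Function.comp_def, hX.init] using h

lemma integral_comp (hX : StatMarkov P X μ K) (i : ℕ) {h : ℝ → ℝ} (hh : Measurable h) :
    ∫ ω, h (X i ω) ∂P = ∫ x, h x ∂μ := by
  rw [← (hX.measurePreserving i).map_eq,
    integral_map (hX.meas i).aemeasurable hh.aestronglyMeasurable]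

lemma integral_mul_shift (hX : StatMarkov P X μ K) {h k : ℝ → ℝ} (hh : Measurable h)
    (hk : Measurable k) (b i : ℕ) :
    ∫ ω, h (X b ω) * k (X (b + i) ω) ∂P = ∫ ω, h (X 0 ω) * k (X i ω) ∂P := by
  have hG : Measurable fun v : Fin (i + 1) → ℝ => h (v 0) * k (v (Fin.last i)) :=
    (hh.comp (measurable_pi_apply _)).mul (hk.comp (measurable_pi_apply _))
  have e := congrArg (fun ν => ∫ v : Fin (i + 1) → ℝ, h (v 0) * k (v (Fin.last i)) ∂ν)
    (hX.stat b (i + 1))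
  beta_reduce at e
  rw [integral_map (measurable_pi_lambda _ fun j => hX.meas _).aemeasurable
      hG.aestronglyMeasurable, integral_map (measurable_pi_lambda _ fun j => hX.meas _).aemeasurable
      hG.aestronglyMeasurable] at e
  simpa [add_comm i b] using e

lemma map_restrict_succ [IsMarkovKernel K] [IsProbabilityMeasure P] (hX : StatMarkov P X μ K)
    {n : ℕ} {A : Set Ω} (hA : MeasurableSet[past X n] A) :
    (P.restrict A).map (X (n + 1)) = ((P.restrict A).map (X n)).bind K := by
  ext B hB
  rw [Measure.bind_apply hB K.aemeasurable, lintegral_map (K.measurable_coe hB) (hX.meas n),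
    Measure.map_apply (hX.meas _) hB, ← ENNReal.toReal_eq_toReal_iff' (measure_ne_top _ _)]
  · have hg : Measurable (B.indicator fun _ => (1:ℝ)) := measurable_const.indicator hB
    have hgb : ∀ x, |B.indicator (fun _ => (1:ℝ)) x| ≤ 1 := fun x => by
      by_cases hx : x ∈ B <;> simp [hx]
    have i1 : Integrable (fun ω => B.indicator (fun _ => (1:ℝ)) (X (n + 1) ω)) P :=
      Integrable.of_bound (hg.comp (hX.meas _)).aestronglyMeasurable 1 (ae_of_all _ fun _ => hgb _)
    have h1 := setIntegral_condExp (hX.past_le n) i1 hA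
    rw [integral_congr_ae (ae_restrict_of_ae (hX.markov n _ hg ⟨1, hgb⟩))] at h1
    have e1 : ∀ x, Kop K (B.indicator fun _ => (1:ℝ)) x = (K x B).toReal := fun x => by
      simp only [Kop, integral_indicator_const _ hB]
      simp [Measure.real]
    simp only [e1] at h1
    rw [integral_toReal (f := fun ω => K (X n ω) B)
      (((K.measurable_coe hB).comp (hX.meas n)).aemeasurable)
      (ae_of_all _ fun _ => measure_lt_top _ _)] at h1
    rw [h1]
    clear h1
    have e2 : (fun ω => B.indicator (fun _ => (1:ℝ)) (X (n + 1) ω))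
        = (X (n + 1) ⁻¹' B).indicator fun _ => (1:ℝ) := rfl
    rw [e2, integral_indicator_const _ ((hX.meas _) hB)]
    simp [Measure.real]
  · refine ne_of_lt (lt_of_le_of_lt (lintegral_mono fun ω => prob_le_one) ?_)
    simp

lemma integrable_Kop [IsMarkovKernel K] (hX : StatMarkov P X μ K) {F : ℝ → ℝ}
    (hF : Measurable F) (hi : Integrable F μ) : Integrable (Kop K F) μ := by
  have e : μ.bind K = μ := hX.inv
  have := ((Measure.integrable_comp_iff (κ := K) (μ := μ) (f := F)
    hF.aestronglyMeasurable).1 (by rw [e]; exact hi)).2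
  exact Integrable.mono' this (Kop_measurable hF).aestronglyMeasurable
    (ae_of_all _ fun x => norm_integral_le_integral_norm _)

lemma condExp_succ [IsMarkovKernel K] [IsProbabilityMeasure P] (hX : StatMarkov P X μ K)
    {F : ℝ → ℝ} (hF : Measurable F) (hi : Integrable F μ) (n : ℕ) :
    P[fun ω => F (X (n + 1) ω) | past X n] =ᵐ[P] fun ω => Kop K F (X n ω) := by
  have hKi : Integrable (fun ω => Kop K F (X n ω)) P :=
    (hX.measurePreserving n).integrable_comp_of_integrable (hX.integrable_Kop hF hi)
  have hFi : Integrable (fun ω => F (X (n + 1) ω)) P :=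
    (hX.measurePreserving (n + 1)).integrable_comp_of_integrable hi
  refine (ae_eq_condExp_of_forall_setIntegral_eq (hX.past_le n) hFi
    (fun _ _ _ => hKi.integrableOn) (fun A hA _ => ?_)
    ((Kop_measurable hF).comp (measurable_past le_rfl)).aestronglyMeasurable).symm
  rw [← integral_map (φ := X n) (f := Kop K F) (hX.meas n).aemeasurable
      (Kop_measurable hF).aestronglyMeasurable,
    ← integral_map (φ := X (n + 1)) (f := F) (hX.meas _).aemeasurable hF.aestronglyMeasurable,
    hX.map_restrict_succ hA]
  have hFi' : Integrable F (((P.restrict A).map (X n)).bind K) := by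
    rw [← hX.map_restrict_succ hA, integrable_map_measure hF.aestronglyMeasurable
      (hX.meas _).aemeasurable]
    exact hFi.integrableOn
  rw [Measure.comp_eq_comp_const_apply] at hFi' ⊢
  rw [ProbabilityTheory.Kernel.integral_comp hFi']
  simp [Kop]

lemma condExp_iterate [IsMarkovKernel K] [IsProbabilityMeasure P] (hX : StatMarkov P X μ K)
    {F : ℝ → ℝ} (hF : Measurable F) (hi : Integrable F μ) (n m : ℕ) :
    P[fun ω => F (X (n + m) ω) | past X n] =ᵐ[P] fun ω => (Kop K)^[m] F (X n ω) := by
  induction m generalizing F with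
  | zero =>
    rw [add_zero, condExp_of_stronglyMeasurable (f := fun ω => F (X n ω)) (hX.past_le n)
      (hF.comp (measurable_past le_rfl)).stronglyMeasurable
      ((hX.measurePreserving n).integrable_comp_of_integrable hi)]
    rfl
  | succ m ih =>
    have h1 := condExp_condExp_of_le (μ := P) (f := fun ω => F (X (n + (m + 1)) ω))
      (past_mono (X := X) (Nat.le_add_right n m)) (hX.past_le (n + m))
    exact h1.symm.trans ((condExp_congr_ae (hX.condExp_succ hF hi (n + m))).trans
      (ih (Kop_measurable hF) (hX.integrable_Kop hF hi)))

/-- The Markov property integrated against a functional of the past. -/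
lemma integral_mul_iterate [IsMarkovKernel K] [IsProbabilityMeasure P] (hX : StatMarkov P X μ K)
    {F : ℝ → ℝ} (hF : Measurable F) (hi : Integrable F μ) {n : ℕ} (m : ℕ) {ρ : Ω → ℝ}
    (hρ : Measurable[past X n] ρ) (hρF : Integrable (fun ω => ρ ω * F (X (n + m) ω)) P) :
    ∫ ω, ρ ω * F (X (n + m) ω) ∂P = ∫ ω, ρ ω * (Kop K)^[m] F (X n ω) ∂P := by
  have h := condExp_mul_of_stronglyMeasurable_left (μ := P) hρ.stronglyMeasurable hρF
    ((hX.measurePreserving (n + m)).integrable_comp_of_integrable hi)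
  rw [← integral_condExp (hX.past_le n)]
  refine integral_congr_ae (h.trans ?_)
  filter_upwards [hX.condExp_iterate hF hi n m] with ω hω
  simp only [Pi.mul_apply]
  congr 1

lemma integral_iterate [IsMarkovKernel K] [IsProbabilityMeasure P] (hX : StatMarkov P X μ K)
    {F : ℝ → ℝ} (hF : Measurable F)
    (hi : Integrable F μ) (m : ℕ) : ∫ x, (Kop K)^[m] F x ∂μ = ∫ x, F x ∂μ := by
  have h := hX.integral_mul_iterate hF hi (n := 0) m (ρ := fun _ => 1) measurable_const
    (by simpa [Function.comp_def] using (hX.measurePreserving (0 + m)).integrable_comp_of_integrable hi)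
  simp only [one_mul] at h
  rw [hX.integral_comp _ hF, hX.integral_comp _ (Kop_iterate_measurable hF m)] at h
  exact h.symm

end StatMarkov

end Markov

section Coefficients

variable {Ω : Type*} [m0 : MeasurableSpace Ω] {P : Measure Ω} [IsProbabilityMeasure P]
  {X : ℕ → Ω → ℝ} {μ : Measure ℝ} [IsProbabilityMeasure μ] {K : Kernel ℝ ℝ} [IsMarkovKernel K]

lemma integral_abs_sub_integral_le {Φ : ℝ → ℝ} (hΦ : ∀ x, |Φ x| ≤ 1) {m : ℝ} (hm : |m| ≤ 1) :
    ∫ x, |Φ x - m| ∂μ ≤ 2 := by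
  have h := norm_integral_le_of_norm_le_const (μ := μ) (f := fun x => |Φ x - m|) (C := 2)
    (ae_of_all _ fun x => by
      rw [Real.norm_eq_abs, abs_abs]
      exact (abs_sub _ _).trans (by linarith [hΦ x]))
  simpa using (le_abs_self _).trans h

lemma abs_integral_le_one {Φ : ℝ → ℝ} (hΦ : ∀ x, |Φ x| ≤ 1) : |∫ x, Φ x ∂μ| ≤ 1 := by
  have h := norm_integral_le_of_norm_le_const (μ := μ) (f := Φ) (C := 1) (ae_of_all _ hΦ)
  simpa using h

lemma abs_nestedK_le {L : List (ℕ × (ℝ → ℝ))} (hL : ∀ q ∈ L, ∀ x, |q.2 x| ≤ 1) :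
    ∀ x, |nestedK (Kop K) L x| ≤ 1 := by
  induction L with
  | nil => simp [nestedK]
  | cons q L ih =>
    obtain ⟨n, g⟩ := q
    refine abs_Kop_iterate_le (fun x => ?_) n
    rw [abs_mul]
    exact mul_le_one₀ (hL (n, g) List.mem_cons_self x) (abs_nonneg _)
      (ih (fun q hq => hL q (List.mem_cons_of_mem _ hq)) x)

lemma abs_nestedK_tList_le (n : ℕ) {l : ℕ} (ns : Fin l → ℕ) (ts : Fin (l + 1) → ℝ) (x : ℝ) :
    |nestedK (Kop K) (tList n ns ts) x| ≤ 1 := by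
  refine abs_nestedK_le (fun q hq y => ?_) x
  simp only [tList, List.mem_cons, List.mem_ofFn] at hq
  obtain rfl | ⟨i, rfl⟩ := hq
  · exact TriForm.abs_indic_le _ _
  · exact TriForm.abs_indic_le _ _

lemma integral_abs_iterate_indic_sub_le (n : ℕ) (t : ℝ) :
    ∫ x, |(Kop K)^[n] (indic t) x - ∫ y, indic t y ∂μ| ∂μ ≤ alphaCoef (Kop K) μ 2 n := by
  refine le_trans ?_ (le_max_left _ _)
  refine le_ciSup (f := fun t => ∫ x, |(Kop K)^[n] (indic t) x - ∫ y, indic t y ∂μ| ∂μ) ⟨2, ?_⟩ t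
  rintro _ ⟨s, rfl⟩
  exact integral_abs_sub_integral_le (abs_Kop_iterate_le (TriForm.abs_indic_le s) n)
    (abs_integral_le_one (TriForm.abs_indic_le s))

lemma integral_abs_nestedK_sub_le (n : ℕ) {j : ℕ} (hj : 1 ≤ j) (s t : ℝ) :
    ∫ x, |nestedK (Kop K) [(n, indic s), (j, indic t)] x
      - ∫ y, nestedK (Kop K) [(n, indic s), (j, indic t)] y ∂μ| ∂μ
      ≤ alphaCoef (Kop K) μ 2 n := by
  have hb : ∀ {l : ℕ} (ns : Fin l → ℕ) (ts : Fin (l + 1) → ℝ),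
      ∫ x, |nestedK (Kop K) (tList n ns ts) x
        - ∫ y, nestedK (Kop K) (tList n ns ts) y ∂μ| ∂μ ≤ 2 := fun ns ts =>
    integral_abs_sub_integral_le (abs_nestedK_tList_le n ns ts)
      (abs_integral_le_one (abs_nestedK_tList_le n ns ts))
  refine le_trans ?_ (le_max_right _ _)
  refine le_trans ?_ (le_ciSup (f := fun j : Fin (2 - 1) =>
    ⨆ ns : {m : Fin (j.1 + 1) → ℕ // ∀ i, 1 ≤ m i}, ⨆ ts : Fin (j.1 + 2) → ℝ,
      ∫ x, |nestedK (Kop K) (tList n ns.1 ts) x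
        - ∫ y, nestedK (Kop K) (tList n ns.1 ts) y ∂μ| ∂μ) (Set.finite_range _).bddAbove
    ⟨0, by norm_num⟩)
  refine le_trans ?_ (le_ciSup ⟨2, ?_⟩ ⟨fun _ => j, fun _ => hj⟩)
  · refine le_trans (le_of_eq ?_) (le_ciSup ⟨2, ?_⟩ ![s, t])
    · simp [tList]
    · rintro _ ⟨ts, rfl⟩
      exact hb _ _
  · rintro _ ⟨ns, rfl⟩
    exact ciSup_le fun ts => hb _ _

lemma indic_mul_indic (s t x : ℝ) : indic s x * indic t x = indic (min s t) x := by
  simp only [indic, Set.indicator_apply, Set.mem_Iic, le_min_iff]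
  split_ifs <;> simp_all

namespace StatMarkov

/-- Decoupling of a bounded function of the future from a weight depending on the past. -/
lemma abs_integral_mul_sub_le (hX : StatMarkov P X μ K) {g : ℝ → ℝ} (hg : Measurable g)
    (hg1 : ∀ x, |g x| ≤ 1) {a : ℕ} (m : ℕ) {ρ : Ω → ℝ} (hρ : Measurable[past X a] ρ)
    (hρ1 : ∀ ω, |ρ ω| ≤ 1) :
    |∫ ω, ρ ω * g (X (a + m) ω) ∂P - (∫ ω, ρ ω ∂P) * ∫ x, g x ∂μ| ≤
      ∫ x, |(Kop K)^[m] g x - ∫ y, g y ∂μ| ∂μ := by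
  have hρm : Measurable ρ := hρ.mono (hX.past_le a) le_rfl
  have hgi : Integrable g μ := Integrable.of_bound hg.aestronglyMeasurable 1 (ae_of_all _ hg1)
  have hKm := Kop_iterate_measurable (K := K) hg m
  have hρi : Integrable ρ P := Integrable.of_bound hρm.aestronglyMeasurable 1 (ae_of_all _ hρ1)
  have hb : ∀ {q : ℝ → ℝ}, Measurable q → (∀ x, |q x| ≤ 1) → ∀ i,
      Integrable (fun ω => ρ ω * q (X i ω)) P := fun {q} hq hq1 i =>
    Integrable.of_bound (hρm.mul (hq.comp (hX.meas i))).aestronglyMeasurable 1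
      (ae_of_all _ fun ω => by
        rw [Real.norm_eq_abs, abs_mul]
        exact mul_le_one₀ (hρ1 ω) (abs_nonneg _) (hq1 _))
  rw [hX.integral_mul_iterate hg hgi m hρ (hb hg hg1 _), ← integral_mul_const,
    ← integral_sub (hb hKm (abs_Kop_iterate_le hg1 m) a) (hρi.mul_const _)]
  have hKi : Integrable ((Kop K)^[m] g) μ :=
    Integrable.of_bound hKm.aestronglyMeasurable 1 (ae_of_all _ (abs_Kop_iterate_le hg1 m))
  have hi : Integrable (fun x => |(Kop K)^[m] g x - ∫ y, g y ∂μ|) μ :=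
    (hKi.sub (integrable_const _)).abs
  rw [← hX.integral_comp a (h := fun x => |(Kop K)^[m] g x - ∫ y, g y ∂μ|)
    (hKm.sub_const _).abs]
  refine abs_integral_le_integral_abs.trans (integral_mono_of_nonneg
    (ae_of_all _ fun _ => abs_nonneg _)
    ((hX.measurePreserving a).integrable_comp_of_integrable hi) (ae_of_all _ fun ω => ?_))
  beta_reduce
  rw [← mul_sub, abs_mul]
  exact mul_le_of_le_one_left (abs_nonneg _) (hρ1 ω)

lemma abs_decouple_indic_last (hX : StatMarkov P X μ K) {a b : ℕ} (hab : a ≤ b) (m : ℕ)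
    {ρ : Ω → ℝ} (hρ : Measurable[past X b] ρ) (hρ1 : ∀ ω, |ρ ω| ≤ 1) (s t u : ℝ) :
    |(∫ ω, ρ ω * (indic s (X a ω) * indic t (X b ω) * indic u (X (b + m) ω)) ∂P)
      - (∫ ω, ρ ω * (indic s (X a ω) * indic t (X b ω)) ∂P) * ∫ ω, indic u (X (b + m) ω) ∂P|
      ≤ alphaCoef (Kop K) μ 2 m := by
  have h := hX.abs_integral_mul_sub_le (TriForm.measurable_indic u) (TriForm.abs_indic_le u)
    (a := b) m (ρ := fun ω => ρ ω * (indic s (X a ω) * indic t (X b ω)))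
    (hρ.mul (((TriForm.measurable_indic s).comp (measurable_past hab)).mul
      ((TriForm.measurable_indic t).comp (measurable_past le_rfl))))
    (fun ω => by
      rw [abs_mul, abs_mul]
      exact mul_le_one₀ (hρ1 ω) (by positivity) (mul_le_one₀ (TriForm.abs_indic_le _ _)
        (abs_nonneg _) (TriForm.abs_indic_le _ _)))
  rw [hX.integral_comp (b + m) (TriForm.measurable_indic u)]
  simp only [← mul_assoc] at h ⊢
  exact h.trans (integral_abs_iterate_indic_sub_le m u)

lemma abs_decouple_indic_first (hX : StatMarkov P X μ K) (a m j : ℕ)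
    {ρ : Ω → ℝ} (hρ : Measurable[past X a] ρ) (hρ1 : ∀ ω, |ρ ω| ≤ 1) (s t u : ℝ) :
    |(∫ ω, ρ ω * (indic s (X a ω) * indic t (X (a + m) ω) * indic u (X (a + m + j) ω)) ∂P)
      - (∫ ω, ρ ω * indic s (X a ω) ∂P) *
        ∫ ω, indic t (X (a + m) ω) * indic u (X (a + m + j) ω) ∂P|
      ≤ alphaCoef (Kop K) μ 2 m := by
  set g : ℝ → ℝ := fun x => indic t x * (Kop K)^[j] (indic u) x with hg
  have hgm : Measurable g :=
    (TriForm.measurable_indic t).mul (Kop_iterate_measurable (TriForm.measurable_indic u) j)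
  have hg1 : ∀ x, |g x| ≤ 1 := fun x => by
    rw [hg, abs_mul]
    exact mul_le_one₀ (TriForm.abs_indic_le _ _) (abs_nonneg _)
      (abs_Kop_iterate_le (TriForm.abs_indic_le u) j x)
  have hgi : Integrable g μ := Integrable.of_bound hgm.aestronglyMeasurable 1 (ae_of_all _ hg1)
  have hui : Integrable (indic u) μ := Integrable.of_bound
    (TriForm.measurable_indic u).aestronglyMeasurable 1 (ae_of_all _ (TriForm.abs_indic_le u))
  have key : ∀ q : Ω → ℝ, Measurable[past X a] q → (∀ ω, |q ω| ≤ 1) →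
      ∫ ω, q ω * (indic t (X (a + m) ω) * indic u (X (a + m + j) ω)) ∂P =
        ∫ ω, q ω * g (X (a + m) ω) ∂P := fun q hq hq1 => by
    have hq' : Measurable[past X (a + m)] fun ω => q ω * indic t (X (a + m) ω) :=
      (hq.mono (past_mono (Nat.le_add_right a m)) le_rfl).mul
        ((TriForm.measurable_indic t).comp (measurable_past le_rfl))
    have h := hX.integral_mul_iterate (TriForm.measurable_indic u) hui j hq'
      (Integrable.of_bound ((hq'.mono (hX.past_le _) le_rfl).mul
        ((TriForm.measurable_indic u).comp (hX.meas _))).aestronglyMeasurable 1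
        (ae_of_all _ fun ω => by
          rw [Real.norm_eq_abs, abs_mul, abs_mul]
          exact mul_le_one₀ (mul_le_one₀ (hq1 ω) (abs_nonneg _) (TriForm.abs_indic_le _ _))
            (abs_nonneg _) (TriForm.abs_indic_le _ _)))
    simpa only [mul_assoc] using h
  have hρ' : Measurable[past X a] fun ω => ρ ω * indic s (X a ω) :=
    hρ.mul ((TriForm.measurable_indic s).comp (measurable_past le_rfl))
  have hρ'1 : ∀ ω, |ρ ω * indic s (X a ω)| ≤ 1 := fun ω => by
    rw [abs_mul]
    exact mul_le_one₀ (hρ1 ω) (abs_nonneg _) (TriForm.abs_indic_le _ _)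
  have k1 := key _ hρ' hρ'1
  have k2 := key (fun _ => 1) measurable_const (by simp)
  simp only [one_mul] at k2
  rw [k2, hX.integral_comp _ hgm]
  have h := hX.abs_integral_mul_sub_le hgm hg1 m hρ' hρ'1
  rw [← k1] at h
  simp only [← mul_assoc] at h ⊢
  refine h.trans ?_
  rcases Nat.eq_zero_or_pos j with rfl | hj
  · have e : g = indic (min t u) := funext fun x => by simp [hg, indic_mul_indic]
    rw [e]
    exact integral_abs_iterate_indic_sub_le m _
  · have e : (Kop K)^[m] g = nestedK (Kop K) [(m, indic t), (j, indic u)] := by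
      simp [nestedK, hg]
    have := integral_abs_nestedK_sub_le (K := K) (μ := μ) m hj t u
    rwa [← e, hX.integral_iterate hgm hgi] at this

end StatMarkov

end Coefficients

section Decoupling

variable {Ω : Type*} [m0 : MeasurableSpace Ω] {P : Measure Ω} [IsProbabilityMeasure P]
  {X : ℕ → Ω → ℝ} {μ : Measure ℝ} [IsProbabilityMeasure μ] {K : Kernel ℝ ℝ} [IsMarkovKernel K]

/-- Decoupling at rate `k ^ (-r)` of functions in a class `S` evaluated along the chain, before
and after a gap of length `k`. -/
structure Decouples (P : Measure Ω) (X : ℕ → Ω → ℝ) (S : Set (ℝ → ℝ)) (C r : ℝ) : Prop where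
  last : ∀ F₁ ∈ S, ∀ F₂ ∈ S, ∀ F₃ ∈ S, ∀ a b m : ℕ, a ≤ b → 1 ≤ m → ∀ ρ : Ω → ℝ,
    Measurable[past X b] ρ → (∀ ω, |ρ ω| ≤ 1) →
    |(∫ ω, ρ ω * (F₁ (X a ω) * F₂ (X b ω) * F₃ (X (b + m) ω)) ∂P)
      - (∫ ω, ρ ω * (F₁ (X a ω) * F₂ (X b ω)) ∂P) * ∫ ω, F₃ (X (b + m) ω) ∂P|
      ≤ C * (m:ℝ) ^ (-r)
  first : ∀ F₁ ∈ S, ∀ F₂ ∈ S, ∀ F₃ ∈ S, ∀ a m j : ℕ, 1 ≤ m → ∀ ρ : Ω → ℝ,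
    Measurable[past X a] ρ → (∀ ω, |ρ ω| ≤ 1) →
    |(∫ ω, ρ ω * (F₁ (X a ω) * F₂ (X (a + m) ω) * F₃ (X (a + m + j) ω)) ∂P)
      - (∫ ω, ρ ω * F₁ (X a ω) ∂P) * ∫ ω, F₂ (X (a + m) ω) * F₃ (X (a + m + j) ω) ∂P|
      ≤ C * (m:ℝ) ^ (-r)

lemma StatMarkov.exists_decouples (hX : StatMarkov P X μ K) {M : ℝ} (hM : 0 < M) {p : ℝ≥0∞}
    (hp : 3 < p) {r : ℝ} (hr : 0 < r)
    (halpha : ∃ B : ℝ, ∀ k : ℕ, 1 ≤ k →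
      alphaCoef (Kop K) μ 2 k ≤ B * (k : ℝ) ^ (-(r * (((1:ℝ≥0∞) - 3 / p)⁻¹).toReal))) :
    (∀ F, Measurable F → ClassC M p μ F → L3 μ F) ∧
      ∃ C, 0 ≤ C ∧ Decouples P X {F | Measurable F ∧ ClassC M p μ F} C r := by
  obtain ⟨B, hB⟩ := halpha
  obtain ⟨h3, C, hC, h⟩ := exists_triForm_bound μ hM hp hr B
  refine ⟨h3, C, hC, fun F₁ h₁ F₂ h₂ F₃ h₃ a b m hab hm ρ hρ hρ1 => ?_,
    fun F₁ h₁ F₂ h₂ F₃ h₃ a m j hm ρ hρ hρ1 => ?_⟩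
  · have W : WeightedTriple P μ ρ (X a) (X b) (X (b + m)) :=
      ⟨hρ.mono (hX.past_le b) le_rfl, hρ1, hX.measurePreserving _, hX.measurePreserving _,
        hX.measurePreserving _⟩
    exact h _ W.triForm_decouple_last m hm
      (fun s t u => (hX.abs_decouple_indic_last hab m hρ hρ1 s t u).trans (hB m hm))
      F₁ F₂ F₃ h₁.1 h₂.1 h₃.1 h₁.2 h₂.2 h₃.2
  · have W : WeightedTriple P μ ρ (X a) (X (a + m)) (X (a + m + j)) :=
      ⟨hρ.mono (hX.past_le a) le_rfl, hρ1, hX.measurePreserving _, hX.measurePreserving _,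
        hX.measurePreserving _⟩
    exact h _ W.triForm_decouple_first m hm
      (fun s t u => (hX.abs_decouple_indic_first a m j hρ hρ1 s t u).trans (hB m hm))
      F₁ F₂ F₃ h₁.1 h₂.1 h₃.1 h₁.2 h₂.2 h₃.2

lemma abs_integral_mul_le_of_unit {m : MeasurableSpace Ω} {Z : Ω → ℝ} {b : ℝ}
    (h : ∀ ρ : Ω → ℝ, Measurable[m] ρ → (∀ ω, |ρ ω| ≤ 1) → |∫ ω, ρ ω * Z ω ∂P| ≤ b)
    {ρ : Ω → ℝ} {r : ℝ} (hρ : Measurable[m] ρ) (hr : ∀ ω, |ρ ω| ≤ r) :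
    |∫ ω, ρ ω * Z ω ∂P| ≤ r * b := by
  obtain ⟨ω₀⟩ := nonempty_of_isProbabilityMeasure P
  rcases ((abs_nonneg _).trans (hr ω₀)).eq_or_lt with rfl | hr0
  · have e : ∀ ω, ρ ω = 0 := fun ω => abs_nonpos_iff.1 (hr ω)
    simp [e]
  · have h1 := h (fun ω => r⁻¹ * ρ ω) (hρ.const_mul _) fun ω => by
      rw [abs_mul, abs_of_pos (inv_pos.2 hr0), inv_mul_le_iff₀ hr0, mul_one]
      exact hr ω
    simp only [mul_assoc, integral_const_mul] at h1
    rwa [abs_mul, abs_of_pos (inv_pos.2 hr0), inv_mul_le_iff₀ hr0] at h1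

lemma le_mul_rpow_half_of_le {q A x y r : ℝ} (hA : 0 ≤ A) (hx : 0 < x) (hy : 0 < y)
    (h₁ : q ≤ A * x ^ (-r)) (h₂ : q ≤ A * y ^ (-r)) :
    q ≤ A * (x ^ (-(r / 2)) * y ^ (-(r / 2))) := by
  have e : ∀ {z : ℝ}, 0 < z → z ^ (-r) = z ^ (-(r / 2)) * z ^ (-(r / 2)) := fun {z} hz => by
    rw [← Real.rpow_add hz]
    congr 1
    ring
  have hx' := Real.rpow_nonneg hx.le (-(r / 2))
  have hy' := Real.rpow_nonneg hy.le (-(r / 2))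
  rcases le_total (x ^ (-(r / 2))) (y ^ (-(r / 2))) with hxy | hxy
  · refine h₁.trans (mul_le_mul_of_nonneg_left ?_ hA)
    rw [e hx]
    exact mul_le_mul_of_nonneg_left hxy hx'
  · refine h₂.trans (mul_le_mul_of_nonneg_left ?_ hA)
    rw [e hy]
    exact mul_le_mul_of_nonneg_right hxy hy'

lemma natCast_rpow_neg_le {r : ℝ} (hr0 : 0 ≤ r) (hr : r ≤ 2) {i : ℕ} (hi : 1 ≤ i) :
    (i:ℝ) ^ (-r) ≤ 4 * ((i:ℝ) + 1) ^ (-r) := by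
  have hi' : (1:ℝ) ≤ i := by exact_mod_cast hi
  have h1 : ((2:ℝ) * i) ^ (-r) ≤ ((i:ℝ) + 1) ^ (-r) :=
    Real.rpow_le_rpow_of_nonpos (by positivity) (by linarith) (by linarith)
  rw [Real.mul_rpow (by norm_num) (by positivity)] at h1
  have h2 : (4:ℝ)⁻¹ ≤ (2:ℝ) ^ (-r) := by
    have : (2:ℝ) ^ (-2:ℝ) ≤ (2:ℝ) ^ (-r) :=
      Real.rpow_le_rpow_of_exponent_le (by norm_num) (by linarith)
    refine le_trans (le_of_eq ?_) this
    rw [Real.rpow_neg (by norm_num)]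
    norm_num
  have h3 := mul_le_mul_of_nonneg_right h2 (Real.rpow_nonneg (by positivity : (0:ℝ) ≤ i) (-r))
  linarith

end Decoupling

section WeakDependence

variable {Ω : Type*} [m0 : MeasurableSpace Ω] {P : Measure Ω} {X : ℕ → Ω → ℝ} {μ : Measure ℝ} [IsProbabilityMeasure μ] {K : Kernel ℝ ℝ}

lemma L3.integrable_mul (hX : StatMarkov P X μ K) {h k : ℝ → ℝ} (hh : L3 μ h) (hk : L3 μ k)
    {ρ : Ω → ℝ} (hρ : Measurable ρ) {r : ℝ} (hr : ∀ ω, |ρ ω| ≤ r) (a b : ℕ) :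
    Integrable (fun ω => ρ ω * (h (X a ω) * k (X b ω))) P := by
  have h1 : L3 μ fun _ => 1 := L3.of_bounded measurable_const (C := 1) (by simp)
  have W : WeightedTriple P μ (fun _ => 1) (X a) (X b) (X b) :=
    ⟨measurable_const, by simp, hX.measurePreserving _, hX.measurePreserving _,
      hX.measurePreserving _⟩
  have hi := W.integrable hh hk h1
  simp only [one_mul, mul_one] at hi
  exact hi.bdd_mul hρ.aestronglyMeasurable (ae_of_all _ hr)

/-- A centred observable of a decoupling Markov chain is weakly dependent. -/
lemma StatMarkov.exists_weakDep [IsProbabilityMeasure P] (hX : StatMarkov P X μ K) {S : Set (ℝ → ℝ)} {C δ : ℝ}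
    (hδ : δ ∈ Ioo (0:ℝ) 1) (hC : 0 ≤ C) (hS : Decouples P X S C (1 + δ)) {g : ℝ → ℝ}
    (hg : g ∈ S) (h1 : (fun _ => 1) ∈ S) (hg3 : L3 μ g) (hg0 : ∫ x, g x ∂μ = 0) :
    ∃ C', WeakDep P (fun i ω => g (X (i + 1) ω)) (fun i => past X (i + 1))
      (fun i => ∫ ω, g (X 0 ω) * g (X i ω) ∂P) C' δ := by
  set γ : ℕ → ℝ := fun i => ∫ ω, g (X 0 ω) * g (X i ω) ∂P with hγ
  set m₁ := ∫ x, |g x| ∂μ with hm₁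
  have hm₁0 : 0 ≤ m₁ := integral_nonneg fun _ => abs_nonneg _
  have hgm := hg3.1
  have hgi : ∀ i, Integrable (fun ω => g (X i ω)) P := fun i =>
    (hX.measurePreserving i).integrable_comp_of_integrable hg3.integrable
  have hg0' : ∀ i, ∫ ω, g (X i ω) ∂P = 0 := fun i => by rw [hX.integral_comp i hgm, hg0]
  have hshift : ∀ b i, ∫ ω, g (X b ω) * g (X (b + i) ω) ∂P = γ i := fun b i =>
    hX.integral_mul_shift hgm hgm b i
  have hρmul : ∀ {a : ℕ} {ρ : Ω → ℝ}, Measurable[past X a] ρ → (∀ ω, |ρ ω| ≤ 1) →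
      |∫ ω, ρ ω * g (X a ω) ∂P| ≤ m₁ := fun {a ρ} hρ hρ1 => by
    rw [hm₁, ← hX.integral_comp a (h := fun x => |g x|) hgm.abs]
    refine abs_integral_le_integral_abs.trans (integral_mono_of_nonneg
      (ae_of_all _ fun _ => abs_nonneg _) (hgi a).abs (ae_of_all _ fun ω => ?_))
    beta_reduce
    rw [abs_mul]
    exact mul_le_of_le_one_left (abs_nonneg _) (hρ1 ω)
  have hpow : ∀ d : ℕ, (0:ℝ) ≤ ((d:ℝ) + 1) ^ (-(1 + δ)) := fun d =>
    Real.rpow_nonneg (by positivity) _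
  have hpow1 : ∀ d : ℕ, ((d:ℝ) + 1) ^ (-(1 + δ)) ≤ 1 := fun d =>
    Real.rpow_le_one_of_one_le_of_nonpos (by linarith [Nat.cast_nonneg (α := ℝ) d])
      (by linarith [hδ.1])
  have hsucc : ∀ i : ℕ, 1 ≤ i → (i:ℝ) ^ (-(1 + δ)) ≤ 4 * ((i:ℝ) + 1) ^ (-(1 + δ)) := fun i =>
    natCast_rpow_neg_le (by linarith [hδ.1]) (by linarith [hδ.2])
  have hdecay : ∀ i : ℕ, 1 ≤ i → |γ i| ≤ C * (i:ℝ) ^ (-(1 + δ)) := fun i hi => by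
    have h := hS.last _ h1 _ hg _ hg 0 0 i le_rfl hi (fun _ => 1) measurable_const (by simp)
    simpa [hg0', hγ] using h
  have hlast₁ : ∀ (a d : ℕ) (ρ : Ω → ℝ), Measurable[past X a] ρ → (∀ ω, |ρ ω| ≤ 1) →
      |∫ ω, ρ ω * g (X (a + (d + 1)) ω) ∂P| ≤ C * ((d:ℝ) + 1) ^ (-(1 + δ)) := fun a d ρ hρ hρ1 => by
    have h := hS.last _ h1 _ h1 _ hg a a (d + 1) le_rfl (by omega) ρ hρ hρ1
    simpa [hg0'] using h
  have hlast₂ : ∀ (a d : ℕ) (ρ : Ω → ℝ), Measurable[past X a] ρ → (∀ ω, |ρ ω| ≤ 1) →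
      |∫ ω, ρ ω * (g (X a ω) ^ 2 * g (X (a + (d + 1)) ω)) ∂P| ≤ C * ((d:ℝ) + 1) ^ (-(1 + δ)) :=
    fun a d ρ hρ hρ1 => by
      have h := hS.last _ hg _ hg _ hg a a (d + 1) le_rfl (by omega) ρ hρ hρ1
      simpa [hg0', sq] using h
  have hlast₃ : ∀ (a b i : ℕ) (ρ : Ω → ℝ), a ≤ b → 1 ≤ i → Measurable[past X a] ρ →
      (∀ ω, |ρ ω| ≤ 1) →
      |∫ ω, ρ ω * (g (X a ω) * g (X b ω) * g (X (b + i) ω)) ∂P| ≤ C * (i:ℝ) ^ (-(1 + δ)) :=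
    fun a b i ρ hab hi hρ hρ1 => by
      have h := hS.last _ hg _ hg _ hg a b i hab hi ρ (hρ.mono (past_mono hab) le_rfl) hρ1
      simpa [hg0'] using h
  have hfirst₁ : ∀ (a d i : ℕ) (ρ : Ω → ℝ), Measurable[past X a] ρ → (∀ ω, |ρ ω| ≤ 1) →
      |∫ ω, ρ ω * (g (X (a + (d + 1)) ω) * g (X (a + (d + 1) + i) ω) - γ i) ∂P| ≤
        C * ((d:ℝ) + 1) ^ (-(1 + δ)) := fun a d i ρ hρ hρ1 => by
    have h := hS.first _ h1 _ hg _ hg a (d + 1) i (by omega) ρ hρ hρ1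
    have hρm := hρ.mono (hX.past_le a) le_rfl
    simp only [one_mul, mul_one, hshift] at h
    rw [← integral_mul_const, ← integral_sub (L3.integrable_mul hX hg3 hg3 hρm hρ1 _ _)
      ((Integrable.of_bound hρm.aestronglyMeasurable 1 (ae_of_all _ hρ1)).mul_const _)] at h
    simpa [mul_sub] using h
  have hsplit : ∀ (a d i : ℕ) (ρ : Ω → ℝ), Measurable[past X a] ρ → (∀ ω, |ρ ω| ≤ 1) →
      ∫ ω, ρ ω * (g (X a ω) * (g (X (a + (d + 1)) ω) * g (X (a + (d + 1) + i) ω) - γ i)) ∂P =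
        (∫ ω, ρ ω * (g (X a ω) * g (X (a + (d + 1)) ω) * g (X (a + (d + 1) + i) ω)) ∂P)
          - (∫ ω, ρ ω * g (X a ω) ∂P) * γ i := fun a d i ρ hρ hρ1 => by
    have hρm := hρ.mono (hX.past_le a) le_rfl
    have W : WeightedTriple P μ ρ (X a) (X (a + (d + 1))) (X (a + (d + 1) + i)) :=
      ⟨hρm, hρ1, hX.measurePreserving _, hX.measurePreserving _, hX.measurePreserving _⟩
    rw [← integral_mul_const, ← integral_sub (W.integrable hg3 hg3 hg3)
      (((hgi a).bdd_mul hρm.aestronglyMeasurable (ae_of_all _ hρ1)).mul_const _)]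
    exact integral_congr_ae (ae_of_all _ fun ω => by ring)
  set A := 4 * C * (1 + m₁) with hA
  have hA0 : 0 ≤ A := by positivity
  have hCA : C ≤ A := by nlinarith
  have hboth : ∀ (a d i : ℕ) (ρ : Ω → ℝ), Measurable[past X a] ρ → (∀ ω, |ρ ω| ≤ 1) →
      |∫ ω, ρ ω * (g (X a ω) * (g (X (a + (d + 1)) ω) * g (X (a + (d + 1) + i) ω) - γ i)) ∂P| ≤
        A * (((d:ℝ) + 1) ^ (-((1 + δ) / 2)) * ((i:ℝ) + 1) ^ (-((1 + δ) / 2))) :=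
    fun a d i ρ hρ hρ1 => by
      rw [hsplit a d i ρ hρ hρ1]
      have hf := hS.first _ hg _ hg _ hg a (d + 1) i (by omega) ρ hρ hρ1
      simp only [hshift, Nat.cast_add, Nat.cast_one] at hf
      refine le_mul_rpow_half_of_le hA0 (by positivity) (by positivity)
        (hf.trans (mul_le_mul_of_nonneg_right hCA (hpow d))) ?_
      rcases Nat.eq_zero_or_pos i with rfl | hi
      · refine hf.trans ?_
        simp only [Nat.cast_zero, zero_add, Real.one_rpow]
        exact mul_le_mul hCA (hpow1 d) (hpow d) hA0
      · refine (abs_sub _ _).trans ?_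
        rw [abs_mul]
        have e1 := hlast₃ a (a + (d + 1)) i ρ (by omega) hi hρ hρ1
        have e2 := mul_le_mul (hρmul hρ hρ1) (hdecay i hi) (abs_nonneg _) hm₁0
        calc _ ≤ C * (1 + m₁) * (i:ℝ) ^ (-(1 + δ)) := by linarith
          _ ≤ C * (1 + m₁) * (4 * ((i:ℝ) + 1) ^ (-(1 + δ))) :=
            mul_le_mul_of_nonneg_left (hsucc i hi) (by positivity)
          _ = A * ((i:ℝ) + 1) ^ (-(1 + δ)) := by rw [hA]; ring
  set m₃ := ∫ x, |g x| ^ 3 ∂μ with hm₃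
  have hm₃0 : 0 ≤ m₃ := integral_nonneg fun _ => by positivity
  set C' := A + 4 * C + m₃ + |γ 0| with hC'
  have hγ0 := abs_nonneg (γ 0)
  have hCC' : C ≤ C' := by linarith
  have hAC' : A ≤ C' := by linarith
  have unit : ∀ {a d : ℕ} {Z : Ω → ℝ},
      (∀ ρ : Ω → ℝ, Measurable[past X a] ρ → (∀ ω, |ρ ω| ≤ 1) →
        |∫ ω, ρ ω * Z ω ∂P| ≤ C * ((d:ℝ) + 1) ^ (-(1 + δ))) →
      ∀ (ρ : Ω → ℝ) (r : ℝ), Measurable[past X a] ρ → (∀ ω, |ρ ω| ≤ r) →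
        |∫ ω, ρ ω * Z ω ∂P| ≤ r * (C' * ((d:ℝ) + 1) ^ (-(1 + δ))) :=
    fun {a d Z} h ρ r hρ hr => abs_integral_mul_le_of_unit (fun ρ' hρ' hρ'1 =>
      (h ρ' hρ' hρ'1).trans (mul_le_mul_of_nonneg_right hCC' (hpow d))) hρ hr
  refine ⟨C', ?_⟩
  constructor
  · exact past_mono.comp fun _ _ h => Nat.succ_le_succ h
  · exact fun i => hX.past_le _
  · exact fun i => hgm.comp (measurable_past le_rfl)
  · exact fun i => (hX.measurePreserving _).integrable_comp_of_integrable hg3.2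
  · intro i
    rw [hX.integral_comp (i + 1) (h := fun x => |g x| ^ 3) (hgm.abs.pow_const 3)]
    linarith
  · exact fun i => hg0' _
  · intro b i
    rw [add_right_comm]
    exact hshift (b + 1) i
  · intro i
    rcases Nat.eq_zero_or_pos i with rfl | hi
    · simp only [Nat.cast_zero, zero_add, Real.one_rpow, mul_one]
      linarith
    · calc |γ i| ≤ C * (4 * ((i:ℝ) + 1) ^ (-(1 + δ))) :=
            (hdecay i hi).trans (mul_le_mul_of_nonneg_left (hsucc i hi) hC)
        _ = 4 * C * ((i:ℝ) + 1) ^ (-(1 + δ)) := by ring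
        _ ≤ _ := mul_le_mul_of_nonneg_right (by linarith) (hpow i)
  · intro a d ρ r hρ hr
    rw [show a + d + 1 + 1 = a + 1 + (d + 1) by ring]
    exact unit (fun ρ' => hlast₁ (a + 1) d ρ') ρ r hρ hr
  · intro a d ρ r hρ hr
    rw [show a + d + 1 + 1 = a + 1 + (d + 1) by ring]
    exact unit (fun ρ' => hlast₂ (a + 1) d ρ') ρ r hρ hr
  · intro a d i ρ r hρ hr
    rw [show a + d + 1 + 1 = a + 1 + (d + 1) by ring,
      show a + d + 1 + i + 1 = a + 1 + (d + 1) + i by ring]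
    exact unit (fun ρ' => hfirst₁ (a + 1) d i ρ') ρ r hρ hr
  · intro a d i ρ r hρ hr
    rw [show a + d + 1 + 1 = a + 1 + (d + 1) by ring,
      show a + d + 1 + i + 1 = a + 1 + (d + 1) + i by ring]
    exact abs_integral_mul_le_of_unit (fun ρ' hρ' hρ'1 =>
      (hboth (a + 1) d i ρ' hρ' hρ'1).trans (mul_le_mul_of_nonneg_right hAC'
        (mul_nonneg (Real.rpow_nonneg (by positivity) _)
          (Real.rpow_nonneg (by positivity) _)))) hρ hr

end WeakDependence

section Assembly

variable {Ω : Type*} [m0 : MeasurableSpace Ω] {P : Measure Ω} [IsProbabilityMeasure P]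

lemma LipschitzWith.inv_mul_comp_mul {h : ℝ → ℝ} (hh : LipschitzWith 1 h) {s : ℝ} (hs : 0 < s) :
    LipschitzWith 1 fun x => s⁻¹ * h (s * x) := by
  refine LipschitzWith.of_dist_le_mul fun x y => ?_
  have h1 := hh.dist_le_mul (s * x) (s * y)
  simp only [Real.dist_eq, NNReal.coe_one, one_mul] at h1 ⊢
  rw [← mul_sub, abs_mul, abs_of_pos hs] at h1
  rwa [← mul_sub, abs_mul, abs_of_pos (inv_pos.2 hs), inv_mul_le_iff₀ hs]

namespace WeakDep

variable {Y : ℕ → Ω → ℝ} {𝓕 : ℕ → MeasurableSpace Ω} {γ : ℕ → ℝ} {C δ : ℝ}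

/-- The rate of convergence of the normalised sums, for Lipschitz test functions. -/
lemma exists_lipschitz_bound_normalized (hY : WeakDep P Y 𝓕 γ C δ) (hδ : δ ∈ Ioo (0:ℝ) 1) :
    ∃ D, ∀ n : ℕ, 1 ≤ n → ∀ h : ℝ → ℝ, LipschitzWith 1 h →
      |∫ ω, h ((n:ℝ) ^ (-(1:ℝ) / 2) * psum Y n ω) ∂P
        - ∫ x, h x ∂gaussianReal 0 (limVar γ).toNNReal| ≤ D * (n:ℝ) ^ (-(δ / 2)) := by
  obtain ⟨D, hD⟩ := hY.exists_lipschitz_bound hδ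
  refine ⟨D, fun n hn h hh => ?_⟩
  have hn0 : (0:ℝ) < n := by exact_mod_cast hn
  set s : ℝ := (n:ℝ) ^ (-(1:ℝ) / 2) with hs
  have hs0 : 0 < s := Real.rpow_pos_of_pos hn0 _
  have hsq : s ^ 2 * n = 1 := by
    rw [hs, ← Real.rpow_natCast, ← Real.rpow_mul hn0.le]
    norm_num
    rw [Real.rpow_neg_one, inv_mul_cancel₀ hn0.ne']
  have h1 := hD n hn _ (LipschitzWith.inv_mul_comp_mul hh hs0)
  have hmap : (gaussianReal 0 ((limVar γ).toNNReal * n)).map (s * ·)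
      = gaussianReal 0 (limVar γ).toNNReal := by
    rw [gaussianReal_map_const_mul, mul_zero]
    congr 1
    ext
    push_cast
    calc s ^ 2 * (((limVar γ).toNNReal : ℝ) * n) = (limVar γ).toNNReal * (s ^ 2 * n) := by ring
      _ = _ := by rw [hsq, mul_one]
  have hG : ∫ x, h (s * x) ∂gaussianReal 0 ((limVar γ).toNNReal * n)
      = ∫ x, h x ∂gaussianReal 0 (limVar γ).toNNReal := by
    rw [← hmap, integral_map (by fun_prop) hh.continuous.aestronglyMeasurable]
  rw [integral_const_mul, integral_const_mul, hG, ← mul_sub, abs_mul,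
    abs_of_pos (inv_pos.2 hs0), inv_mul_le_iff₀ hs0] at h1
  refine h1.trans (le_of_eq ?_)
  rw [hs, mul_left_comm, ← Real.rpow_add hn0]
  ring_nf

end WeakDep

lemma Kop_iterate_congr {μ : Measure ℝ} {K : Kernel ℝ ℝ} (hinv : μ.bind (fun x => K x) = μ)
    {f g : ℝ → ℝ} (h : f =ᵐ[μ] g) (m : ℕ) : (Kop K)^[m] f =ᵐ[μ] (Kop K)^[m] g := by
  induction m generalizing f g with
  | zero => exact h
  | succ m ih =>
    refine ih ?_
    have h' : f =ᵐ[μ.bind K] g := by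
      have e : μ.bind K = μ := hinv
      rwa [e]
    filter_upwards [Measure.ae_ae_of_ae_comp h'] with x hx
    exact integral_congr_ae hx

/-- The covariances of a centred observable in terms of the transition operator. -/
lemma StatMarkov.integral_mul_sub_const {X : ℕ → Ω → ℝ} {μ : Measure ℝ} [IsProbabilityMeasure μ]
    {K : Kernel ℝ ℝ} [IsMarkovKernel K] (hX : StatMarkov P X μ K) {F : ℝ → ℝ} {m : ℝ}
    (hg3 : L3 μ fun x => F x - m) (hg0 : ∫ x, (F x - m) ∂μ = 0) (i : ℕ) :
    ∫ ω, (F (X 0 ω) - m) * (F (X i ω) - m) ∂P = ∫ x, (F x - m) * (Kop K)^[i] F x ∂μ := by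
  have hm : L3 μ fun _ => m := L3.of_bounded measurable_const (C := |m|) (by simp)
  have hF3 : L3 μ F := by simpa using hg3.add hm
  have hint := L3.integrable_mul hX hg3 hF3 (ρ := fun _ => 1) measurable_const (r := 1)
    (by simp) 0 (0 + i)
  simp only [one_mul] at hint
  have hmi : Integrable (fun ω => (F (X 0 ω) - m) * m) P :=
    ((hX.measurePreserving 0).integrable_comp_of_integrable hg3.integrable).mul_const m
  have h := hX.integral_mul_iterate hF3.1 hF3.integrable (n := 0) i
    (ρ := fun ω => F (X 0 ω) - m) (hg3.1.comp (measurable_past le_rfl)) hint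
  rw [hX.integral_comp 0 (h := fun x => (F x - m) * (Kop K)^[i] F x)
    (hg3.1.mul (Kop_iterate_measurable hF3.1 i))] at h
  rw [zero_add] at h hint
  rw [← h]
  simp only [mul_sub (_ - m)]
  rw [integral_sub hint hmi, integral_mul_const, hX.integral_comp 0 hg3.1, hg0, zero_mul, sub_zero]

end Assembly

/-- Theorem 4(3): for a stationary Markov chain, if
`f ∈ C(M,p,μ)` with `p ∈ (3,∞]` and `α_2(k) = O(k^{−(1+δ)p/(p−3)})` for some
`δ ∈ (0,1)`, then for every concave `c` with `c(0)=0`,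
`d_c(P_n(f), G_{σ²(f)}) = O(c(n^{−δ/2}))`.  For `p = ∞`, `p/(p−3)` is read as
`1`, which is how `((1 − 3/p)⁻¹).toReal` behaves. -/
theorem statement14 {Ω : Type*} [MeasurableSpace Ω] (P : Measure Ω)
    [IsProbabilityMeasure P] (X : ℕ → Ω → ℝ) (hXm : ∀ i, Measurable (X i))
    (μ : Measure ℝ) [IsProbabilityMeasure μ]
    (K : Kernel ℝ ℝ) [IsMarkovKernel K] (hinv : μ.bind (fun x => K x) = μ)
    (hX0 : Measure.map (X 0) P = μ)
    (hMarkov : ∀ n : ℕ, ∀ g : ℝ → ℝ, Measurable g → (∃ C, ∀ x, |g x| ≤ C) →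
      P[fun ω => g (X (n + 1) ω)
          | MeasurableSpace.comap (fun ω => fun i : Fin (n + 1) => X i.1 ω) inferInstance]
        =ᵐ[P] fun ω => Kop K g (X n ω))
    (hstat : ∀ k n : ℕ,
      Measure.map (fun ω => fun i : Fin n => X (i.1 + k) ω) P
        = Measure.map (fun ω => fun i : Fin n => X i.1 ω) P)
    (M : ℝ) (hM : 0 < M) (p : ℝ≥0∞) (hp : 3 < p)
    (f : ℝ → ℝ) (hf : ClassC M p μ f)
    (δ : ℝ) (hδ : δ ∈ Set.Ioo (0:ℝ) 1)
    (halpha : ∃ B : ℝ, ∀ k : ℕ, 1 ≤ k →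
      alphaCoef (Kop K) μ 2 k
        ≤ B * (k : ℝ) ^ (-((1 + δ) * (((1:ℝ≥0∞) - 3 / p)⁻¹).toReal))) :
    ∀ c : ℝ → ℝ, ConcaveOn ℝ (Set.Ici (0:ℝ)) c → c 0 = 0 →
      (∀ x : ℝ, 0 ≤ x → 0 ≤ c x) →
      ∃ B : ℝ, ∀ n : ℕ, 1 ≤ n →
        dC c (Measure.map (fun ω => (n : ℝ) ^ (-(1:ℝ)/2) *
            ∑ i ∈ Finset.range n, (f (X (i + 1) ω) - ∫ y, f y ∂μ)) P)
          (gaussianReal 0 (Real.toNNReal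
            ((∫ x, (f x - ∫ y, f y ∂μ) ^ 2 ∂μ) +
              2 * ∑' k : ℕ, ∫ x, (f x - ∫ y, f y ∂μ) * (Kop K)^[k + 1] f x ∂μ)))
          ≤ B * c ((n : ℝ) ^ (-(δ/2))) := by
  intro c hc hc0 hcn
  have hX : StatMarkov P X μ K := ⟨hXm, hinv, hX0, hMarkov, hstat⟩
  set m := ∫ y, f y ∂μ with hm
  set F := hf.1.aestronglyMeasurable.mk f with hF
  have hFm : Measurable F := hf.1.aestronglyMeasurable.stronglyMeasurable_mk.measurable
  have hfF : f =ᵐ[μ] F := hf.1.aestronglyMeasurable.ae_eq_mk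
  set M' := (1 + |m|) * max M 1 with hM'
  have hM1 : 1 ≤ M' :=
    one_le_mul_of_one_le_of_one_le (by linarith [abs_nonneg m]) (le_max_right _ _)
  obtain ⟨h3, C, hC, hS⟩ := hX.exists_decouples (lt_of_lt_of_le one_pos hM1) hp
    (by linarith [hδ.1] : 0 < 1 + δ) halpha
  have hgm : Measurable fun x => F x - m := hFm.sub_const m
  have hgC : ClassC M' p μ fun x => F x - m := (hf.congr hfF).sub_const hM m
  have hg3 := h3 _ hgm hgC
  have hg0 : ∫ x, (F x - m) ∂μ = 0 := by
    rw [integral_sub (hf.1.congr hfF) (integrable_const _), ← integral_congr_ae hfF, ← hm]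
    simp
  obtain ⟨C', hY⟩ := hX.exists_weakDep hδ hC hS ⟨hgm, hgC⟩
    ⟨measurable_const, ClassC.one hM1⟩ hg3 hg0
  obtain ⟨D, hD⟩ := hY.exists_lipschitz_bound_normalized hδ
  have hvar : (∫ x, (f x - m) ^ 2 ∂μ) + 2 * ∑' k : ℕ, ∫ x, (f x - m) * (Kop K)^[k + 1] f x ∂μ
      = WeakDep.limVar fun i => ∫ ω, (F (X 0 ω) - m) * (F (X i ω) - m) ∂P := by
    rw [WeakDep.limVar]
    congr 1
    · have h := hX.integral_comp 0 (h := fun x => (F x - m) * (F x - m)) (hgm.mul hgm)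
      rw [h]
      refine integral_congr_ae ?_
      filter_upwards [hfF] with x hx
      rw [hx, sq]
    · refine congrArg (2 * ·) (tsum_congr fun k => ?_)
      rw [hX.integral_mul_sub_const hg3 hg0]
      refine integral_congr_ae ?_
      filter_upwards [hfF, Kop_iterate_congr hinv hfF (k + 1)] with x hx hx'
      rw [hx, hx']
  rw [hvar]
  refine ⟨4 + D, fun n hn => ?_⟩
  have hlaw : (fun ω => (n : ℝ) ^ (-(1:ℝ)/2) * ∑ i ∈ Finset.range n, (f (X (i + 1) ω) - m))
      =ᵐ[P] fun ω => (n : ℝ) ^ (-(1:ℝ)/2) *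
        WeakDep.psum (fun i ω => F (X (i + 1) ω) - m) n ω := by
    have h : ∀ᵐ ω ∂P, ∀ i, f (X i ω) = F (X i ω) := ae_all_iff.2 fun i =>
      (hX.measurePreserving i).quasiMeasurePreserving.ae_eq_comp hfF
    filter_upwards [h] with ω hω
    simp only [WeakDep.psum, hω]
  rw [Measure.map_congr hlaw]
  have hpm := (hY.measurable_psum n).const_mul ((n : ℝ) ^ (-(1:ℝ)/2))
  have := Measure.isProbabilityMeasure_map (μ := P) hpm.aemeasurable
  refine dC_le_of_lipschitz ?_ (integrable_id_gaussianReal _ _) (fun h hh => ?_) hc hc0 hcn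
    (Real.rpow_pos_of_pos (by exact_mod_cast hn) _) le_rfl
  · rw [integrable_map_measure (by fun_prop) hpm.aemeasurable]
    exact (hY.integrable_psum n).const_mul _
  · rw [integral_map hpm.aemeasurable hh.continuous.aestronglyMeasurable]
    exact hD n hn h hh

end
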